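/- arXiv:1703.02916 — 4 statements merged into one kernel-verified Lean document; each statement's English description precedes it below -/
import Mathlib

section
/- Let m₁ ≥ 1 and m₂ ≥ 0 be integers and ρ = m₁/2 + m₂. For every λ₀ ∈ ℂ with 2λ₀ ∉ {−1,−2,−3,…} there exist an open neighbourhood U of λ₀ contained in {λ ∈ ℂ : 2λ ∉ {−1,−2,−3,…}}, a radius ε ∈ (0,1), and a function H : ℂ × ℂ → ℂ which is complex-analytic on the product U × ball(0,ε) ⊆ ℂ², satisfies H(λ,0) = 1 for all λ ∈ U, and is such that for every λ ∈ U the function w_λ(y) = y^{ρ+λ}·H(λ,y) satisfies y²·w_λ''(y) + (1 − 2ρ − r(y))·y·w_λ'(y) + (ρ² − λ²)·w_λ(y) = 0 for all y ∈ (0,ε) (derivatives taken in the real variable y). -/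
open Set Filter Topology

noncomputable section

/-- `ρ = m₁/2 + m₂`. -/
def rho (m₁ m₂ : ℕ) : ℝ := m₁ / 2 + m₂

/-- `r(y) = 2m₁y²/(1−y²) + 4m₂y⁴/(1−y⁴)`. -/
def rFun (m₁ m₂ : ℕ) (y : ℝ) : ℝ :=
  2 * m₁ * y ^ 2 / (1 - y ^ 2) + 4 * m₂ * y ^ 4 / (1 - y ^ 4)

/-- The radial eigenvalue equation in the boundary coordinate `y`:
`y²w'' + (1 − 2ρ − r(y))yw' + (ρ² − λ²)w = 0`. -/
def RadialODE (m₁ m₂ : ℕ) (lam : ℂ) (w : ℝ → ℂ) (y : ℝ) : Prop :=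
  (y : ℂ) ^ 2 * deriv (deriv w) y
    + (1 - 2 * (rho m₁ m₂ : ℂ) - (rFun m₁ m₂ y : ℂ)) * (y : ℂ) * deriv w y
    + ((rho m₁ m₂ : ℂ) ^ 2 - lam ^ 2) * w y = 0

lemma joint_analytic {U : Set ℂ} (hU : IsOpen U) (b : ℕ → ℂ → ℂ)
    (hb : ∀ k, DifferentiableOn ℂ (b k) U) {M : ℝ} (hM : 1 ≤ M)
    (hbd : ∀ k, ∀ l ∈ U, ‖b k l‖ ≤ M ^ k) {ε : ℝ} (hε : ε = 1 / (8 * M)) :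
    ∀ p ∈ U ×ˢ Metric.ball (0 : ℂ) ε,
      AnalyticAt ℂ (fun p : ℂ × ℂ => ∑' k, b k p.1 * p.2 ^ (2 * k)) p := by
  let E := lp (fun _ : ℕ => ℂ) 2
  let e : ℕ → E := fun k => lp.single 2 k (1 : ℂ)
  let φ : ℕ → (E →L[ℂ] ℂ) := fun k => innerSL ℂ (e k)
  have he : ∀ k, ‖e k‖ = 1 := fun k => by
    simp only [e]; rw [lp.norm_single (by norm_num)]; simp
  have hφ : ∀ k, ‖φ k‖ = 1 := fun k => by simp only [φ]; rw [innerSL_apply_norm, he]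
  have hφe : ∀ j k, φ j (e k) = if j = k then 1 else 0 := fun j k => by
    simp only [φ, e, innerSL_apply_apply]
    rw [lp.inner_single_left]
    simp [lp.single_apply, Pi.single_apply]
  have hM0 : 0 < M := by linarith
  have hMc : (M : ℂ) ≠ 0 := by exact_mod_cast hM0.ne'
  let G : ℕ → ℂ → E := fun k l => (b k l * (1 / (2 * M)) ^ k) • e k
  let Φ : ℕ → ℂ → (E →L[ℂ] ℂ) := fun k y => ((2 * M * y ^ 2) ^ k) • φ k
  have hgeo : Summable (fun k : ℕ => (1 / 2 : ℝ) ^ k) := summable_geometric_two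
  have hGb : ∀ k, ∀ l ∈ U, ‖G k l‖ ≤ (1 / 2 : ℝ) ^ k := by
    intro k l hl
    simp only [G]
    rw [norm_smul, he, mul_one, norm_mul, norm_pow]
    have : ‖(1 / (2 * M) : ℂ)‖ = 1 / (2 * M) := by
      rw [norm_div, norm_mul]; simp [abs_of_pos hM0]
    rw [this]
    calc ‖b k l‖ * (1 / (2 * M)) ^ k ≤ M ^ k * (1 / (2 * M)) ^ k := by
          gcongr; exact hbd k l hl
      _ = (1 / 2 : ℝ) ^ k := by rw [← mul_pow]; congr 1; field_simp
  have hsmall : ∀ y ∈ Metric.ball (0 : ℂ) ε, ‖(2 * M * y ^ 2 : ℂ)‖ ≤ 1 / 2 := by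
    intro y hy
    rw [mem_ball_zero_iff] at hy
    rw [norm_mul, norm_mul, norm_pow]
    simp only [Complex.norm_ofNat, Complex.norm_real, Real.norm_eq_abs, abs_of_pos hM0]
    have h1 : M * ε = 1 / 8 := by rw [hε]; field_simp
    have h2 : ε ≤ 1 := by rw [hε, div_le_one (by positivity)]; linarith
    have h3 : ‖y‖ ^ 2 ≤ ε := by nlinarith [norm_nonneg y]
    nlinarith
  have hΦb : ∀ k, ∀ y ∈ Metric.ball (0 : ℂ) ε, ‖Φ k y‖ ≤ (1 / 2 : ℝ) ^ k := by
    intro k y hy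
    simp only [Φ]
    rw [norm_smul, hφ, mul_one, norm_pow]
    exact pow_le_pow_left₀ (norm_nonneg _) (hsmall y hy) k
  have hGd : DifferentiableOn ℂ (fun l => ∑' k, G k l) U :=
    Complex.differentiableOn_tsum_of_summable_norm hgeo
      (fun k => ((hb k).mul_const _).smul_const _) hU hGb
  have hΦd : DifferentiableOn ℂ (fun y => ∑' k, Φ k y) (Metric.ball (0 : ℂ) ε) :=
    Complex.differentiableOn_tsum_of_summable_norm hgeo
      (fun k => by
        apply DifferentiableOn.smul_const
        fun_prop) Metric.isOpen_ball hΦb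
  have key : ∀ p ∈ U ×ˢ Metric.ball (0 : ℂ) ε,
      ∑' k, b k p.1 * p.2 ^ (2 * k) = (∑' k, Φ k p.2) (∑' k, G k p.1) := by
    rintro ⟨l, y⟩ ⟨hl, hy⟩
    have sΦ : Summable (fun k => Φ k y) :=
      Summable.of_norm_bounded hgeo (fun k => hΦb k y hy)
    have sG : Summable (fun k => G k l) :=
      Summable.of_norm_bounded hgeo (fun k => hGb k l hl)
    have h1 : (∑' k, Φ k y) (∑' k, G k l) = ∑' k, (Φ k y) (∑' k, G k l) :=
      (ContinuousLinearMap.apply ℂ ℂ (∑' k, G k l)).map_tsum sΦ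
    have h2 : ∀ j, φ j (∑' k, G k l) = b j l * (1 / (2 * M)) ^ j := by
      intro j
      rw [(φ j).map_tsum sG, tsum_eq_single j]
      · simp [G, hφe]
      · intro k hk
        simp [G, hφe, hk.symm]
    rw [h1]
    refine tsum_congr fun j => ?_
    simp only [Φ, smul_apply, h2, smul_eq_mul]
    rw [pow_mul, mul_left_comm, ← mul_pow]
    congr 2
    field_simp
  intro p hp
  have hopen : IsOpen (U ×ˢ Metric.ball (0 : ℂ) ε) := hU.prod Metric.isOpen_ball
  have hG' : AnalyticAt ℂ (fun p : ℂ × ℂ => ∑' k, G k p.1) p :=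
    (hGd.analyticAt (hU.mem_nhds hp.1)).fun_comp analyticAt_fst
  have hΦ' : AnalyticAt ℂ (fun p : ℂ × ℂ => ∑' k, Φ k p.2) p :=
    (hΦd.analyticAt (Metric.isOpen_ball.mem_nhds hp.2)).fun_comp analyticAt_snd
  have := AnalyticAt.comp₂ (f := fun p : ℂ × ℂ => ∑' k, Φ k p.2)
    (g := fun p : ℂ × ℂ => ∑' k, G k p.1)
    ((ContinuousLinearMap.id ℂ (E →L[ℂ] ℂ)).analyticAt_bilinear _) hΦ' hG'
  refine this.congr ?_
  filter_upwards [hopen.mem_nhds hp] with q hq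
  exact (key q hq).symm

lemma theta_series (c : ℕ → ℂ) {C M : ℝ} (hM : 1 ≤ M) (hc : ∀ k, ‖c k‖ ≤ C * M ^ k)
    {ε : ℝ} (hε : ε ^ 2 * M ≤ 1 / 2) {y : ℂ} (hy : ‖y‖ < ε) :
    Summable (fun k => c k * y ^ (2 * k)) ∧
    DifferentiableAt ℂ (fun z => ∑' k, c k * z ^ (2 * k)) y ∧
    y * deriv (fun z => ∑' k, c k * z ^ (2 * k)) y = ∑' k, (2 * k * c k) * y ^ (2 * k) := by
  have hgeo : Summable (fun k : ℕ => C * (1 / 2 : ℝ) ^ k) := summable_geometric_two.mul_left C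
  have hb : ∀ k : ℕ, ∀ z ∈ Metric.ball (0 : ℂ) ε, ‖c k * z ^ (2 * k)‖ ≤ C * (1 / 2) ^ k := by
    intro k z hz
    rw [mem_ball_zero_iff] at hz
    rw [norm_mul, norm_pow, pow_mul]
    have h1 : M * ‖z‖ ^ 2 ≤ 1 / 2 := by
      have : ‖z‖ ^ 2 ≤ ε ^ 2 := pow_le_pow_left₀ (norm_nonneg _) hz.le 2
      nlinarith
    have hC : 0 ≤ C := by simpa using (norm_nonneg _).trans (hc 0)
    calc ‖c k‖ * (‖z‖ ^ 2) ^ k ≤ C * M ^ k * (‖z‖ ^ 2) ^ k := by gcongr; exact hc k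
      _ = C * (M * ‖z‖ ^ 2) ^ k := by rw [mul_pow]; ring
      _ ≤ _ := by gcongr
  have hym : y ∈ Metric.ball (0 : ℂ) ε := by rwa [mem_ball_zero_iff]
  have hd : ∀ k : ℕ, DifferentiableOn ℂ (fun z : ℂ => c k * z ^ (2 * k)) (Metric.ball 0 ε) :=
    fun k => by fun_prop
  refine ⟨Summable.of_norm_bounded hgeo fun k => hb k y hym, ?_, ?_⟩
  · exact (Complex.differentiableOn_tsum_of_summable_norm hgeo hd
      Metric.isOpen_ball hb).differentiableAt (Metric.isOpen_ball.mem_nhds hym)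
  · have := Complex.hasSum_deriv_of_summable_norm hgeo hd Metric.isOpen_ball hb hym
    rw [← this.tsum_eq, ← tsum_mul_left]
    refine tsum_congr fun k => ?_
    rw [deriv_const_mul _ (by fun_prop)]
    simp only [deriv_pow_field]
    rcases k with _ | k
    · simp
    · have : 2 * (k + 1) = (2 * (k + 1) - 1) + 1 := by omega
      conv_rhs => rw [this, pow_succ]
      push_cast; ring

/-- Coefficients of the Frobenius series in `y ^ 2`. -/
def bseq (A B s l : ℂ) : ℕ → ℂ
  | 0 => 1
  | 1 => A * s / (2 * (2 + 2 * l))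
  | (k + 2) => (A * (2 * k + 2 + s) * bseq A B s l (k + 1)
      + (2 * k * (2 * k + 2 * l) + B * (2 * k + s)) * bseq A B s l k)
      / ((2 * k + 4) * (2 * k + 4 + 2 * l))

set_option maxHeartbeats 1000000 in
lemma bseq_bound {A B S L c : ℝ} (hA : 0 ≤ A) (hB : 0 ≤ B) (hc : 0 < c) {s l : ℂ}
    (hs : ‖s‖ ≤ S) (hl : ‖2 * l‖ ≤ L) (hden : ∀ n : ℕ, c * (n + 1) ≤ ‖(n : ℂ) + 1 + 2 * l‖) (k : ℕ) :
    ‖bseq A B s l k‖ ≤ (1 + A * (1 + S) / c + ((1 + L) + B * (1 + S)) / c) ^ k := by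
  have hS : 0 ≤ S := (norm_nonneg _).trans hs
  have hL : 0 ≤ L := (norm_nonneg _).trans hl
  set K₁ := A * (1 + S) / c with hK₁
  set K₂ := ((1 + L) + B * (1 + S)) / c with hK₂
  have h1 : 0 ≤ K₁ := by positivity
  have h2 : 0 ≤ K₂ := by positivity
  have hK1c : K₁ * c = A * (1 + S) := by rw [hK₁]; field_simp
  have hK2c : K₂ * c = (1 + L) + B * (1 + S) := by rw [hK₂]; field_simp
  induction k using Nat.twoStepInduction with
  | zero => simp [bseq]
  | one =>
    rw [bseq, pow_one, norm_div, norm_mul, norm_mul]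
    have hd := hden 1
    norm_num at hd
    simp only [Complex.norm_real, Real.norm_eq_abs, abs_of_nonneg hA, Complex.norm_ofNat]
    have hd0 : 0 < ‖2 + 2 * l‖ := by linarith
    rw [div_le_iff₀ (by positivity)]
    have : A * ‖s‖ ≤ A * (1 + S) := by gcongr; linarith
    have : K₁ * c ≤ K₁ * ‖2 + 2 * l‖ := by gcongr; linarith
    nlinarith
  | more k ih0 ih1 =>
    set M := 1 + K₁ + K₂ with hM
    have hk : (0 : ℝ) ≤ k := Nat.cast_nonneg k
    rw [bseq, norm_div, norm_mul]
    have hd := hden (2 * k + 3)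
    have hn4 : ‖(2 * k + 4 : ℂ)‖ = 2 * k + 4 := by
      have : (2 * k + 4 : ℂ) = ((2 * k + 4 : ℝ) : ℂ) := by push_cast; ring
      rw [this, Complex.norm_real, Real.norm_eq_abs, abs_of_nonneg (by positivity)]
    have hn2 : ‖(2 * k + 2 : ℂ)‖ = 2 * k + 2 := by
      have : (2 * k + 2 : ℂ) = ((2 * k + 2 : ℝ) : ℂ) := by push_cast; ring
      rw [this, Complex.norm_real, Real.norm_eq_abs, abs_of_nonneg (by positivity)]
    have hn0 : ‖(2 * k : ℂ)‖ = 2 * k := by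
      have : (2 * k : ℂ) = ((2 * k : ℝ) : ℂ) := by push_cast; ring
      rw [this, Complex.norm_real, Real.norm_eq_abs, abs_of_nonneg (by positivity)]
    have hnA : ‖(A : ℂ)‖ = A := by simp [abs_of_nonneg hA]
    have hnB : ‖(B : ℂ)‖ = B := by simp [abs_of_nonneg hB]
    have hd' : c * (2 * k + 4) ≤ ‖(2 * k + 4 + 2 * l : ℂ)‖ := by
      convert hd using 2
      · push_cast; ring
      · push_cast; ring
    set N : ℝ := 2 * k + 4 with hN
    have hN4 : 4 ≤ N := by linarith
    have hNN : N ≤ N ^ 2 := by nlinarith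
    have hN1 : 1 ≤ N ^ 2 := by linarith
    have hSN : S ≤ S * N ^ 2 := le_mul_of_one_le_right hS hN1
    have hLN : L ≤ L * N := le_mul_of_one_le_right hL (by linarith)
    rw [hn4]
    have hD : c * N ^ 2 ≤ N * ‖(2 * k + 4 + 2 * l : ℂ)‖ := by
      calc c * N ^ 2 = N * (c * N) := by ring
        _ ≤ _ := by gcongr
    have hDpos : 0 < c * N ^ 2 := by positivity
    rw [div_le_iff₀ (hDpos.trans_le hD)]
    have hc1 : ‖A * (2 * k + 2 + s)‖ ≤ K₁ * (c * N ^ 2) := by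
      rw [norm_mul, hnA]
      have : ‖2 * (k : ℂ) + 2 + s‖ ≤ (1 + S) * N ^ 2 := by
        refine (norm_add_le _ _).trans ?_
        rw [hn2]
        linarith
      calc A * ‖2 * (k : ℂ) + 2 + s‖ ≤ A * ((1 + S) * N ^ 2) := by gcongr
        _ = _ := by rw [← mul_assoc K₁, hK1c]; ring
    have hc2 : ‖(2 * k * (2 * k + 2 * l) + B * (2 * k + s) : ℂ)‖ ≤ K₂ * (c * N ^ 2) := by
      refine (norm_add_le _ _).trans ?_
      rw [norm_mul, norm_mul (B : ℂ), hnB, hn0]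
      have e1 : ‖2 * (k : ℂ) + 2 * l‖ ≤ (1 + L) * N := by
        refine (norm_add_le _ _).trans ?_
        rw [hn0]
        linarith
      have e2 : ‖2 * (k : ℂ) + s‖ ≤ (1 + S) * N ^ 2 := by
        refine (norm_add_le _ _).trans ?_
        rw [hn0]
        linarith
      calc 2 * (k : ℝ) * ‖2 * (k : ℂ) + 2 * l‖ + B * ‖2 * (k : ℂ) + s‖
          ≤ N * ((1 + L) * N) + B * ((1 + S) * N ^ 2) := by gcongr; linarith
        _ = _ := by rw [← mul_assoc K₂, hK2c]; ring
    have hM1 : 1 ≤ M := by linarith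
    calc _ ≤ K₁ * (c * N ^ 2) * M ^ (k + 1) + K₂ * (c * N ^ 2) * M ^ k := by
          refine (norm_add_le _ _).trans ?_
          rw [norm_mul (A * (2 * k + 2 + s) : ℂ), norm_mul (2 * k * (2 * k + 2 * l) + B * (2 * k + s) : ℂ)]
          gcongr
      _ = (K₁ * M + K₂) * M ^ k * (c * N ^ 2) := by ring
      _ ≤ (M ^ 2) * M ^ k * (c * N ^ 2) := by
          gcongr
          nlinarith
      _ = M ^ (k + 2) * (c * N ^ 2) := by ring
      _ ≤ _ := by gcongr

lemma bseq_diff {U : Set ℂ} (A B ρ : ℂ)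
    (h : ∀ l ∈ U, ∀ n : ℕ, 2 * l ≠ -((n : ℂ) + 1)) (k : ℕ) :
    DifferentiableOn ℂ (fun l => bseq A B (ρ + l) l k) U := by
  induction k using Nat.twoStepInduction with
  | zero => simp only [bseq]; fun_prop
  | one =>
    simp only [bseq]
    refine DifferentiableOn.fun_div (by fun_prop) (by fun_prop) fun l hl h0 => ?_
    refine h l hl 1 ?_
    push_cast
    linear_combination h0 / 2
  | more k ih0 ih1 =>
    simp only [bseq]
    refine DifferentiableOn.fun_div (by fun_prop) (by fun_prop) fun l hl h0 => ?_
    refine h l hl (2 * k + 3) ?_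
    have h4 : (2 * k + 4 : ℂ) ≠ 0 := by exact_mod_cast (by omega : 2 * k + 4 ≠ 0)
    have := (mul_eq_zero.1 h0).resolve_left h4
    push_cast
    linear_combination this

lemma nat_le_two_pow_real (k : ℕ) : (k : ℝ) ≤ 2 ^ k := by
  exact_mod_cast Nat.lt_two_pow_self.le

lemma ode_of_theta (m₁ m₂ : ℕ) (l : ℂ) (h : ℂ → ℂ) (h1 : ℂ → ℂ) (S2 : ℂ) {ε y : ℝ}
    (hy : y ∈ Ioo 0 ε) (hε : ε ≤ 1)
    (hd : ∀ z ∈ Ioo 0 ε, DifferentiableAt ℂ h (z : ℝ))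
    (hh1 : ∀ z : ℝ, z ∈ Ioo 0 ε → (z : ℂ) * deriv h z = h1 z)
    (hd1 : DifferentiableAt ℂ h1 y) (hh2 : (y : ℂ) * deriv h1 y = S2)
    (heq : (1 - (y : ℂ) ^ 4) * (S2 + 2 * l * h1 y) =
      (2 * m₁ * y ^ 2 + (2 * m₁ + 4 * m₂) * y ^ 4) * (h1 y + (rho m₁ m₂ + l) * h y)) :
    RadialODE m₁ m₂ l (fun z : ℝ => (z : ℂ) ^ ((rho m₁ m₂ : ℂ) + l) * h z) y := by
  set ρ : ℂ := (rho m₁ m₂ : ℂ) with hρ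
  set s := ρ + l with hs
  have hpow : ∀ (t : ℂ) (z : ℝ), 0 < z →
      HasDerivAt (fun x : ℝ => (x : ℂ) ^ t) (t * (z : ℂ) ^ (t - 1)) z := by
    intro t z hz
    have : HasDerivAt (fun x : ℂ => x ^ t) (t * (z : ℂ) ^ (t - 1) * 1) (z : ℂ) :=
      (hasDerivAt_id (z : ℂ)).cpow_const (Or.inl (by simpa using hz))
    simpa using this.comp_ofReal
  have hw1 : ∀ z ∈ Ioo 0 ε, HasDerivAt (fun z : ℝ => (z : ℂ) ^ s * h z)
      ((z : ℂ) ^ (s - 1) * (s * h z + h1 z)) z := by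
    intro z hz
    have hz0 : (z : ℂ) ≠ 0 := by exact_mod_cast hz.1.ne'
    have := (hpow s z hz.1).mul (hd z hz).hasDerivAt.comp_ofReal
    refine this.congr_deriv ?_
    rw [← hh1 z hz]
    have : (z : ℂ) ^ s = (z : ℂ) ^ (s - 1) * z := by
      rw [Complex.cpow_sub _ _ hz0, Complex.cpow_one]; field_simp
    rw [this]; ring
  have hy0 : (y : ℂ) ≠ 0 := by exact_mod_cast hy.1.ne'
  have hev : deriv (fun z : ℝ => (z : ℂ) ^ s * h z) =ᶠ[𝓝 y]
      fun z : ℝ => (z : ℂ) ^ (s - 1) * (s * h z + h1 z) := by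
    filter_upwards [isOpen_Ioo.mem_nhds hy] with z hz using (hw1 z hz).deriv
  have hw2 : HasDerivAt (fun z : ℝ => (z : ℂ) ^ (s - 1) * (s * h z + h1 z))
      ((s - 1) * (y : ℂ) ^ (s - 1 - 1) * (s * h y + h1 y)
        + (y : ℂ) ^ (s - 1) * (s * deriv h y + deriv h1 y)) y :=
    (hpow (s - 1) y hy.1).mul
      (((hd y hy).hasDerivAt.comp_ofReal.const_mul s).add hd1.hasDerivAt.comp_ofReal)
  unfold RadialODE
  rw [hev.deriv_eq, hw2.deriv, (hw1 y hy).deriv]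
  have e1 : (y : ℂ) ^ (s - 1) = (y : ℂ) ^ (s - 1 - 1) * y := by
    rw [Complex.cpow_sub (s - 1) 1 hy0, Complex.cpow_one]; field_simp
  have e2 : (y : ℂ) ^ s = (y : ℂ) ^ (s - 1 - 1) * y * y := by
    rw [← e1, Complex.cpow_sub _ _ hy0, Complex.cpow_one]; field_simp
  have hy1 : y < 1 := hy.2.trans_le hε
  have hy2 : (1 : ℝ) - y ^ 2 ≠ 0 := by nlinarith [hy.1]
  have hy4 : (1 : ℝ) - y ^ 4 ≠ 0 := by
    have : y ^ 4 < 1 := pow_lt_one₀ hy.1.le hy1 (by norm_num)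
    linarith
  have hy4c : (1 : ℂ) - (y : ℂ) ^ 4 ≠ 0 := by exact_mod_cast hy4
  have hr : (1 - (y : ℂ) ^ 4) * (rFun m₁ m₂ y : ℂ) =
      2 * m₁ * y ^ 2 + (2 * m₁ + 4 * m₂) * y ^ 4 := by
    have : (1 - y ^ 4) * rFun m₁ m₂ y = 2 * m₁ * y ^ 2 + (2 * m₁ + 4 * m₂) * y ^ 4 := by
      unfold rFun
      have : 1 - y ^ 4 = (1 - y ^ 2) * (1 + y ^ 2) := by ring
      have h3 : 1 + y ^ 2 ≠ 0 := by positivity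
      rw [this]
      field_simp
      ring
    exact_mod_cast this
  have hmain : S2 + 2 * l * h1 y = (rFun m₁ m₂ y : ℂ) * (h1 y + s * h y) := by
    apply mul_left_cancel₀ hy4c
    rw [heq, ← hr]; ring
  beta_reduce
  rw [← hρ, e1, e2]
  have hh1y := hh1 y hy
  rw [hs] at *
  linear_combination ((y : ℂ) ^ (ρ + l - 1 - 1) * y * y) * hmain
    + ((y : ℂ) ^ (ρ + l - 1 - 1) * y * y) * hh2
    + ((y : ℂ) ^ (ρ + l - 1 - 1) * y * y * (ρ + l)) * hh1y

lemma bseq_ode (A B s l : ℂ) (hl : ∀ n : ℕ, 2 * l ≠ -((n : ℂ) + 1)) (x : ℂ)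
    (h0 : Summable fun k => bseq A B s l k * x ^ k)
    (h1 : Summable fun k : ℕ => (2 * k * bseq A B s l k) * x ^ k)
    (h2 : Summable fun k : ℕ => (2 * k * (2 * k * bseq A B s l k)) * x ^ k) :
    (1 - x ^ 2) * (∑' k : ℕ, (2 * k * (2 * k * bseq A B s l k)) * x ^ k
      + 2 * l * ∑' k : ℕ, (2 * k * bseq A B s l k) * x ^ k) =
    (A * x + B * x ^ 2) * (∑' k : ℕ, (2 * k * bseq A B s l k) * x ^ k
      + s * ∑' k : ℕ, bseq A B s l k * x ^ k) := by
  set b := bseq A B s l with hb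
  let d : ℕ → ℂ := fun k => (2 * k * (2 * k * b k)) * x ^ k + 2 * l * ((2 * k * b k) * x ^ k)
  let e : ℕ → ℂ := fun k => (2 * k * b k) * x ^ k + s * (b k * x ^ k)
  have sd : Summable d := h2.add (h1.mul_left _)
  have se : Summable e := h1.add (h0.mul_left _)
  have D : ∑' k, d k = ∑' k : ℕ, (2 * k * (2 * k * b k)) * x ^ k
      + 2 * l * ∑' k : ℕ, (2 * k * b k) * x ^ k := by
    rw [← tsum_mul_left, ← h2.tsum_add (h1.mul_left _)]
  have E : ∑' k, e k = ∑' k : ℕ, (2 * k * b k) * x ^ k + s * ∑' k : ℕ, b k * x ^ k := by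
    rw [← tsum_mul_left, ← h1.tsum_add (h0.mul_left _)]
  rw [← D, ← E]
  have hd0 : d 0 = 0 := by simp [d]
  have hd1 : d 1 = A * x * e 0 := by
    have : 2 + 2 * l ≠ 0 := fun h => hl 1 (by push_cast; linear_combination h)
    have hb1 : b 1 * (2 * (2 + 2 * l)) = A * s := by
      rw [hb, bseq, div_mul_cancel₀ _ (mul_ne_zero two_ne_zero this)]
    have hb0 : b 0 = 1 := by rw [hb, bseq]
    simp only [d, e, hb0]
    push_cast
    linear_combination x * hb1
  have hrec : ∀ k, d (k + 2) = A * x * e (k + 1) + x ^ 2 * d k + B * x ^ 2 * e k := by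
    intro k
    have hne : (2 * k + 4 + 2 * l : ℂ) ≠ 0 :=
      fun h => hl (2 * k + 3) (by push_cast; linear_combination h)
    have h4 : (2 * k + 4 : ℂ) ≠ 0 := by exact_mod_cast (by omega : 2 * k + 4 ≠ 0)
    have hbk : b (k + 2) * ((2 * k + 4) * (2 * k + 4 + 2 * l)) =
        A * (2 * k + 2 + s) * b (k + 1)
      + (2 * k * (2 * k + 2 * l) + B * (2 * k + s)) * b k := by
      rw [hb, bseq, div_mul_cancel₀ _ (mul_ne_zero h4 hne)]
    simp only [d, e]
    push_cast
    linear_combination x ^ (k + 2) * hbk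
  have sd2 := (summable_nat_add_iff 2).2 sd
  have se1 := (summable_nat_add_iff 1).2 se
  have t1 : ∑' k, d k = d 0 + d 1 + ∑' k, d (k + 2) := by
    rw [← sd.sum_add_tsum_nat_add 2]; simp [Finset.sum_range_succ]
  have t2 : ∑' k, e k = e 0 + ∑' k, e (k + 1) := se.tsum_eq_zero_add
  have t3 : ∑' k, d (k + 2) = A * x * ∑' k, e (k + 1) + x ^ 2 * ∑' k, d k
      + B * x ^ 2 * ∑' k, e k := by
    rw [tsum_congr hrec, Summable.tsum_add ((se1.mul_left _).add (sd.mul_left _)) (se.mul_left _),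
      Summable.tsum_add (se1.mul_left _) (sd.mul_left _), tsum_mul_left, tsum_mul_left,
      tsum_mul_left]
  linear_combination t1 + t3 + hd0 + hd1 - A * x * t2

lemma exists_lower (l₀ : ℂ) (h : ∀ n : ℕ, 2 * l₀ ≠ -((n : ℂ) + 1)) :
    ∃ c > 0, ∀ n : ℕ, c * ((n : ℝ) + 1) ≤ ‖(n : ℂ) + 1 + 2 * l₀‖ := by
  have ht : Tendsto (fun n : ℕ => ((n + 1 : ℕ) : ℂ) / ((n + 1 : ℕ) + 2 * l₀)) atTop (𝓝 1) :=
    (tendsto_natCast_div_add_atTop (2 * l₀)).comp (tendsto_add_atTop_nat 1)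
  obtain ⟨K, hK⟩ := (Metric.isBounded_range_of_tendsto _ ht).exists_norm_le
  have hK' : ∀ n : ℕ, ((n : ℝ) + 1) ≤ (|K| + 1) * ‖(n : ℂ) + 1 + 2 * l₀‖ := by
    intro n
    have hne : (n : ℂ) + 1 + 2 * l₀ ≠ 0 := fun h0 => h n (by linear_combination h0)
    have h1 := hK _ (mem_range_self n)
    push_cast at h1
    have hn : ‖(n : ℂ) + 1‖ = n + 1 := by
      have : (n : ℂ) + 1 = ((n + 1 : ℕ) : ℂ) := by push_cast; ring
      rw [this, Complex.norm_natCast]; push_cast; ring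
    rw [norm_div, hn, div_le_iff₀ (norm_pos_iff.2 hne)] at h1
    refine h1.trans ?_
    gcongr
    linarith [le_abs_self K]
  refine ⟨1 / (|K| + 1), by positivity, fun n => ?_⟩
  rw [one_div, inv_mul_le_iff₀ (by positivity)]
  exact hK' n

theorem holomorphic_dependence_of_Q (m₁ m₂ : ℕ) (hm₁ : 1 ≤ m₁) (lam₀ : ℂ)
    (hlam₀ : ∀ n : ℕ, 2 * lam₀ ≠ -((n : ℂ) + 1)) :
    ∃ U : Set ℂ, IsOpen U ∧ lam₀ ∈ U ∧
      (∀ lam ∈ U, ∀ n : ℕ, 2 * lam ≠ -((n : ℂ) + 1)) ∧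
      ∃ ε ∈ Set.Ioo (0 : ℝ) 1, ∃ H : ℂ × ℂ → ℂ,
        (∀ p ∈ U ×ˢ Metric.ball (0 : ℂ) ε, AnalyticAt ℂ H p) ∧
        (∀ lam ∈ U, H (lam, 0) = 1) ∧
        ∀ lam ∈ U, ∀ y ∈ Set.Ioo (0 : ℝ) ε,
          RadialODE m₁ m₂ lam
            (fun z : ℝ => (z : ℂ) ^ ((rho m₁ m₂ : ℂ) + lam) * H (lam, (z : ℂ))) y := by
  obtain ⟨c, hc, hlow⟩ := exists_lower lam₀ hlam₀
  set U : Set ℂ := Metric.ball lam₀ (c / 4) with hUdef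
  have hdist : ∀ l ∈ U, ‖l - lam₀‖ < c / 4 := fun l hl => by
    rwa [hUdef, Metric.mem_ball, dist_eq_norm] at hl
  have hden : ∀ l ∈ U, ∀ n : ℕ, c / 2 * ((n : ℝ) + 1) ≤ ‖(n : ℂ) + 1 + 2 * l‖ := by
    intro l hl n
    have h1 := hlow n
    have h2 : ‖(n : ℂ) + 1 + 2 * lam₀‖ ≤ ‖(n : ℂ) + 1 + 2 * l‖ + ‖2 * (l - lam₀)‖ := by
      have : (n : ℂ) + 1 + 2 * lam₀ = (n : ℂ) + 1 + 2 * l - 2 * (l - lam₀) := by ring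
      rw [this]; exact norm_sub_le _ _
    rw [norm_mul, Complex.norm_ofNat] at h2
    have h3 := hdist l hl
    have hn : (0 : ℝ) ≤ n := Nat.cast_nonneg n
    nlinarith
  have hUne : ∀ l ∈ U, ∀ n : ℕ, 2 * l ≠ -((n : ℂ) + 1) := by
    intro l hl n h0
    have h1 := hden l hl n
    rw [h0, add_neg_cancel, norm_zero] at h1
    have : 0 < c / 2 * ((n : ℝ) + 1) := by positivity
    linarith
  set A : ℝ := 2 * m₁ with hA
  set B : ℝ := 2 * m₁ + 4 * m₂ with hB
  have hA0 : 0 ≤ A := by positivity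
  have hB0 : 0 ≤ B := by positivity
  set R : ℝ := ‖lam₀‖ + c / 4 with hR
  have hlR : ∀ l ∈ U, ‖l‖ ≤ R := by
    intro l hl
    have := norm_le_norm_add_norm_sub' l lam₀
    linarith [hdist l hl]
  set S : ℝ := ‖(rho m₁ m₂ : ℂ)‖ + R with hS
  set M : ℝ := 1 + A * (1 + S) / (c / 2) + ((1 + 2 * R) + B * (1 + S)) / (c / 2) with hM
  have hR0 : 0 ≤ R := by positivity
  have hS0 : 0 ≤ S := by positivity
  have hM1 : 1 ≤ M := by
    have : 0 ≤ A * (1 + S) / (c / 2) := by positivity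
    have : 0 ≤ ((1 + 2 * R) + B * (1 + S)) / (c / 2) := by positivity
    linarith
  let b : ℕ → ℂ → ℂ := fun k l => bseq A B (rho m₁ m₂ + l) l k
  have hbd : ∀ k, ∀ l ∈ U, ‖b k l‖ ≤ M ^ k := by
    intro k l hl
    refine bseq_bound hA0 hB0 (by positivity) ?_ ?_ (hden l hl) k
    · exact (norm_add_le _ _).trans (by linarith [hlR l hl])
    · rw [norm_mul, Complex.norm_ofNat]; linarith [hlR l hl]
  set ε : ℝ := 1 / (8 * M) with hε
  have hM0 : 0 < M := by linarith
  have hε0 : 0 < ε := by positivity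
  have hε1 : ε < 1 := by rw [hε, div_lt_one (by positivity)]; linarith
  have hεM : ε * M = 1 / 8 := by rw [hε]; field_simp
  refine ⟨U, Metric.isOpen_ball, Metric.mem_ball_self (by positivity), hUne, ε, ⟨hε0, hε1⟩,
    fun p : ℂ × ℂ => ∑' k, b k p.1 * p.2 ^ (2 * k),
    joint_analytic Metric.isOpen_ball b (bseq_diff A B _ hUne) hM1 hbd hε, ?_, ?_⟩
  · intro l hl
    simp only
    rw [tsum_eq_single 0]
    · simp [b, bseq]
    · intro k hk; simp [hk]
  · intro l hl y hy
    have g0 : ∀ k, ‖b k l‖ ≤ 1 * M ^ k := fun k => by simpa using hbd k l hl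
    have step : ∀ (a : ℕ → ℂ) (C N : ℝ), 0 ≤ C → 0 ≤ N → (∀ k, ‖a k‖ ≤ C * N ^ k) →
        ∀ k : ℕ, ‖2 * (k : ℂ) * a k‖ ≤ (2 * C) * (2 * N) ^ k := by
      intro a C N hC hN ha k
      rw [norm_mul, norm_mul, Complex.norm_ofNat, Complex.norm_natCast, mul_pow]
      calc 2 * (k : ℝ) * ‖a k‖ ≤ 2 * 2 ^ k * (C * N ^ k) := by
            gcongr
            · exact nat_le_two_pow_real k
            · exact ha k
        _ = _ := by ring
    have g1 := step _ _ _ (by norm_num) hM0.le g0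
    have g2 := step _ _ _ (by norm_num) (by positivity) g1
    have ny : ∀ z ∈ Ioo 0 ε, ‖(z : ℂ)‖ < ε := fun z hz => by
      rw [Complex.norm_real, Real.norm_eq_abs, abs_of_pos hz.1]; exact hz.2
    have r0 := fun z hz => theta_series _ (ε := ε) hM1 g0 (by nlinarith) (ny z hz)
    have r1 := theta_series _ (ε := ε) (by linarith) g1 (by nlinarith) (ny y hy)
    have r2 := theta_series _ (ε := ε) (by linarith) g2 (by nlinarith) (ny y hy)
    refine ode_of_theta m₁ m₂ l (fun z => ∑' k, b k l * z ^ (2 * k))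
      (fun z => ∑' k : ℕ, (2 * k * b k l) * z ^ (2 * k)) _ hy hε1.le (fun z hz => (r0 z hz).2.1)
      (fun z hz => (r0 z hz).2.2) r1.2.1 r1.2.2 ?_
    have s0 := (r0 y hy).1
    have s1 := r1.1
    have s2 := r2.1
    simp only [pow_mul] at s0 s1 s2 ⊢
    have := bseq_ode A B (rho m₁ m₂ + l) l (hUne l hl) ((y : ℂ) ^ 2) s0 s1 s2
    rw [← pow_mul] at this
    simp only [b]
    convert this using 2
    simp only [hA, hB]
    push_cast
    ring

end
end

section
/- Let m₁ ≥ 1 and m₂ ≥ 0 be integers, ρ = m₁/2 + m₂, and let λ ∈ ℂ with 2λ ∉ ℤ. Suppose: (i) φ : ℝ → ℂ is continuous on [0,∞), twice differentiable on (0,∞), φ(0) = 1, and satisfies φ''(t) + (m₁·coth(t) + 2m₂·coth(2t))·φ'(t) + (ρ² − λ²)·φ(t) = 0 for all t > 0; (ii) Q₊, Q₋ : (0,∞) → ℂ are twice differentiable and satisfy the same ODE on (0,∞), and there exist ε ∈ (0,1) and functions h₊, h₋ real-analytic on (−ε,ε) with h₊(0) = h₋(0) = 1 such that Q₊(t) =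 exp(−(ρ+λ)t)·h₊(e^{−t}) and Q₋(t) = exp(−(ρ−λ)t)·h₋(e^{−t}) whenever e^{−t} < ε. Then φ(t) = c(−λ)·Q₊(t) + c(λ)·Q₋(t) for all t > 0, where c(μ) = g(μ)/g(ρ) and g(μ) = Γ(μ)·2^{−μ} / (Γ((m₁/2 + 1 + μ)/2)·Γ((m₁/2 + m₂ + μ)/2)). -/
open Set Filter Topology

noncomputable section

/-- The hyperbolic cotangent. -/
def cothR (t : ℝ) : ℝ := Real.cosh t / Real.sinh t

/-- The radial eigenvalue equation in the variable `t`: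
`q'' + (m₁ coth t + 2m₂ coth 2t) q' + (ρ² − λ²) q = 0`. -/
def RadialODEt (m₁ m₂ : ℕ) (lam : ℂ) (q : ℝ → ℂ) (t : ℝ) : Prop :=
  deriv (deriv q) t + ((m₁ * cothR t + 2 * m₂ * cothR (2 * t) : ℝ) : ℂ) * deriv q t
    + ((rho m₁ m₂ : ℂ) ^ 2 - lam ^ 2) * q t = 0

/-- `g(μ) = Γ(μ)2^{−μ}/(Γ((m₁/2+1+μ)/2)Γ((m₁/2+m₂+μ)/2))`. -/
def gfun (m₁ m₂ : ℕ) (μ : ℂ) : ℂ :=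
  Complex.Gamma μ * (2 : ℂ) ^ (-μ) /
    (Complex.Gamma (((m₁ : ℂ) / 2 + 1 + μ) / 2) *
      Complex.Gamma (((m₁ : ℂ) / 2 + (m₂ : ℂ) + μ) / 2))

/-- The Harish-Chandra c-function, normalized so that `c(ρ) = 1`. -/
def cfun (m₁ m₂ : ℕ) (μ : ℂ) : ℂ := gfun m₁ m₂ μ / gfun m₁ m₂ ((rho m₁ m₂ : ℂ))


/-- the density `Δ(t) = sinh(t)^{m₁} sinh(2t)^{m₂}`. -/
def Dl (m₁ m₂ : ℕ) (t : ℝ) : ℝ := Real.sinh t ^ m₁ * Real.sinh (2 * t) ^ m₂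

lemma Dl_pos (m₁ m₂ : ℕ) {t : ℝ} (ht : 0 < t) : 0 < Dl m₁ m₂ t := by
  have h1 : 0 < Real.sinh t := Real.sinh_pos_iff.2 ht
  have h2 : 0 < Real.sinh (2 * t) := Real.sinh_pos_iff.2 (by linarith)
  unfold Dl; positivity

lemma hasDerivAt_Dl (m₁ m₂ : ℕ) {t : ℝ} (ht : 0 < t) :
    HasDerivAt (Dl m₁ m₂) ((m₁ * cothR t + 2 * m₂ * cothR (2 * t)) * Dl m₁ m₂ t) t := by
  have h1 : 0 < Real.sinh t := Real.sinh_pos_iff.2 ht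
  have h2 : 0 < Real.sinh (2 * t) := Real.sinh_pos_iff.2 (by linarith)
  have e2 : HasDerivAt (fun t : ℝ => Real.sinh (2 * t)) (Real.cosh (2 * t) * 2) t := by
    simpa using ((hasDerivAt_id t).const_mul 2).sinh
  have := ((Real.hasDerivAt_sinh t).pow m₁).mul (e2.pow m₂)
  refine this.congr_deriv ?_
  have pw : ∀ (m : ℕ) (x y : ℝ), x ≠ 0 → (m : ℝ) * x ^ (m - 1) * y = m * (y / x) * x ^ m := by
    intro m x y hx
    cases m with
    | zero => simp
    | succ n => simp only [Nat.add_sub_cancel, pow_succ]; field_simp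
  simp only [Pi.pow_apply]
  rw [pw _ _ _ h1.ne', pw _ _ _ h2.ne']
  unfold cothR Dl
  ring

/-- `q` is a solution of the radial equation on `(0,∞)`. -/
def IsSol (m₁ m₂ : ℕ) (lam : ℂ) (q : ℝ → ℂ) : Prop :=
  ∀ t : ℝ, 0 < t → DifferentiableAt ℝ q t ∧ DifferentiableAt ℝ (deriv q) t ∧
    RadialODEt m₁ m₂ lam q t

lemma IsSol.neg_lam {m₁ m₂ : ℕ} {lam : ℂ} {q : ℝ → ℂ} (h : IsSol m₁ m₂ lam q) :
    IsSol m₁ m₂ (-lam) q := by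
  intro t ht
  obtain ⟨a, b, c⟩ := h t ht
  refine ⟨a, b, ?_⟩
  unfold RadialODEt at *
  rwa [neg_sq]

/-- weighted Wronskian -/
def Wr (m₁ m₂ : ℕ) (p q : ℝ → ℂ) (t : ℝ) : ℂ :=
  (Dl m₁ m₂ t : ℂ) * (p t * deriv q t - deriv p t * q t)

lemma hasDerivAt_Dl_deriv {m₁ m₂ : ℕ} {lam : ℂ} {q : ℝ → ℂ} (h : IsSol m₁ m₂ lam q)
    {t : ℝ} (ht : 0 < t) :
    HasDerivAt (fun t => (Dl m₁ m₂ t : ℂ) * deriv q t)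
      (-((rho m₁ m₂ : ℂ) ^ 2 - lam ^ 2) * (Dl m₁ m₂ t * q t)) t := by
  obtain ⟨a, b, c⟩ := h t ht
  have h1 := (hasDerivAt_Dl m₁ m₂ ht).ofReal_comp
  have h2 := b.hasDerivAt
  refine (h1.mul h2).congr_deriv ?_
  unfold RadialODEt at c
  rw [Complex.ofReal_mul]
  linear_combination (Dl m₁ m₂ t : ℂ) * c

lemma const_of_deriv {f : ℝ → ℂ} (h : ∀ t : ℝ, 0 < t → HasDerivAt f 0 t) :
    ∃ K, ∀ t : ℝ, 0 < t → f t = K := by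
  obtain ⟨K, hK⟩ := isOpen_Ioi.exists_is_const_of_deriv_eq_zero (𝕜 := ℝ) (s := Ioi (0 : ℝ)) (f := f)
    isPreconnected_Ioi (fun t ht => (h t ht).differentiableAt.differentiableWithinAt)
    (fun t ht => (h t ht).deriv)
  exact ⟨K, hK⟩

lemma Wr_const {m₁ m₂ : ℕ} {lam : ℂ} {p q : ℝ → ℂ} (hp : IsSol m₁ m₂ lam p)
    (hq : IsSol m₁ m₂ lam q) : ∃ K, ∀ t : ℝ, 0 < t → Wr m₁ m₂ p q t = K := by
  apply const_of_deriv
  intro t ht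
  have h1 := hasDerivAt_Dl_deriv hp ht
  have h2 := hasDerivAt_Dl_deriv hq ht
  have h3 := ((hp t ht).1.hasDerivAt.mul h2).sub (h1.mul (hq t ht).1.hasDerivAt)
  refine (h3.congr_deriv ?_).congr_of_eventuallyEq (Eventually.of_forall fun s => ?_)
  · ring
  · simp only [Wr, Pi.sub_apply, Pi.mul_apply]; ring

/-- asymptotic type -/
def Asym (m₁ m₂ : ℕ) (lam : ℂ) (q : ℝ → ℂ) : Prop :=
  ∃ h : ℝ → ℂ, AnalyticAt ℝ h 0 ∧ h 0 = 1 ∧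
    ∀ᶠ t : ℝ in atTop, q t = Complex.exp (-((rho m₁ m₂ : ℂ) + lam) * t) * h (Real.exp (-t))

lemma tendsto_y : Tendsto (fun t : ℝ => Real.exp (-t)) atTop (𝓝 0) :=
  Real.tendsto_exp_neg_atTop_nhds_zero

lemma Asym.deriv {m₁ m₂ : ℕ} {lam : ℂ} {q : ℝ → ℂ} (hq : Asym m₁ m₂ lam q) :
    ∃ h k : ℝ → ℂ, AnalyticAt ℝ h 0 ∧ AnalyticAt ℝ k 0 ∧ h 0 = 1 ∧ k 0 = -((rho m₁ m₂ : ℂ) + lam) ∧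
    ∀ᶠ t : ℝ in atTop, q t = Complex.exp (-((rho m₁ m₂ : ℂ) + lam) * t) * h (Real.exp (-t)) ∧
      deriv q t = Complex.exp (-((rho m₁ m₂ : ℂ) + lam) * t) * k (Real.exp (-t)) := by
  obtain ⟨h, ha, h0, hq⟩ := hq
  refine ⟨h, fun y => -((rho m₁ m₂ : ℂ) + lam) * h y - y * _root_.deriv h y, ha, ?_, h0, ?_, ?_⟩
  · exact (analyticAt_const.mul ha).sub ((Complex.ofRealCLM.analyticAt 0).mul ha.deriv)
  · simp [h0]
  · have hq' : ∀ᶠ t : ℝ in atTop, ∀ᶠ s : ℝ in 𝓝 t,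
        q s = Complex.exp (-((rho m₁ m₂ : ℂ) + lam) * s) * h (Real.exp (-s)) := by
      obtain ⟨T, hT⟩ := eventually_atTop.1 hq
      filter_upwards [eventually_gt_atTop T] with t ht
      filter_upwards [Ioi_mem_nhds ht] with s hs using hT s (le_of_lt hs)
    filter_upwards [hq', tendsto_y.eventually ha.eventually_analyticAt] with t ht hat
    refine ⟨ht.self_of_nhds, ?_⟩
    rw [EventuallyEq.deriv_eq ht]
    have e1 : HasDerivAt (fun s : ℝ => Real.exp (-s)) (Real.exp (-t) * (-1)) t :=
      ((hasDerivAt_id t).neg).exp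
    have e2 := hat.differentiableAt.hasDerivAt.scomp t e1
    have e3 : HasDerivAt (fun s : ℝ => Complex.exp (-((rho m₁ m₂ : ℂ) + lam) * s))
        (Complex.exp (-((rho m₁ m₂ : ℂ) + lam) * t) * (-((rho m₁ m₂ : ℂ) + lam) * 1)) t :=
      ((Complex.ofRealCLM.hasDerivAt (x := t)).const_mul _).cexp
    have e4 := (e3.mul e2).deriv
    refine e4.trans ?_
    simp only [Function.comp_apply, Complex.real_smul]
    push_cast
    ring

lemma Dl_eq_exp (m₁ m₂ : ℕ) (t : ℝ) : (Dl m₁ m₂ t : ℂ) =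
    Complex.exp (2 * (rho m₁ m₂ : ℂ) * t) * ((1 / 2 : ℂ) ^ (m₁ + m₂) *
      (1 - (Real.exp (-t) : ℂ) ^ 2) ^ m₁ * (1 - (Real.exp (-t) : ℂ) ^ 4) ^ m₂) := by
  have h1 : (Real.sinh t : ℂ) = Complex.exp t * ((1 / 2) * (1 - (Real.exp (-t) : ℂ) ^ 2)) := by
    rw [Real.sinh_eq]
    push_cast
    rw [← Complex.exp_nat_mul, Complex.exp_neg]
    have : Complex.exp t * Complex.exp ((2 : ℕ) * (-t)) = (Complex.exp t)⁻¹ := by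
      rw [← Complex.exp_add, ← Complex.exp_neg]; congr 1; push_cast; ring
    linear_combination (1 / 2) * this
  have h2 : (Real.sinh (2 * t) : ℂ)
      = Complex.exp (2 * t) * ((1 / 2) * (1 - (Real.exp (-t) : ℂ) ^ 4)) := by
    rw [Real.sinh_eq]
    push_cast
    rw [← Complex.exp_nat_mul]
    have : Complex.exp (2 * t) * Complex.exp ((4 : ℕ) * (-t)) = Complex.exp (-(2 * t)) := by
      rw [← Complex.exp_add]; congr 1; push_cast; ring
    linear_combination (1 / 2) * this
  have h3 : Complex.exp (2 * (rho m₁ m₂ : ℂ) * t) =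
      Complex.exp t ^ m₁ * Complex.exp (2 * t) ^ m₂ := by
    rw [← Complex.exp_nat_mul, ← Complex.exp_nat_mul, ← Complex.exp_add]
    congr 1
    simp only [rho]; push_cast; ring
  rw [h3]
  simp only [Dl]
  rw [Complex.ofReal_mul, Complex.ofReal_pow, Complex.ofReal_pow, h1, h2]
  simp only [mul_pow, pow_add]
  ring

lemma Wr_asym {m₁ m₂ : ℕ} {l₁ l₂ : ℂ} {p q : ℝ → ℂ} (hp : Asym m₁ m₂ l₁ p)
    (hq : Asym m₁ m₂ l₂ q) : ∃ H : ℝ → ℂ, AnalyticAt ℝ H 0 ∧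
      H 0 = (1 / 2 : ℂ) ^ (m₁ + m₂) * (l₁ - l₂) ∧
      ∀ᶠ t : ℝ in atTop, Wr m₁ m₂ p q t = Complex.exp (-(l₁ + l₂) * t) * H (Real.exp (-t)) := by
  obtain ⟨h, k, ha, ka, h0, k0, hhk⟩ := hp.deriv
  obtain ⟨h', k', ha', ka', h0', k0', hhk'⟩ := hq.deriv
  have ido : AnalyticAt ℝ (fun y : ℝ => (y : ℂ)) 0 := Complex.ofRealCLM.analyticAt 0
  refine ⟨fun y => ((1 / 2 : ℂ) ^ (m₁ + m₂) *
      (1 - (y : ℂ) ^ 2) ^ m₁ * (1 - (y : ℂ) ^ 4) ^ m₂) * (h y * k' y - k y * h' y), ?_, ?_, ?_⟩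
  · exact (((analyticAt_const.mul ((analyticAt_const.sub (ido.pow 2)).pow m₁)).mul
      ((analyticAt_const.sub (ido.pow 4)).pow m₂))).mul ((ha.mul ka').sub (ka.mul ha'))
  · simp [h0, k0, h0', k0']; ring
  · filter_upwards [hhk, hhk'] with t ht ht'
    rw [Wr, Dl_eq_exp, ht.1, ht.2, ht'.1, ht'.2]
    have : Complex.exp (-(l₁ + l₂) * t) = Complex.exp (2 * (rho m₁ m₂ : ℂ) * t) *
      Complex.exp (-((rho m₁ m₂ : ℂ) + l₁) * t) * Complex.exp (-((rho m₁ m₂ : ℂ) + l₂) * t) := by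
      rw [← Complex.exp_add, ← Complex.exp_add]; congr 1; ring
    rw [this]; ring

lemma Wr_opp {m₁ m₂ : ℕ} {lam : ℂ} {p q : ℝ → ℂ} (hp : IsSol m₁ m₂ lam p)
    (hq : IsSol m₁ m₂ lam q) (ap : Asym m₁ m₂ lam p) (aq : Asym m₁ m₂ (-lam) q)
    {t : ℝ} (ht : 0 < t) : Wr m₁ m₂ p q t = (1 / 2 : ℂ) ^ (m₁ + m₂) * (2 * lam) := by
  obtain ⟨K, hK⟩ := Wr_const hp hq
  obtain ⟨H, Ha, H0, hH⟩ := Wr_asym ap aq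
  have l1 : Tendsto (fun t : ℝ => H (Real.exp (-t))) atTop (𝓝 (H 0)) :=
    Ha.continuousAt.tendsto.comp tendsto_y
  have l2 : Tendsto (fun t : ℝ => H (Real.exp (-t))) atTop (𝓝 K) := by
    refine tendsto_const_nhds.congr' ?_
    filter_upwards [hH, eventually_gt_atTop 0] with s hs hs0
    rw [← hK s hs0, hs]; simp
  rw [hK t ht, tendsto_nhds_unique l2 l1, H0]; ring

lemma analytic_power_zero {H : ℝ → ℂ} (Ha : AnalyticAt ℝ H 0) {w K : ℂ}
    (hw : ∀ n : ℕ, w ≠ n)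
    (hH : ∀ᶠ t : ℝ in atTop, H (Real.exp (-t)) = K * Complex.exp (-w * t)) : K = 0 := by
  by_contra hK
  have hnz : ¬ ∀ᶠ z in 𝓝 (0 : ℝ), H z = 0 := by
    intro hz
    obtain ⟨t, ht, ht'⟩ := (hH.and (tendsto_y.eventually hz)).exists
    rw [ht] at ht'
    simp [hK] at ht'
  obtain ⟨n, g, ga, g0, hg⟩ := Ha.exists_eventuallyEq_pow_smul_nonzero_iff.2 hnz
  have hg2 : ∀ᶠ t : ℝ in atTop, ∀ᶠ s : ℝ in 𝓝 t,
      Complex.exp (-(n : ℂ) * s) * g (Real.exp (-s)) = K * Complex.exp (-w * s) := by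
    obtain ⟨T, hT⟩ := eventually_atTop.1 (hH.and (tendsto_y.eventually hg))
    filter_upwards [eventually_gt_atTop T] with t ht
    filter_upwards [Ioi_mem_nhds ht] with s hs
    obtain ⟨a, b⟩ := hT s (le_of_lt hs)
    rw [← a, b, sub_zero, Complex.real_smul]
    push_cast
    rw [← Complex.exp_nat_mul]; congr 2; ring
  -- differentiate
  have hd : ∀ᶠ t : ℝ in atTop, (w - n) * g (Real.exp (-t)) - Real.exp (-t) *
      deriv g (Real.exp (-t)) = 0 := by
    filter_upwards [hg2, tendsto_y.eventually ga.eventually_analyticAt] with t ht hat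
    have e1 : HasDerivAt (fun s : ℝ => Real.exp (-s)) (Real.exp (-t) * (-1)) t :=
      ((hasDerivAt_id t).neg).exp
    have e2 := hat.differentiableAt.hasDerivAt.scomp t e1
    have e3 : ∀ v : ℂ, HasDerivAt (fun s : ℝ => Complex.exp (-v * s))
        (Complex.exp (-v * t) * (-v * 1)) t := fun v =>
      ((Complex.ofRealCLM.hasDerivAt (x := t)).const_mul _).cexp
    have e4 := ((e3 n).mul e2).congr_of_eventuallyEq (EventuallyEq.symm ht)
    have e5 := e4.unique ((e3 w).const_mul K)
    have e6 := ht.self_of_nhds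
    simp only [Function.comp_apply, Complex.real_smul] at e5 e6
    push_cast at e5 e6 ⊢
    have : Complex.exp (-(n : ℂ) * t) ≠ 0 := Complex.exp_ne_zero _
    apply mul_left_cancel₀ this
    linear_combination e5 + w * e6
  have l1 : Tendsto (fun t : ℝ => (w - n) * g (Real.exp (-t)) - Real.exp (-t) *
      deriv g (Real.exp (-t))) atTop (𝓝 ((w - n) * g 0 - ((0 : ℝ) : ℂ) * deriv g 0)) :=
    (tendsto_const_nhds.mul (ga.continuousAt.tendsto.comp tendsto_y)).sub
      (((Complex.continuous_ofReal.tendsto 0).comp tendsto_y).mul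
        (ga.deriv.continuousAt.tendsto.comp tendsto_y))
  have l2 := tendsto_nhds_unique (tendsto_const_nhds.congr' (hd.mono fun t h => h.symm)) l1
  simp [g0, sub_eq_zero] at l2
  exact hw n l2

lemma Wr_same {m₁ m₂ : ℕ} {lam : ℂ} (hlam : ∀ n : ℤ, 2 * lam ≠ (n : ℂ))
    {p q : ℝ → ℂ} (hp : IsSol m₁ m₂ lam p)
    (hq : IsSol m₁ m₂ lam q) (ap : Asym m₁ m₂ lam p) (aq : Asym m₁ m₂ lam q)
    {t : ℝ} (ht : 0 < t) : Wr m₁ m₂ p q t = 0 := by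
  obtain ⟨K, hK⟩ := Wr_const hp hq
  obtain ⟨H, Ha, H0, hH⟩ := Wr_asym ap aq
  rw [hK t ht]
  apply analytic_power_zero Ha (w := -(2 * lam))
  · intro n hn
    apply hlam (-n); push_cast; rw [← hn]; ring
  · filter_upwards [hH, eventually_gt_atTop 0] with s hs hs0
    rw [← hK s hs0, hs, mul_right_comm, ← Complex.exp_add]
    rw [show -(lam + lam) * (s : ℂ) + -(-(2 * lam)) * s = 0 by ring]; simp

lemma Wr_identity (m₁ m₂ : ℕ) (f p q : ℝ → ℂ) (t : ℝ) :
    f t * Wr m₁ m₂ p q t = p t * Wr m₁ m₂ f q t - q t * Wr m₁ m₂ f p t := by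
  simp only [Wr]; ring

lemma sol_unique {m₁ m₂ : ℕ} {lam : ℂ} (hlam : ∀ n : ℤ, 2 * lam ≠ (n : ℂ))
    {p q e : ℝ → ℂ} (hp : IsSol m₁ m₂ lam p)
    (hq : IsSol m₁ m₂ lam q) (he : IsSol m₁ m₂ lam e)
    (ap : Asym m₁ m₂ lam p) (aq : Asym m₁ m₂ lam q) (ae : Asym m₁ m₂ (-lam) e)
    {t : ℝ} (ht : 0 < t) : p t = q t := by
  have h := Wr_identity m₁ m₂ p q e t
  rw [Wr_opp hq he aq ae ht, Wr_opp hp he ap ae ht, Wr_same hlam hp hq ap aq ht] at h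
  have hl : lam ≠ 0 := by rintro rfl; exact hlam 0 (by simp)
  have h2 : (1 / 2 : ℂ) ^ (m₁ + m₂) * (2 * lam) ≠ 0 := by
    refine mul_ne_zero (pow_ne_zero _ (by norm_num)) (mul_ne_zero two_ne_zero hl)
  apply mul_right_cancel₀ h2
  rw [h]; ring


lemma hasSum_of_eq {R : Type*} [AddCommMonoid R] [TopologicalSpace R] {f g : ℕ → R} {s : R}
    (h : HasSum f s) (e : ∀ n, g n = f n) : HasSum g s := by
  rwa [show g = f from funext e]

lemma abel_lemma {v : ℕ → ℝ} (hv : ∀ n, 0 < v n) {g : ℕ → ℂ} {C : ℂ} {V : ℝ → ℝ}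
    (hV : ∀ x : ℝ, 0 ≤ x → x < 1 → HasSum (fun n => v n * x ^ n) (V x))
    (hVt : Tendsto V (𝓝[<] 1) atTop)
    (hg : Tendsto (fun n => g n / (v n : ℂ)) atTop (𝓝 C))
    {G : ℝ → ℂ} (hG : ∀ x : ℝ, 0 ≤ x → x < 1 → HasSum (fun n => g n * (x : ℂ) ^ n) (G x)) :
    Tendsto (fun x => G x / (V x : ℂ)) (𝓝[<] 1) (𝓝 C) := by
  rw [Metric.tendsto_nhds]
  intro ε hε
  obtain ⟨N, hN⟩ := eventually_atTop.1 (Metric.tendsto_nhds.1 hg (ε / 2) (by positivity))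
  set M : ℝ := ∑ n ∈ Finset.range N, ‖g n - C * v n‖ with hM
  have hM0 : 0 ≤ M := Finset.sum_nonneg fun _ _ => norm_nonneg _
  have hbig := hVt.eventually_gt_atTop (2 * M / ε)
  have hpos := hVt.eventually_gt_atTop 0
  have hx0 : ∀ᶠ x : ℝ in 𝓝[<] 1, 0 ≤ x :=
    nhdsWithin_le_nhds (Filter.Eventually.mono (Ioi_mem_nhds (show (0 : ℝ) < 1 by norm_num))
      fun x hx => le_of_lt hx)
  filter_upwards [hbig, hpos, hx0, self_mem_nhdsWithin] with x hb hp h0 h1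
  have h1 : x < 1 := h1
  have hVc : HasSum (fun n => ((v n : ℂ)) * (x : ℂ) ^ n) (V x : ℂ) := by
    have := Complex.hasSum_ofReal (f := fun n => v n * x ^ n) |>.2 (hV x h0 h1)
    simpa using this
  have hd := (hG x h0 h1).sub (hVc.mul_left C)
  have hfin : HasSum (fun n => if n ∈ Finset.range N then ‖g n - C * v n‖ else 0) M := by
    have := hasSum_sum_of_ne_finset_zero (s := Finset.range N)
      (f := fun n => if n ∈ Finset.range N then ‖g n - C * v n‖ else 0)
      (L := SummationFilter.unconditional ℕ) (fun b hb => by simp only [if_neg hb])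
    rwa [Finset.sum_congr rfl (fun n hn => if_pos hn)] at this
  have hbd := ((hV x h0 h1).mul_left (ε / 2)).add hfin
  have hle : ‖G x - C * V x‖ ≤ ε / 2 * V x + M := by
    rw [← hd.tsum_eq, ← hbd.tsum_eq]
    refine tsum_of_norm_bounded hbd.summable.hasSum ?_
    intro n
    have hxn : x ^ n ≤ 1 := pow_le_one₀ h0 h1.le
    have hxn0 : 0 ≤ x ^ n := pow_nonneg h0 n
    have e : g n * (x : ℂ) ^ n - C * (v n * (x : ℂ) ^ n) = (g n - C * v n) * ((x ^ n : ℝ) : ℂ) := by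
      push_cast; ring
    rw [e, norm_mul, Complex.norm_real, Real.norm_of_nonneg hxn0]
    by_cases hn : n ∈ Finset.range N
    · rw [if_pos hn]
      have : 0 ≤ ε / 2 * (v n * x ^ n) := by have := hv n; positivity
      have := mul_le_mul_of_nonneg_left hxn (norm_nonneg (g n - C * v n))
      linarith
    · rw [if_neg hn, add_zero, ← mul_assoc]
      refine mul_le_mul_of_nonneg_right ?_ hxn0
      have h := hN n (by simpa using hn)
      rw [dist_eq_norm] at h
      have hvn : (v n : ℂ) ≠ 0 := by exact_mod_cast (hv n).ne'
      have e2 : g n - C * v n = (g n / v n - C) * v n := by field_simp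
      rw [e2, norm_mul, Complex.norm_real, Real.norm_of_nonneg (hv n).le]
      exact mul_le_mul_of_nonneg_right h.le (hv n).le
  have hVx : (V x : ℂ) ≠ 0 := by exact_mod_cast hp.ne'
  rw [dist_eq_norm, show G x / (V x : ℂ) - C = (G x - C * V x) / V x by field_simp, norm_div,
    Complex.norm_real, Real.norm_of_nonneg hp.le, div_lt_iff₀ hp]
  have : 2 * M < V x * ε := (div_lt_iff₀ hε).1 hb
  nlinarith

/-- absolute convergence in the unit disc -/
def AbsSum (f : ℕ → ℂ) : Prop := ∀ r : ℝ, 0 ≤ r → r < 1 → Summable fun n => ‖f n‖ * r ^ n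

/-- power series -/
def PS (f : ℕ → ℂ) (z : ℂ) : ℂ := ∑' n, f n * z ^ n

lemma AbsSum.hasSum {f : ℕ → ℂ} (hf : AbsSum f) {z : ℂ} (hz : ‖z‖ < 1) :
    HasSum (fun n => f n * z ^ n) (PS f z) := by
  apply Summable.hasSum
  apply Summable.of_norm
  simpa using hf ‖z‖ (norm_nonneg _) hz

lemma AbsSum.aux {f : ℕ → ℂ} (hf : AbsSum f) {r : ℝ} (hr0 : 0 ≤ r) (hr : r < 1) :
    DifferentiableOn ℂ (PS f) (Metric.ball 0 r) ∧
    ∀ z ∈ Metric.ball (0 : ℂ) r, HasSum (fun n => deriv (fun w : ℂ => f n * w ^ n) z)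
      (deriv (PS f) z) := by
  have hb : ∀ (n : ℕ) (w : ℂ), w ∈ Metric.ball (0 : ℂ) r → ‖f n * w ^ n‖ ≤ ‖f n‖ * r ^ n := by
    intro n w hw
    rw [norm_mul, norm_pow]
    have : ‖w‖ ≤ r := by simpa using (Metric.mem_ball.1 hw).le
    gcongr
  have hd : ∀ n : ℕ, DifferentiableOn ℂ (fun w : ℂ => f n * w ^ n) (Metric.ball 0 r) := fun n => by
    fun_prop
  exact ⟨Complex.differentiableOn_tsum_of_summable_norm (hf r hr0 hr) hd Metric.isOpen_ball hb,
    fun z hz => Complex.hasSum_deriv_of_summable_norm (hf r hr0 hr) hd Metric.isOpen_ball hb hz⟩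

lemma AbsSum.hasDerivAt {f : ℕ → ℂ} (hf : AbsSum f) {z : ℂ} (hz : ‖z‖ < 1) :
    ∃ D, HasDerivAt (PS f) D z ∧ HasSum (fun n : ℕ => (n : ℂ) * f n * z ^ n) (z * D) := by
  obtain ⟨r, hr1, hr2⟩ := exists_between hz
  obtain ⟨h1, h2⟩ := hf.aux ((norm_nonneg z).trans hr1.le) hr2
  have hm : z ∈ Metric.ball (0 : ℂ) r := by simpa using hr1
  refine ⟨deriv (PS f) z, (h1.differentiableAt (Metric.isOpen_ball.mem_nhds hm)).hasDerivAt, ?_⟩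
  have := (h2 z hm).mul_left z
  refine hasSum_of_eq this fun n => ?_
  have e : deriv (fun w : ℂ => f n * w ^ n) z = f n * (n * z ^ (n - 1)) := by
    rw [deriv_const_mul _ (by fun_prop)]; simp
  rw [e]
  cases n with
  | zero => simp
  | succ k => simp only [Nat.add_sub_cancel, pow_succ]; ring

lemma AbsSum.analyticAt {f : ℕ → ℂ} (hf : AbsSum f) : AnalyticAt ℂ (PS f) 0 :=
  (hf.aux (r := 1 / 2) (by norm_num) (by norm_num)).1.analyticAt (Metric.ball_mem_nhds _ (by norm_num))

lemma AbsSum.theta {f : ℕ → ℂ} (hf : AbsSum f) (a : ℂ) : AbsSum (fun n => (a + n) * f n) := by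
  intro r h0 h1
  have hz : ‖(r : ℂ)‖ < 1 := by simpa [abs_of_nonneg h0] using h1
  obtain ⟨D, -, hD⟩ := hf.hasDerivAt hz
  have := (hD.add ((hf.hasSum hz).mul_left a)).summable.norm
  refine this.congr fun n => ?_
  rw [show (n : ℂ) * f n * (r : ℂ) ^ n + a * (f n * (r : ℂ) ^ n) = ((a + n) * f n) * (r : ℂ) ^ n by
    ring]
  simp [abs_of_nonneg h0]

/-- the theta-derivative relation -/
lemma AbsSum.theta_deriv {f : ℕ → ℂ} (hf : AbsSum f) (a : ℂ) {z : ℂ} (hz : ‖z‖ < 1) :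
    ∃ D, HasDerivAt (PS f) D z ∧ z * D = PS (fun n => (a + n) * f n) z - a * PS f z := by
  obtain ⟨D, h1, h2⟩ := hf.hasDerivAt hz
  refine ⟨D, h1, ?_⟩
  have h3 := ((hf.theta a).hasSum hz).sub ((hf.hasSum hz).mul_left a)
  refine HasSum.unique h2 ?_
  refine hasSum_of_eq h3 fun n => ?_
  ring

/-- hypergeometric coefficients -/
def hc (a b c : ℂ) (n : ℕ) : ℂ :=
  ∏ j ∈ Finset.range n, ((a + j) * (b + j) / ((c + j) * (1 + j)))

lemma hc_succ (a b c : ℂ) (n : ℕ) :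
    hc a b c (n + 1) = hc a b c n * ((a + n) * (b + n) / ((c + n) * (1 + n))) := by
  rw [hc, Finset.prod_range_succ]; rfl

lemma one_add_nat_ne (n : ℕ) : (1 + n : ℂ) ≠ 0 := by
  rw [add_comm]; exact Nat.cast_add_one_ne_zero n

lemma hc_ne {a b c : ℂ} (ha : ∀ n : ℕ, a + n ≠ 0) (hb : ∀ n : ℕ, b + n ≠ 0)
    (hcc : ∀ n : ℕ, c + n ≠ 0) (n : ℕ) : hc a b c n ≠ 0 :=
  Finset.prod_ne_zero_iff.2 fun j _ => div_ne_zero (mul_ne_zero (ha j) (hb j))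
    (mul_ne_zero (hcc j) (one_add_nat_ne j))

lemma tendsto_ratio (a c : ℂ) : Tendsto (fun n : ℕ => (a + n) / (c + n)) atTop (𝓝 1) := by
  have h : ∀ a : ℂ, Tendsto (fun n : ℕ => a / n + 1) atTop (𝓝 1) := fun a => by
    simpa using (tendsto_const_div_atTop_nhds_zero_nat a).add_const 1
  have := (h a).div (h c) one_ne_zero
  rw [div_one] at this
  refine this.congr' ?_
  filter_upwards [eventually_gt_atTop 0] with n hn
  have : (n : ℂ) ≠ 0 := by exact_mod_cast hn.ne'
  simp only [Pi.div_apply]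
  rw [← mul_div_mul_right _ _ this]
  congr 1 <;> field_simp

lemma hc_absSum {a b c : ℂ} (ha : ∀ n : ℕ, a + n ≠ 0) (hb : ∀ n : ℕ, b + n ≠ 0)
    (hcc : ∀ n : ℕ, c + n ≠ 0) : AbsSum (hc a b c) := by
  intro r h0 h1
  rcases h0.eq_or_lt with rfl | hr
  · refine summable_of_ne_finset_zero (s := {0}) fun n hn => ?_
    have : n ≠ 0 := by simpa using hn
    simp [this]
  · refine summable_of_ratio_test_tendsto_lt_one h1 (Eventually.of_forall fun n => ?_) ?_
    · exact mul_ne_zero (norm_ne_zero_iff.2 (hc_ne ha hb hcc n)) (pow_ne_zero _ hr.ne')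
    · have h2 := (((tendsto_ratio a c).mul (tendsto_ratio b 1)).norm).mul_const r
      simp only [mul_one, norm_one, one_mul] at h2
      refine h2.congr fun n => ?_
      have hn := norm_ne_zero_iff.2 (hc_ne ha hb hcc n)
      have hrn : r ^ n ≠ 0 := pow_ne_zero _ hr.ne'
      rw [hc_succ, pow_succ, Real.norm_of_nonneg (by positivity), Real.norm_of_nonneg (by positivity),
        norm_mul (hc a b c n), div_mul_div_comm]
      field_simp

lemma hc_rel {a b lam : ℂ} (hcc : ∀ n : ℕ, (1 + lam) + n ≠ 0) {z L R : ℂ}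
    (hL : HasSum (fun n : ℕ => (n : ℂ) * (n + lam) * hc a b (1 + lam) n * z ^ n) L)
    (hR : HasSum (fun n : ℕ => (a + n) * (b + n) * hc a b (1 + lam) n * z ^ n) R) :
    L = z * R := by
  have h1 := (hasSum_nat_add_iff' 1).2 hL
  simp only [Finset.sum_range_one, Nat.cast_zero, zero_mul, sub_zero] at h1
  refine h1.unique ?_
  refine hasSum_of_eq (hR.mul_left z) fun n => ?_
  rw [hc_succ, pow_succ]
  have e1 := hcc n
  have e2 := one_add_nat_ne n
  push_cast
  field_simp
  ring

/-- binomial coefficients -/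
def bc (A : ℝ) (n : ℕ) : ℝ := ∏ j ∈ Finset.range n, ((A + j) / (1 + j))

lemma bc_pos {A : ℝ} (hA : 0 < A) (n : ℕ) : 0 < bc A n :=
  Finset.prod_pos fun j _ => by positivity

lemma bc_eq (A : ℝ) (n : ℕ) : Ring.choose (A + n - 1) n = bc A n := by
  have h : Ring.choose (A + n - 1) n = Ring.multichoose A n := by
    rw [Ring.choose]; congr 1; ring
  rw [h]
  have h2 := Ring.factorial_nsmul_multichoose_eq_ascPochhammer A n
  have h3 : (ascPochhammer ℕ n).smeval A = ∏ j ∈ Finset.range n, (A + j) := by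
    rw [Polynomial.ascPochhammer_smeval_eq_eval]
    clear h h2
    induction n with
    | zero => simp
    | succ k ih => rw [ascPochhammer_succ_eval, ih, Finset.prod_range_succ]
  have h4 : ((n.factorial : ℕ) : ℝ) = ∏ j ∈ Finset.range n, (1 + (j : ℝ)) := by
    rw [← Finset.prod_range_add_one_eq_factorial]; push_cast
    exact Finset.prod_congr rfl fun _ _ => add_comm _ _
  rw [h3, nsmul_eq_mul] at h2
  have h5 : ((n.factorial : ℕ) : ℝ) ≠ 0 := by exact_mod_cast n.factorial_ne_zero
  rw [bc, Finset.prod_div_distrib, ← h2, ← h4]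
  field_simp

lemma bc_hasSum (A : ℝ) {x : ℝ} (h0 : 0 ≤ x) (h1 : x < 1) :
    HasSum (fun n => bc A n * x ^ n) (1 / (1 - x) ^ A) := by
  have := (Real.one_div_one_sub_rpow_hasFPowerSeriesOnBall_zero A).hasSum (y := x)
    (by simpa [enorm_eq_nnnorm, ← NNReal.coe_lt_coe, abs_of_nonneg h0] using h1)
  simp only [zero_add] at this
  refine hasSum_of_eq this fun n => ?_
  rw [FormalMultilinearSeries.ofScalars_apply_eq, bc_eq, smul_eq_mul]

lemma bc_tendsto {A : ℝ} (hA : 0 < A) :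
    Tendsto (fun x : ℝ => 1 / (1 - x) ^ A) (𝓝[<] 1) atTop := by
  have h1 : Tendsto (fun x : ℝ => 1 - x) (𝓝[<] 1) (𝓝[>] 0) := by
    refine tendsto_nhdsWithin_iff.2 ⟨?_, ?_⟩
    · have : Tendsto (fun x : ℝ => 1 - x) (𝓝 1) (𝓝 (1 - 1)) := by
        exact (continuous_const.sub continuous_id).tendsto 1
      rw [sub_self] at this
      exact this.mono_left nhdsWithin_le_nhds
    · filter_upwards [self_mem_nhdsWithin] with x hx
      have : x < 1 := hx
      simpa using this
  have h2 := (tendsto_rpow_neg_nhdsGT_zero (y := -A) (by linarith)).comp h1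
  refine h2.congr' ?_
  filter_upwards [self_mem_nhdsWithin] with x hx
  have : x < 1 := hx
  simp only [Function.comp_apply]
  rw [Real.rpow_neg (by linarith), one_div]

lemma coef_tendsto {a b c : ℂ} {A : ℝ} (hA : 0 < A) (habc : a + b + 1 = c + A)
    (ha : ∀ n : ℕ, a + n ≠ 0) (hb : ∀ n : ℕ, b + n ≠ 0)
    (hcc : ∀ n : ℕ, c + n ≠ 0) :
    Tendsto (fun n => ((a + n) * hc a b c n) / (bc A n : ℂ)) atTop
      (𝓝 (Complex.Gamma c * Complex.Gamma A / (Complex.Gamma a * Complex.Gamma b))) := by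
  have hG : ∀ s : ℂ, (∀ n : ℕ, s + n ≠ 0) → Complex.Gamma s ≠ 0 := fun s hs =>
    Complex.Gamma_ne_zero fun m hm => hs m (by rw [hm]; ring)
  have hAn : ∀ n : ℕ, (A : ℂ) + n ≠ 0 := fun n => by
    have : (A + n : ℝ) ≠ 0 := by positivity
    exact_mod_cast this
  have h1 := ((Complex.GammaSeq_tendsto_Gamma c).mul (Complex.GammaSeq_tendsto_Gamma A)).div
    ((Complex.GammaSeq_tendsto_Gamma a).mul (Complex.GammaSeq_tendsto_Gamma b))
    (mul_ne_zero (hG a ha) (hG b hb))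
  have h2 := h1.mul ((tendsto_ratio c b).mul (tendsto_ratio A 0))
  rw [mul_one, mul_one] at h2
  refine h2.congr' ?_
  filter_upwards [eventually_gt_atTop 0] with n hn
  have hn0 : (n : ℂ) ≠ 0 := by exact_mod_cast hn.ne'
  have hpw : (n : ℂ) ^ c * (n : ℂ) ^ (A : ℂ) = (n : ℂ) ^ a * (n : ℂ) ^ b * n := by
    rw [← Complex.cpow_add _ _ hn0, ← habc, Complex.cpow_add _ _ hn0, Complex.cpow_add _ _ hn0,
      Complex.cpow_one]
  have hp0 : ∀ s : ℂ, (n : ℂ) ^ s ≠ 0 := fun s => by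
    rw [Ne, Complex.cpow_eq_zero_iff]; tauto
  have hP : ∀ s : ℂ, (∀ n : ℕ, s + n ≠ 0) → ∏ j ∈ Finset.range n, (s + (j : ℂ)) ≠ 0 := fun s hs =>
    Finset.prod_ne_zero_iff.2 fun j _ => hs j
  have hbc : (bc A n : ℂ) = (∏ j ∈ Finset.range n, ((A : ℂ) + j)) /
      ∏ j ∈ Finset.range n, (1 + (j : ℂ)) := by
    rw [bc, ← Finset.prod_div_distrib]; push_cast; rfl
  have hhc : hc a b c n = (∏ j ∈ Finset.range n, (a + (j : ℂ))) * (∏ j ∈ Finset.range n, (b + (j : ℂ)))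
      / ((∏ j ∈ Finset.range n, (c + (j : ℂ))) * ∏ j ∈ Finset.range n, (1 + (j : ℂ))) := by
    rw [hc, ← Finset.prod_mul_distrib, ← Finset.prod_mul_distrib, ← Finset.prod_div_distrib]
  simp only [Pi.div_apply, Complex.GammaSeq, Finset.prod_range_succ, zero_add]
  rw [hbc, hhc]
  have f0 : (n.factorial : ℂ) ≠ 0 := by exact_mod_cast n.factorial_ne_zero
  have p1 := hP a ha
  have p2 := hP b hb
  have p3 := hP c hcc
  have p4 := hP A hAn
  have p5 : ∏ j ∈ Finset.range n, (1 + (j : ℂ)) ≠ 0 := hP 1 one_add_nat_ne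
  have q1 := ha n
  have q2 := hb n
  have q3 := hcc n
  have q4 := hAn n
  have r1 := hp0 a
  have r2 := hp0 b
  generalize ∏ j ∈ Finset.range n, (a + (j : ℂ)) = Pa at *
  generalize ∏ j ∈ Finset.range n, (b + (j : ℂ)) = Pb at *
  generalize ∏ j ∈ Finset.range n, (c + (j : ℂ)) = Pc at *
  generalize ∏ j ∈ Finset.range n, ((A : ℂ) + (j : ℂ)) = PA at *
  generalize ∏ j ∈ Finset.range n, (1 + (j : ℂ)) = P1 at *
  generalize (n : ℂ) ^ c = nc at *
  generalize (n : ℂ) ^ (A : ℂ) = nA at *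
  generalize (n : ℂ) ^ a = na at *
  generalize (n : ℂ) ^ b = nb at *
  field_simp
  linear_combination hpw


/-- parameters of the hypergeometric solution -/
def pa (m₁ m₂ : ℕ) (lam : ℂ) : ℂ := ((m₁ : ℂ) / 2 + (m₂ : ℂ) + lam) / 2
/-- second parameter -/
def pb (m₁ : ℕ) (lam : ℂ) : ℂ := ((m₁ : ℂ) / 2 + 1 + lam) / 2

/-- `1/cosh²` -/
def xx (t : ℝ) : ℝ := 1 / Real.cosh t ^ 2

lemma xx_pos (t : ℝ) : 0 < xx t := by
  have := Real.cosh_pos t; unfold xx; positivity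

lemma xx_eq (t : ℝ) : xx t = 1 - Real.tanh t ^ 2 := by
  have h := Real.cosh_pos t
  rw [xx, Real.tanh_eq_sinh_div_cosh, div_pow, Real.sinh_sq]; field_simp; ring

lemma tanh_pos' {t : ℝ} (ht : 0 < t) : 0 < Real.tanh t := by
  rw [Real.tanh_eq_sinh_div_cosh]; exact div_pos (Real.sinh_pos_iff.2 ht) (Real.cosh_pos t)

lemma xx_lt_one {t : ℝ} (ht : 0 < t) : xx t < 1 := by
  rw [xx_eq]; have := tanh_pos' ht; nlinarith

lemma norm_xx {t : ℝ} (ht : 0 < t) : ‖(xx t : ℂ)‖ < 1 := by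
  rw [Complex.norm_real, Real.norm_of_nonneg (xx_pos t).le]; exact xx_lt_one ht

lemma hasDerivAt_tanh' (t : ℝ) : HasDerivAt Real.tanh (xx t) t := by
  have h := Real.cosh_pos t
  have := (Real.hasDerivAt_sinh t).div (Real.hasDerivAt_cosh t) h.ne'
  have e : Real.tanh = Real.sinh / Real.cosh := by
    ext s; rw [Real.tanh_eq_sinh_div_cosh]; rfl
  rw [e]
  refine this.congr_deriv ?_
  rw [xx, ← Real.cosh_sq_sub_sinh_sq t]
  field_simp

lemma hasDerivAt_xx (t : ℝ) : HasDerivAt xx (-2 * Real.tanh t * xx t) t := by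
  have e : xx = fun s => 1 - Real.tanh s ^ 2 := funext xx_eq
  have := ((hasDerivAt_tanh' t).pow 2).const_sub 1
  rw [e]
  refine this.congr_deriv ?_
  simp only [← xx_eq]; push_cast; ring

lemma hasDerivAt_L (t : ℝ) : HasDerivAt (fun s => Real.log (2 * Real.cosh s)) (Real.tanh t) t := by
  have h := Real.cosh_pos t
  have := ((Real.hasDerivAt_cosh t).const_mul 2).log (by positivity)
  refine this.congr_deriv ?_
  rw [Real.tanh_eq_sinh_div_cosh]; field_simp

/-- `(2cosh t)^{-2a} ∑ f_n cosh^{-2n}` -/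
def EE (a : ℂ) (f : ℕ → ℂ) (t : ℝ) : ℂ :=
  Complex.exp (-(2 * a) * (Real.log (2 * Real.cosh t) : ℝ)) * PS f (xx t)

lemma hasDerivAt_EE {a : ℂ} {f : ℕ → ℂ} (hf : AbsSum f) {t : ℝ} (ht : 0 < t) :
    HasDerivAt (EE a f) (-2 * (Real.tanh t : ℂ) * EE a (fun n => (a + n) * f n) t) t := by
  obtain ⟨D, h1, h2⟩ := hf.theta_deriv a (norm_xx ht)
  have e1 := h1.comp t (hasDerivAt_xx t).ofReal_comp
  have e2 := (((hasDerivAt_L t).ofReal_comp).const_mul (-(2 * a))).cexp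
  refine (e2.mul e1).congr_deriv ?_
  simp only [EE, Function.comp_apply, Complex.ofReal_mul, Complex.ofReal_neg, Complex.ofReal_ofNat]
  linear_combination (-2 * (Real.tanh t : ℂ) *
    Complex.exp (-(2 * a) * (Real.log (2 * Real.cosh t) : ℝ))) * h2

section
variable {m₁ m₂ : ℕ} {lam : ℂ}

lemma pa_ne (hlam : ∀ n : ℤ, 2 * lam ≠ (n : ℂ)) (n : ℕ) : pa m₁ m₂ lam + n ≠ 0 := by
  intro h
  apply hlam (-(m₁ + 2 * m₂ + 4 * n))
  unfold pa at h
  push_cast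
  linear_combination 4 * h

lemma pb_ne (hlam : ∀ n : ℤ, 2 * lam ≠ (n : ℂ)) (n : ℕ) : pb m₁ lam + n ≠ 0 := by
  intro h
  apply hlam (-(m₁ + 2 + 4 * n))
  unfold pb at h
  push_cast
  linear_combination 4 * h

lemma pc_ne (hlam : ∀ n : ℤ, 2 * lam ≠ (n : ℂ)) (n : ℕ) : (1 + lam) + n ≠ 0 := by
  intro h
  apply hlam (-(2 + 2 * n))
  push_cast
  linear_combination 2 * h

/-- the coefficients -/
def ff (m₁ m₂ : ℕ) (lam : ℂ) : ℕ → ℂ := hc (pa m₁ m₂ lam) (pb m₁ lam) (1 + lam)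

lemma ff_absSum (hlam : ∀ n : ℤ, 2 * lam ≠ (n : ℂ)) : AbsSum (ff m₁ m₂ lam) :=
  hc_absSum (pa_ne hlam) (pb_ne hlam) (pc_ne hlam)

/-- the explicit solution -/
def Esol (m₁ m₂ : ℕ) (lam : ℂ) : ℝ → ℂ := EE (pa m₁ m₂ lam) (ff m₁ m₂ lam)

lemma deriv_Esol (hlam : ∀ n : ℤ, 2 * lam ≠ (n : ℂ)) {t : ℝ} (ht : 0 < t) :
    deriv (Esol m₁ m₂ lam) t = -2 * (Real.tanh t : ℂ) *
      EE (pa m₁ m₂ lam) (fun n => (pa m₁ m₂ lam + n) * ff m₁ m₂ lam n) t :=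
  (hasDerivAt_EE (ff_absSum hlam) ht).deriv

lemma Esol_isSol (hlam : ∀ n : ℤ, 2 * lam ≠ (n : ℂ)) : IsSol m₁ m₂ lam (Esol m₁ m₂ lam) := by
  intro t ht
  have hf : AbsSum (ff m₁ m₂ lam) := ff_absSum hlam
  have hf1 := hf.theta (pa m₁ m₂ lam)
  have hf2 := hf1.theta (pa m₁ m₂ lam)
  have hev : deriv (Esol m₁ m₂ lam) =ᶠ[𝓝 t] fun t => -2 * (Real.tanh t : ℂ) *
      EE (pa m₁ m₂ lam) (fun n => (pa m₁ m₂ lam + n) * ff m₁ m₂ lam n) t := by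
    filter_upwards [Ioi_mem_nhds ht] with s hs using deriv_Esol hlam hs
  have h2 := ((((hasDerivAt_tanh' t).ofReal_comp).const_mul (-2)).mul
    (hasDerivAt_EE (a := pa m₁ m₂ lam) hf1 ht)).congr_of_eventuallyEq hev
  refine ⟨(hasDerivAt_EE hf ht).differentiableAt, h2.differentiableAt, ?_⟩
  unfold RadialODEt
  rw [h2.deriv, deriv_Esol hlam ht]
  -- the series relation
  have hz := norm_xx ht
  have s0 := hf.hasSum hz
  have s1 := hf1.hasSum hz
  have s2 := hf2.hasSum hz
  have hrho : (rho m₁ m₂ : ℂ) = (m₁ : ℂ) / 2 + m₂ := by simp [rho]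
  have rel := hc_rel (a := pa m₁ m₂ lam) (b := pb m₁ lam) (lam := lam) (z := (xx t : ℂ))
    (L := PS (fun n => (pa m₁ m₂ lam + n) * ((pa m₁ m₂ lam + n) * ff m₁ m₂ lam n)) (xx t)
      - rho m₁ m₂ * PS (fun n => (pa m₁ m₂ lam + n) * ff m₁ m₂ lam n) (xx t)
      + ((rho m₁ m₂ : ℂ) ^ 2 - lam ^ 2) / 4 * PS (ff m₁ m₂ lam) (xx t))
    (R := PS (fun n => (pa m₁ m₂ lam + n) * ((pa m₁ m₂ lam + n) * ff m₁ m₂ lam n)) (xx t)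
      + (1 - m₂) / 2 * PS (fun n => (pa m₁ m₂ lam + n) * ff m₁ m₂ lam n) (xx t))
    (pc_ne hlam)
    (hasSum_of_eq ((s2.sub (s1.mul_left _)).add (s0.mul_left _)) fun n => by
      simp only [hrho, pa, ff]; ring)
    (hasSum_of_eq (s2.add (s1.mul_left _)) fun n => by
      simp only [pa, pb, ff]; ring)
  -- coth relations
  have hc := Real.cosh_pos t
  have hs := Real.sinh_pos_iff.2 ht
  have hth : (m₁ * cothR t + 2 * m₂ * cothR (2 * t)) * Real.tanh t
      = m₁ + m₂ + m₂ * Real.tanh t ^ 2 := by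
    rw [cothR, cothR, Real.cosh_two_mul, Real.sinh_two_mul, Real.tanh_eq_sinh_div_cosh]
    field_simp
    ring
  have hthc : ((m₁ * cothR t + 2 * m₂ * cothR (2 * t) : ℝ) : ℂ) * (Real.tanh t : ℂ)
      = m₁ + m₂ + m₂ * (Real.tanh t : ℂ) ^ 2 := by exact_mod_cast hth
  have hx : (xx t : ℂ) = 1 - (Real.tanh t : ℂ) ^ 2 := by rw [xx_eq]; push_cast; rfl
  simp only [Esol, EE] at *
  generalize Complex.exp (-(2 * pa m₁ m₂ lam) * (Real.log (2 * Real.cosh t) : ℝ)) = X at *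
  generalize PS (ff m₁ m₂ lam) (xx t) = S0 at *
  generalize PS (fun n => (pa m₁ m₂ lam + n) * ff m₁ m₂ lam n) (xx t) = S1 at *
  generalize PS (fun n => (pa m₁ m₂ lam + n) * ((pa m₁ m₂ lam + n) * ff m₁ m₂ lam n)) (xx t)
    = S2 at *
  generalize ((m₁ * cothR t + 2 * m₂ * cothR (2 * t) : ℝ) : ℂ) = CC at *
  rw [hrho] at *
  rw [hx] at *
  linear_combination 4 * X * rel - 2 * X * S1 * hthc

lemma Esol_asym (hlam : ∀ n : ℤ, 2 * lam ≠ (n : ℂ)) : Asym m₁ m₂ lam (Esol m₁ m₂ lam) := by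
  have ido : AnalyticAt ℝ (fun y : ℝ => y) 0 := analyticAt_id
  have hoR : ∀ {u : ℝ → ℝ}, AnalyticAt ℝ u 0 → AnalyticAt ℝ (fun y => (u y : ℂ)) 0 := fun hu =>
    (Complex.ofRealCLM.analyticAt _).comp hu
  have hlog : AnalyticAt ℝ (fun y : ℝ => Real.log (1 + y ^ 2)) 0 :=
    (analyticAt_const.add (ido.pow 2)).log (by norm_num)
  have hxy : AnalyticAt ℝ (fun y : ℝ => 4 * y ^ 2 / (1 + y ^ 2) ^ 2) 0 :=
    (analyticAt_const.mul (ido.pow 2)).div ((analyticAt_const.add (ido.pow 2)).pow 2) (by norm_num)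
  refine ⟨fun y => Complex.exp (-(2 * pa m₁ m₂ lam) * (Real.log (1 + y ^ 2) : ℝ)) *
    PS (ff m₁ m₂ lam) ((4 * y ^ 2 / (1 + y ^ 2) ^ 2 : ℝ) : ℂ), ?_, ?_, ?_⟩
  · refine AnalyticAt.mul ?_ ?_
    · have he : ∀ w : ℂ, AnalyticAt ℝ Complex.exp w := fun w =>
        (analyticAt_cexp (z := w)).restrictScalars (𝕜 := ℝ)
      exact (he _).comp (f := fun y : ℝ => -(2 * pa m₁ m₂ lam) * ((Real.log (1 + y ^ 2) : ℝ) : ℂ))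
        (analyticAt_const.mul (hoR hlog))
    · have h1 : AnalyticAt ℝ (PS (ff m₁ m₂ lam)) (((4 * (0 : ℝ) ^ 2 / (1 + (0 : ℝ) ^ 2) ^ 2 : ℝ)) : ℂ) := by
        have : AnalyticAt ℂ (PS (ff m₁ m₂ lam)) 0 := (ff_absSum hlam).analyticAt
        simpa using this.restrictScalars (𝕜 := ℝ)
      exact h1.comp (f := fun y : ℝ => ((4 * y ^ 2 / (1 + y ^ 2) ^ 2 : ℝ) : ℂ)) (hoR hxy)
  · have h0 : PS (ff m₁ m₂ lam) 0 = 1 := by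
      rw [PS, tsum_eq_single 0 (fun n hn => by simp [hn])]
      simp [ff, hc]
    simp [h0]
  · refine Eventually.of_forall fun t => ?_
    have hc := Real.cosh_pos t
    have he := Real.exp_pos t
    have hcosh : 2 * Real.cosh t = Real.exp t * (1 + Real.exp (-t) ^ 2) := by
      rw [Real.cosh_eq, Real.exp_neg]; field_simp
    have h1 : Real.log (2 * Real.cosh t) = t + Real.log (1 + Real.exp (-t) ^ 2) := by
      rw [hcosh, Real.log_mul he.ne' (by positivity), Real.log_exp]
    have h2 : xx t = 4 * Real.exp (-t) ^ 2 / (1 + Real.exp (-t) ^ 2) ^ 2 := by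
      have : Real.cosh t = Real.exp t * (1 + Real.exp (-t) ^ 2) / 2 := by linarith
      rw [xx, this, Real.exp_neg]; field_simp; norm_num
    simp only [Esol, EE]
    rw [h1, ← h2, ← mul_assoc, ← Complex.exp_add]
    congr 2
    simp only [pa, rho]; push_cast; ring

lemma tendsto_xx : Tendsto xx (𝓝[>] 0) (𝓝[<] 1) := by
  refine tendsto_nhdsWithin_iff.2 ⟨?_, ?_⟩
  · have : Tendsto xx (𝓝 0) (𝓝 (xx 0)) := (hasDerivAt_xx 0).continuousAt
    have h : xx 0 = 1 := by simp [xx]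
    rw [h] at this
    exact this.mono_left nhdsWithin_le_nhds
  · filter_upwards [self_mem_nhdsWithin] with t ht using xx_lt_one ht

/-- limit value of the weighted derivative of `E` at `0` -/
def lim0 (m₁ m₂ : ℕ) (lam : ℂ) : ℂ :=
  -2 * 2 ^ m₂ * (2 : ℂ) ^ (-((rho m₁ m₂ : ℂ) + lam)) *
    (Complex.Gamma (1 + lam) * Complex.Gamma ((((m₁ : ℝ) + m₂ + 1) / 2 : ℝ) : ℂ) /
      (Complex.Gamma (pa m₁ m₂ lam) * Complex.Gamma (pb m₁ lam)))

lemma Esol_lim (hlam : ∀ n : ℤ, 2 * lam ≠ (n : ℂ)) :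
    Tendsto (fun t => (Dl m₁ m₂ t : ℂ) * deriv (Esol m₁ m₂ lam) t) (𝓝[>] 0)
      (𝓝 (lim0 m₁ m₂ lam)) := by
  have hA : (0 : ℝ) < ((m₁ : ℝ) + m₂ + 1) / 2 := by positivity
  have hf1 := (ff_absSum (m₁ := m₁) (m₂ := m₂) hlam).theta (pa m₁ m₂ lam)
  have habel := abel_lemma (bc_pos hA) (fun x h0 h1 => bc_hasSum _ h0 h1) (bc_tendsto hA)
    (coef_tendsto (a := pa m₁ m₂ lam) (b := pb m₁ lam) (c := 1 + lam) hA
      (by simp only [pa, pb]; push_cast; ring) (pa_ne hlam) (pb_ne hlam) (pc_ne hlam))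
    (G := fun x => PS (fun n => (pa m₁ m₂ lam + n) * ff m₁ m₂ lam n) x)
    (fun x h0 h1 => hf1.hasSum (by simpa [abs_of_nonneg h0] using h1))
  have h1 := habel.comp tendsto_xx
  have h2 : Tendsto (fun t : ℝ => -2 * 2 ^ m₂ * (Real.cosh t : ℂ) ^ (m₁ + 2 * m₂) *
      Complex.exp (-(2 * pa m₁ m₂ lam) * (Real.log (2 * Real.cosh t) : ℝ))) (𝓝[>] 0)
      (𝓝 (-2 * 2 ^ m₂ * (2 : ℂ) ^ (-((rho m₁ m₂ : ℂ) + lam)))) := by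
    have hcont : ContinuousAt (fun t : ℝ => -2 * 2 ^ m₂ * (Real.cosh t : ℂ) ^ (m₁ + 2 * m₂) *
      Complex.exp (-(2 * pa m₁ m₂ lam) * (Real.log (2 * Real.cosh t) : ℝ))) 0 := by
      have c1 : ContinuousAt (fun t : ℝ => ((Real.log (2 * Real.cosh t) : ℝ) : ℂ)) 0 :=
        (hasDerivAt_L 0).ofReal_comp.continuousAt
      have c2 : ContinuousAt (fun t : ℝ => (Real.cosh t : ℂ)) 0 :=
        (Real.hasDerivAt_cosh 0).ofReal_comp.continuousAt
      exact (continuousAt_const.mul (c2.pow _)).mul (continuousAt_const.mul c1).cexp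
    have := hcont.tendsto.mono_left (nhdsWithin_le_nhds (s := Ioi 0))
    convert this using 2
    rw [Complex.cpow_def_of_ne_zero two_ne_zero]
    simp only [Real.cosh_zero, mul_one, Complex.ofReal_one, one_pow]
    rw [show Complex.log 2 = ((Real.log 2 : ℝ) : ℂ) by
      rw [Complex.ofReal_log (by norm_num)]; norm_num]
    congr 2
    simp only [pa, rho]; push_cast; ring
  have h3 := h2.mul h1
  refine h3.congr' ?_
  filter_upwards [self_mem_nhdsWithin] with t ht
  have ht : 0 < t := ht
  have hc := Real.cosh_pos t
  have hs := Real.sinh_pos_iff.2 ht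
  rw [deriv_Esol hlam ht]
  have hV : (1 - xx t) ^ (((m₁ : ℝ) + m₂ + 1) / 2) = Real.tanh t ^ (m₁ + m₂ + 1) := by
    have : 1 - xx t = Real.tanh t ^ (2 : ℝ) := by rw [xx_eq]; norm_num
    rw [this, ← Real.rpow_mul (tanh_pos' ht).le, ← Real.rpow_natCast]
    congr 1; push_cast; ring
  have hD : Dl m₁ m₂ t * Real.tanh t
      = 2 ^ m₂ * Real.cosh t ^ (m₁ + 2 * m₂) * Real.tanh t ^ (m₁ + m₂ + 1) := by
    rw [Dl, Real.sinh_two_mul, Real.tanh_eq_sinh_div_cosh]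
    simp only [mul_pow, div_pow, pow_add, pow_one, pow_mul]
    field_simp
    ring
  have hDc : (Dl m₁ m₂ t : ℂ) * (Real.tanh t : ℂ)
      = 2 ^ m₂ * (Real.cosh t : ℂ) ^ (m₁ + 2 * m₂) * (Real.tanh t : ℂ) ^ (m₁ + m₂ + 1) := by
    exact_mod_cast hD
  simp only [Function.comp_apply, hV, EE]
  push_cast at hDc ⊢
  rw [one_div, div_inv_eq_mul]
  linear_combination (2 * Complex.exp (-(2 * pa m₁ m₂ lam) * (Real.log (2 * Real.cosh t) : ℝ)) *
    PS (fun n => (pa m₁ m₂ lam + n) * ff m₁ m₂ lam n) (xx t)) * hDc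

end

lemma sol_lim {m₁ m₂ : ℕ} {lam : ℂ} (hlam : ∀ n : ℤ, 2 * lam ≠ (n : ℂ)) {q : ℝ → ℂ}
    (hq : IsSol m₁ m₂ lam q) (aq : Asym m₁ m₂ lam q) :
    Tendsto (fun t => (Dl m₁ m₂ t : ℂ) * deriv q t) (𝓝[>] 0) (𝓝 (lim0 m₁ m₂ lam)) := by
  have hlam' : ∀ n : ℤ, 2 * (-lam) ≠ (n : ℂ) := fun n hn => hlam (-n) (by
    push_cast; linear_combination -hn)
  have he : IsSol m₁ m₂ lam (Esol m₁ m₂ (-lam)) := by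
    simpa using (Esol_isSol (m₁ := m₁) (m₂ := m₂) hlam').neg_lam
  refine (Esol_lim hlam).congr' ?_
  filter_upwards [self_mem_nhdsWithin] with t ht
  have : Esol m₁ m₂ lam =ᶠ[𝓝 t] q := by
    filter_upwards [Ioi_mem_nhds ht] with s hs
    exact (sol_unique hlam hq (Esol_isSol hlam) he aq (Esol_asym hlam) (Esol_asym hlam') hs).symm
  rw [this.deriv_eq]


lemma Dl_mono (m₁ m₂ : ℕ) {s t : ℝ} (hs : 0 ≤ s) (hst : s ≤ t) : Dl m₁ m₂ s ≤ Dl m₁ m₂ t := by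
  have h1 : 0 ≤ Real.sinh s := Real.sinh_nonneg_iff.2 hs
  have h2 : 0 ≤ Real.sinh (2 * s) := Real.sinh_nonneg_iff.2 (by linarith)
  have h3 : Real.sinh s ≤ Real.sinh t := Real.sinh_le_sinh.2 hst
  have h4 : Real.sinh (2 * s) ≤ Real.sinh (2 * t) := Real.sinh_le_sinh.2 (by linarith)
  unfold Dl
  have : 0 ≤ Real.sinh t := h1.trans h3
  gcongr

lemma Dl_nonneg (m₁ m₂ : ℕ) {t : ℝ} (ht : 0 ≤ t) : 0 ≤ Dl m₁ m₂ t := by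
  have h1 : 0 ≤ Real.sinh t := Real.sinh_nonneg_iff.2 ht
  have h2 : 0 ≤ Real.sinh (2 * t) := Real.sinh_nonneg_iff.2 (by linarith)
  unfold Dl; positivity

lemma Dl_diff (m₁ m₂ : ℕ) : Differentiable ℝ (Dl m₁ m₂) := by
  unfold Dl
  exact (Real.differentiable_sinh.pow _).mul
    ((Real.differentiable_sinh.comp (differentiable_id.const_mul 2)).pow _)

lemma Dl_zero {m₁ : ℕ} (m₂ : ℕ) (hm₁ : 1 ≤ m₁) : Dl m₁ m₂ 0 = 0 := by
  simp [Dl, show m₁ ≠ 0 by omega]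

lemma phi_bound {m₁ m₂ : ℕ} (hm₁ : 1 ≤ m₁) {lam : ℂ} {φ : ℝ → ℂ}
    (hc : ContinuousOn φ (Ici 0)) (hφ : IsSol m₁ m₂ lam φ) :
    ∃ C : ℝ, 0 ≤ C ∧ ∀ t : ℝ, 0 < t → t ≤ 1 →
      ‖(Dl m₁ m₂ t : ℂ) * deriv φ t‖ ≤ C * t * Dl m₁ m₂ t := by
  set κ : ℂ := (rho m₁ m₂ : ℂ) ^ 2 - lam ^ 2 with hκ
  set ψ : ℝ → ℂ := fun t => φ (max t 0) with hψ
  have hψc : Continuous ψ := hc.comp_continuous (by fun_prop) (fun t => Set.mem_Ici.2 (le_max_right _ _))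
  have hcontI : Continuous fun t => (Dl m₁ m₂ t : ℂ) * ψ t :=
    (Complex.continuous_ofReal.comp (Dl_diff m₁ m₂).continuous).mul hψc
  have hI : ∀ t, HasDerivAt (fun t => ∫ s in (0 : ℝ)..t, (Dl m₁ m₂ s : ℂ) * ψ s)
      ((Dl m₁ m₂ t : ℂ) * ψ t) t := fun t =>
    intervalIntegral.integral_hasDerivAt_right (hcontI.intervalIntegrable _ _)
      (hcontI.stronglyMeasurableAtFilter _ _) hcontI.continuousAt
  obtain ⟨L, hL⟩ := const_of_deriv (f := fun t => (Dl m₁ m₂ t : ℂ) * deriv φ t +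
      κ * ∫ s in (0 : ℝ)..t, (Dl m₁ m₂ s : ℂ) * ψ s) (by
    intro t ht
    refine ((hasDerivAt_Dl_deriv hφ ht).add ((hI t).const_mul κ)).congr_deriv ?_
    simp only [hψ, max_eq_left ht.le]
    ring)
  obtain ⟨M, hM⟩ := (isCompact_Icc (a := (0 : ℝ)) (b := 1)).exists_bound_of_continuousOn
    hψc.continuousOn
  have hM0 : 0 ≤ M := (norm_nonneg _).trans (hM 0 (by simp))
  have hIb : ∀ t : ℝ, 0 < t → t ≤ 1 →
      ‖κ * ∫ s in (0 : ℝ)..t, (Dl m₁ m₂ s : ℂ) * ψ s‖ ≤ (‖κ‖ * M) * t * Dl m₁ m₂ t := by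
    intro t h0 h1
    have := intervalIntegral.norm_integral_le_of_norm_le_const (a := 0) (b := t)
      (C := Dl m₁ m₂ t * M) (f := fun s => (Dl m₁ m₂ s : ℂ) * ψ s) (by
        intro s hs
        rw [uIoc_of_le h0.le] at hs
        rw [norm_mul, Complex.norm_real, Real.norm_of_nonneg (Dl_nonneg _ _ hs.1.le)]
        exact mul_le_mul (Dl_mono _ _ hs.1.le hs.2) (hM s ⟨hs.1.le, hs.2.trans h1⟩)
          (norm_nonneg _) (Dl_nonneg _ _ h0.le))
    rw [sub_zero, abs_of_pos h0] at this
    rw [norm_mul]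
    calc _ ≤ ‖κ‖ * (Dl m₁ m₂ t * M * t) := by gcongr
      _ = _ := by ring
  have hbd : ∀ t : ℝ, 0 < t → t ≤ 1 →
      ‖(Dl m₁ m₂ t : ℂ) * deriv φ t - L‖ ≤ (‖κ‖ * M) * t * Dl m₁ m₂ t := by
    intro t h0 h1
    rw [← hL t h0]
    simp only [sub_add_cancel_left, norm_neg]
    exact hIb t h0 h1
  suffices hL0 : L = 0 by
    refine ⟨‖κ‖ * M, by positivity, fun t h0 h1 => ?_⟩
    have := hbd t h0 h1
    rwa [hL0, sub_zero] at this
  by_contra hLn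
  have hDlim : Tendsto (fun t => (Dl m₁ m₂ t : ℂ) * deriv φ t) (𝓝[>] 0) (𝓝 L) := by
    rw [tendsto_iff_norm_sub_tendsto_zero]
    have hz : Tendsto (fun t : ℝ => (‖κ‖ * M) * t * Dl m₁ m₂ t) (𝓝[>] 0) (𝓝 0) := by
      have : Continuous (fun t : ℝ => (‖κ‖ * M) * t * Dl m₁ m₂ t) :=
        (continuous_const.mul continuous_id).mul (Dl_diff m₁ m₂).continuous
      have := (this.tendsto 0).mono_left (nhdsWithin_le_nhds (s := Ioi 0))
      simpa using this
    refine squeeze_zero' (Eventually.of_forall fun _ => norm_nonneg _) ?_ hz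
    filter_upwards [Ioc_mem_nhdsGT (show (0 : ℝ) < 1 by norm_num)] with t ht using hbd t ht.1 ht.2
  have hre : Tendsto (fun t => ((Dl m₁ m₂ t : ℂ) * deriv φ t / L).re) (𝓝[>] 0) (𝓝 1) := by
    have := (Complex.continuous_re.tendsto _).comp (hDlim.div_const L)
    simpa [hLn, Function.comp_def] using this
  have hO := ((Dl_diff m₁ m₂) 0).hasDerivAt.isBigO_sub
  simp only [Dl_zero m₂ hm₁, sub_zero] at hO
  obtain ⟨B, hBpos, hB⟩ := hO.exists_pos
  have hB' := (hB.bound).filter_mono (nhdsWithin_le_nhds (s := Ioi (0 : ℝ)))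
  obtain ⟨δ, hδ, hδ'⟩ := mem_nhdsGT_iff_exists_Ioo_subset.1
    (hB'.and (hre.eventually (lt_mem_nhds (show (1 / 2 : ℝ) < 1 by norm_num))))
  have hδ : 0 < δ := hδ
  -- monotone function
  set u : ℝ → ℝ := fun t => (φ t / L).re - 1 / (2 * B) * Real.log t with hu
  have hud : ∀ t ∈ Ioo (0 : ℝ) δ, HasDerivAt u ((deriv φ t / L).re - 1 / (2 * B) * t⁻¹) t := by
    intro t ht
    have h1 := ((hφ t ht.1).1.hasDerivAt.div_const L)
    have h2 := (Complex.reCLM.hasFDerivAt.comp_hasDerivAt t h1)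
    exact h2.sub ((Real.hasDerivAt_log ht.1.ne').const_mul _)
  have hmono : MonotoneOn u (Ioo 0 δ) := by
    refine monotoneOn_of_deriv_nonneg (convex_Ioo 0 δ)
      (fun t ht => (hud t ht).continuousAt.continuousWithinAt) ?_ ?_
    · rw [interior_Ioo]; exact fun t ht => (hud t ht).differentiableAt.differentiableWithinAt
    · rw [interior_Ioo]
      intro t ht
      rw [(hud t ht).deriv]
      obtain ⟨b1, b2⟩ := hδ' ht
      have hDp := Dl_pos m₁ m₂ ht.1
      have htp : 0 < t := ht.1
      have b1 : Dl m₁ m₂ t ≤ B * t := by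
        have b1' : ‖Dl m₁ m₂ t‖ ≤ B * ‖t‖ := b1
        rwa [Real.norm_of_nonneg hDp.le, Real.norm_of_nonneg htp.le] at b1'
      have b2 : 1 / 2 < ((Dl m₁ m₂ t : ℂ) * deriv φ t / L).re := b2
      rw [mul_div_assoc, Complex.re_ofReal_mul] at b2
      set r := (deriv φ t / L).re
      have hr : 0 < r := by
        by_contra hneg
        have := mul_nonpos_of_nonneg_of_nonpos hDp.le (not_lt.1 hneg)
        linarith
      have h3 : 1 / 2 < B * t * r := b2.trans_le (mul_le_mul_of_nonneg_right b1 hr.le)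
      rw [sub_nonneg, ← one_div, div_mul_div_comm, one_mul, div_le_iff₀ (by positivity)]
      nlinarith
  -- contradiction
  have hφlim : Tendsto φ (𝓝[>] 0) (𝓝 (φ 0)) :=
    (hc 0 self_mem_Ici).tendsto.mono_left (nhdsWithin_mono _ Ioi_subset_Ici_self)
  have l1 : Tendsto (fun t => (φ t / L).re) (𝓝[>] 0) (𝓝 (φ 0 / L).re) :=
    (Complex.continuous_re.tendsto _).comp (hφlim.div_const L)
  have l2 : Tendsto (fun t => u (δ / 2) + 1 / (2 * B) * Real.log t) (𝓝[>] 0) atBot :=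
    tendsto_atBot_add_const_left _ _
      (Real.tendsto_log_nhdsGT_zero.const_mul_atBot (by positivity))
  have l3 : Tendsto (fun t => (φ t / L).re) (𝓝[>] 0) atBot := by
    refine tendsto_atBot_mono' _ ?_ l2
    filter_upwards [Ioo_mem_nhdsGT (show (0 : ℝ) < δ / 2 by positivity)] with t ht
    have := hmono (show t ∈ Ioo 0 δ from ⟨ht.1, by linarith [ht.2]⟩)
      (show δ / 2 ∈ Ioo 0 δ from ⟨by positivity, by linarith⟩) ht.2.le
    have h4 : u t = (φ t / L).re - 1 / (2 * B) * Real.log t := rfl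
    linarith
  exact not_tendsto_nhds_of_tendsto_atBot l3 _ l1

lemma Wr_phi {m₁ m₂ : ℕ} (hm₁ : 1 ≤ m₁) {lam : ℂ} {φ q : ℝ → ℂ} {l : ℂ}
    (hc : ContinuousOn φ (Ici 0)) (h0 : φ 0 = 1) (hφ : IsSol m₁ m₂ lam φ) (hq : IsSol m₁ m₂ lam q)
    (hl : Tendsto (fun t => (Dl m₁ m₂ t : ℂ) * deriv q t) (𝓝[>] 0) (𝓝 l))
    {t : ℝ} (ht : 0 < t) : Wr m₁ m₂ φ q t = l := by
  obtain ⟨K, hK⟩ := Wr_const hφ hq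
  rw [hK t ht]
  obtain ⟨C, hC0, hC⟩ := phi_bound hm₁ hc hφ
  have hφlim : Tendsto φ (𝓝[>] 0) (𝓝 1) := by
    rw [← h0]
    exact (hc 0 self_mem_Ici).tendsto.mono_left (nhdsWithin_mono _ Ioi_subset_Ici_self)
  obtain ⟨δ, hδ, hδ'⟩ := mem_nhdsGT_iff_exists_Ioo_subset.1
    (hl.norm.eventually_lt_const (show ‖l‖ < ‖l‖ + 1 by linarith))
  have hδ : 0 < δ := hδ
  set B := ‖l‖ + 1 with hB
  have hBp : 0 < B := by positivity
  set T := δ / 2 with hT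
  have hTp : 0 < T := by positivity
  have hQ : ∀ s : ℝ, 0 < s → s ≤ T → Dl m₁ m₂ s * ‖q s‖ ≤ Dl m₁ m₂ T * ‖q T‖ + B * T := by
    intro s hs hsT
    have hDs := Dl_pos m₁ m₂ hs
    have hmv := (convex_Icc s T).norm_image_sub_le_of_norm_deriv_le (f := q)
      (C := B / Dl m₁ m₂ s) (fun r hr => (hq r (hs.trans_le hr.1)).1) (by
        intro r hr
        have hr0 := hs.trans_le hr.1
        have h1 : ‖(Dl m₁ m₂ r : ℂ) * deriv q r‖ < B :=
          hδ' ⟨hr0, by have := hr.2; linarith⟩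
        rw [norm_mul, Complex.norm_real, Real.norm_of_nonneg (Dl_pos m₁ m₂ hr0).le] at h1
        rw [le_div_iff₀ hDs, mul_comm]
        exact (mul_le_mul_of_nonneg_right (Dl_mono m₁ m₂ hs.le hr.1) (norm_nonneg _)).trans h1.le)
      (right_mem_Icc.2 hsT) (left_mem_Icc.2 hsT)
    rw [Real.norm_eq_abs, abs_of_nonpos (by linarith)] at hmv
    have h2 : ‖q s‖ ≤ ‖q T‖ + B / Dl m₁ m₂ s * T := by
      have h3 : ‖q s‖ ≤ ‖q T‖ + ‖q s - q T‖ := by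
        have := norm_add_le (q T) (q s - q T); rwa [add_sub_cancel] at this
      have h4 : B / Dl m₁ m₂ s * -(s - T) ≤ B / Dl m₁ m₂ s * T := by
        apply mul_le_mul_of_nonneg_left _ (by positivity); linarith
      linarith
    calc Dl m₁ m₂ s * ‖q s‖ ≤ Dl m₁ m₂ s * (‖q T‖ + B / Dl m₁ m₂ s * T) := by gcongr
      _ = Dl m₁ m₂ s * ‖q T‖ + B * T := by field_simp
      _ ≤ _ := by have := Dl_mono m₁ m₂ hs.le hsT; gcongr
  set N := Dl m₁ m₂ T * ‖q T‖ + B * T with hN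
  have hz : Tendsto (fun s : ℝ => (Dl m₁ m₂ s : ℂ) * deriv φ s * q s) (𝓝[>] 0) (𝓝 0) := by
    rw [tendsto_zero_iff_norm_tendsto_zero]
    have hb : Tendsto (fun s : ℝ => C * s * N) (𝓝[>] 0) (𝓝 0) := by
      have : Continuous fun s : ℝ => C * s * N := by fun_prop
      simpa using (this.tendsto 0).mono_left (nhdsWithin_le_nhds (s := Ioi 0))
    refine squeeze_zero' (Eventually.of_forall fun _ => norm_nonneg _) ?_ hb
    filter_upwards [Ioc_mem_nhdsGT (show (0 : ℝ) < 1 by norm_num), Ioc_mem_nhdsGT hTp] with s h1 h2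
    rw [norm_mul]
    calc _ ≤ C * s * Dl m₁ m₂ s * ‖q s‖ := by
          exact mul_le_mul_of_nonneg_right (hC s h1.1 h1.2) (norm_nonneg _)
      _ = C * s * (Dl m₁ m₂ s * ‖q s‖) := by ring
      _ ≤ _ := mul_le_mul_of_nonneg_left (hQ s h2.1 h2.2) (mul_nonneg hC0 h1.1.le)
  have hfin := (hφlim.mul hl).sub hz
  rw [one_mul, sub_zero] at hfin
  refine tendsto_nhds_unique (tendsto_const_nhds.congr' ?_) hfin
  filter_upwards [self_mem_nhdsWithin] with s hs
  rw [← hK s hs, Wr]; ring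

lemma lim0_eq {m₁ m₂ : ℕ} (hm₁ : 1 ≤ m₁) {lam : ℂ} (hl : lam ≠ 0) :
    lim0 m₁ m₂ lam = -((1 / 2 : ℂ) ^ (m₁ + m₂) * (2 * lam)) * cfun m₁ m₂ lam := by
  have hrp : 0 < rho m₁ m₂ := by
    have : (1 : ℝ) ≤ m₁ := by exact_mod_cast hm₁
    unfold rho; positivity
  have hG : Complex.Gamma (rho m₁ m₂ : ℂ) ≠ 0 :=
    Complex.Gamma_ne_zero_of_re_pos (by simpa using hrp)
  have hGA : Complex.Gamma ((((m₁ : ℝ) + m₂ + 1) / 2 : ℝ) : ℂ) ≠ 0 :=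
    Complex.Gamma_ne_zero_of_re_pos (by rw [Complex.ofReal_re]; positivity)
  have hg : gfun m₁ m₂ (rho m₁ m₂ : ℂ) = (2 : ℂ) ^ (-(rho m₁ m₂ : ℂ)) /
      Complex.Gamma ((((m₁ : ℝ) + m₂ + 1) / 2 : ℝ) : ℂ) := by
    have e1 : ((m₁ : ℂ) / 2 + 1 + (rho m₁ m₂ : ℂ)) / 2 = ((((m₁ : ℝ) + m₂ + 1) / 2 : ℝ) : ℂ) := by
      simp only [rho]; push_cast; ring
    have e2 : ((m₁ : ℂ) / 2 + (m₂ : ℂ) + (rho m₁ m₂ : ℂ)) / 2 = (rho m₁ m₂ : ℂ) := by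
      simp only [rho]; push_cast; ring
    rw [gfun, e1, e2]
    field_simp
  have h2r : (2 : ℂ) ^ (-(rho m₁ m₂ : ℂ)) ≠ 0 := by
    rw [Ne, Complex.cpow_eq_zero_iff]; simp
  have hpow : (2 : ℂ) ^ (-(rho m₁ m₂ : ℂ)) * (2 : ℂ) ^ (-(rho m₁ m₂ : ℂ)) * 2 ^ m₂
      = (1 / 2 : ℂ) ^ (m₁ + m₂) := by
    rw [← Complex.cpow_add _ _ two_ne_zero, ← Complex.cpow_natCast 2 m₂,
      ← Complex.cpow_add _ _ two_ne_zero, one_div, inv_pow, ← Complex.cpow_natCast,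
      ← Complex.cpow_neg]
    congr 1
    simp only [rho]; push_cast; ring
  have hadd : (2 : ℂ) ^ (-((rho m₁ m₂ : ℂ) + lam)) = (2 : ℂ) ^ (-(rho m₁ m₂ : ℂ)) * (2 : ℂ) ^ (-lam) := by
    rw [← Complex.cpow_add _ _ two_ne_zero]; congr 1; ring
  rw [cfun, hg, lim0, hadd, add_comm 1 lam, Complex.Gamma_add_one _ hl, gfun, ← hpow, ← pa, ← pb]
  field_simp

theorem spherical_function_connection_formula (m₁ m₂ : ℕ) (hm₁ : 1 ≤ m₁) (lam : ℂ)
    (hlam : ∀ n : ℤ, 2 * lam ≠ (n : ℂ))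
    (φ : ℝ → ℂ) (hφc : ContinuousOn φ (Set.Ici 0)) (hφ0 : φ 0 = 1)
    (hφd : ∀ t ∈ Set.Ioi (0 : ℝ), DifferentiableAt ℝ φ t ∧ DifferentiableAt ℝ (deriv φ) t)
    (hφODE : ∀ t ∈ Set.Ioi (0 : ℝ), RadialODEt m₁ m₂ lam φ t)
    (Qp Qm : ℝ → ℂ)
    (hQpd : ∀ t ∈ Set.Ioi (0 : ℝ), DifferentiableAt ℝ Qp t ∧ DifferentiableAt ℝ (deriv Qp) t)
    (hQmd : ∀ t ∈ Set.Ioi (0 : ℝ), DifferentiableAt ℝ Qm t ∧ DifferentiableAt ℝ (deriv Qm) t)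
    (hQpODE : ∀ t ∈ Set.Ioi (0 : ℝ), RadialODEt m₁ m₂ lam Qp t)
    (hQmODE : ∀ t ∈ Set.Ioi (0 : ℝ), RadialODEt m₁ m₂ lam Qm t)
    (ε : ℝ) (hε : ε ∈ Set.Ioo (0 : ℝ) 1) (hp hm : ℝ → ℂ)
    (hhp : ∀ y ∈ Set.Ioo (-ε) ε, AnalyticAt ℝ hp y)
    (hhm : ∀ y ∈ Set.Ioo (-ε) ε, AnalyticAt ℝ hm y)
    (hhp0 : hp 0 = 1) (hhm0 : hm 0 = 1)
    (hQpas : ∀ t : ℝ, Real.exp (-t) < ε →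
      Qp t = Complex.exp (-((rho m₁ m₂ : ℂ) + lam) * t) * hp (Real.exp (-t)))
    (hQmas : ∀ t : ℝ, Real.exp (-t) < ε →
      Qm t = Complex.exp (-((rho m₁ m₂ : ℂ) - lam) * t) * hm (Real.exp (-t))) :
    ∀ t ∈ Set.Ioi (0 : ℝ),
      φ t = cfun m₁ m₂ (-lam) * Qp t + cfun m₁ m₂ lam * Qm t := by
  have hl : lam ≠ 0 := by rintro rfl; exact hlam 0 (by simp)
  have hlam' : ∀ n : ℤ, 2 * (-lam) ≠ (n : ℂ) := fun n hn => hlam (-n) (by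
    push_cast; linear_combination -hn)
  have sφ : IsSol m₁ m₂ lam φ := fun t ht => ⟨(hφd t ht).1, (hφd t ht).2, hφODE t ht⟩
  have sp : IsSol m₁ m₂ lam Qp := fun t ht => ⟨(hQpd t ht).1, (hQpd t ht).2, hQpODE t ht⟩
  have sm : IsSol m₁ m₂ lam Qm := fun t ht => ⟨(hQmd t ht).1, (hQmd t ht).2, hQmODE t ht⟩
  have hev : ∀ᶠ t : ℝ in atTop, Real.exp (-t) < ε := tendsto_y.eventually_lt_const hε.1
  have h0m : (0 : ℝ) ∈ Set.Ioo (-ε) ε := ⟨by linarith [hε.1], hε.1⟩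
  have ap : Asym m₁ m₂ lam Qp := ⟨hp, hhp 0 h0m, hhp0, hev.mono hQpas⟩
  have am : Asym m₁ m₂ (-lam) Qm := ⟨hm, hhm 0 h0m, hhm0, hev.mono fun t ht => by
    rw [hQmas t ht, sub_eq_add_neg]⟩
  intro t ht
  have ht : 0 < t := ht
  have hid := Wr_identity m₁ m₂ φ Qp Qm t
  rw [Wr_opp sp sm ap am ht, Wr_phi hm₁ hφc hφ0 sφ sm (sol_lim hlam' sm.neg_lam am) ht,
    Wr_phi hm₁ hφc hφ0 sφ sp (sol_lim hlam sp ap) ht, lim0_eq hm₁ hl,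
    lim0_eq hm₁ (neg_ne_zero.2 hl)] at hid
  have h2 : (1 / 2 : ℂ) ^ (m₁ + m₂) * (2 * lam) ≠ 0 :=
    mul_ne_zero (pow_ne_zero _ (by norm_num)) (mul_ne_zero two_ne_zero hl)
  apply mul_right_cancel₀ h2
  rw [hid]; ring

end
end

section
/- Let m₁ ≥ 1 and m₂ ≥ 0 be integers, ρ = m₁/2 + m₂, and let λ ∈ ℂ with Re λ > 0 and 2λ ∉ ℤ. Suppose φ : ℝ → ℂ is continuous on [0,∞), twice differentiable on (0,∞), φ(0) = 1, and satisfies φ''(t) + (m₁·coth(t) + 2m₂·coth(2t))·φ'(t) + (ρ² − λ²)·φ(t) = 0 for all t > 0. Then exp((ρ − λ)·t)·φ(t) tends to c(λ) = g(λ)/g(ρ) as t → ∞, where g(μ) = Γ(μ)·2^{−μ} / (Γ((m₁/2 + 1 + μ)/2)·Γ((m₁/2 + m₂ + μ)/2)). -/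
open Set Filter Topology

noncomputable section

/-- rising factorial -/
def poch (a : ℂ) (n : ℕ) : ℂ := ∏ j ∈ Finset.range n, (a + j)

lemma poch_succ (a : ℂ) (n : ℕ) : poch a (n+1) = poch a n * (a + n) := by
  simp [poch, Finset.prod_range_succ]

lemma poch_zero (a : ℂ) : poch a 0 = 1 := by simp [poch]

/-- hypergeometric coefficient -/
def hyp (a b c : ℂ) (n : ℕ) : ℂ := poch a n * poch b n / (poch c n * (n.factorial : ℂ))

lemma poch_ne_zero {c : ℂ} (hc : 0 < c.re) (n : ℕ) : poch c n ≠ 0 := by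
  rw [poch, Finset.prod_ne_zero_iff]
  intro j _ h
  have := congrArg Complex.re h
  simp at this
  have : (0:ℝ) ≤ j := by positivity
  linarith

lemma add_nat_ne_zero {c : ℂ} (hc : 0 < c.re) (n : ℕ) : c + n ≠ 0 := by
  intro h
  have := congrArg Complex.re h
  simp at this
  have : (0:ℝ) ≤ n := by positivity
  linarith

lemma hyp_zero (a b c : ℂ) : hyp a b c 0 = 1 := by simp [hyp, poch_zero]

lemma hyp_succ (a b : ℂ) {c : ℂ} (hc : 0 < c.re) (n : ℕ) :
    (n + 1) * (c + n) * hyp a b c (n+1) = (a + n) * (b + n) * hyp a b c n := by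
  have h1 := poch_ne_zero hc n
  have h2 := add_nat_ne_zero hc n
  have h3 : (n.factorial : ℂ) ≠ 0 := by exact_mod_cast n.factorial_ne_zero
  have h4 : (n + 1 : ℂ) ≠ 0 := by exact_mod_cast n.succ_ne_zero
  simp only [hyp, poch_succ, Nat.factorial_succ]
  push_cast
  field_simp

lemma poch_upper (a : ℂ) : ∃ C : ℝ, 0 ≤ C ∧ ∀ n : ℕ, 1 ≤ n →
    ‖poch a (n+1)‖ ≤ C * ((n:ℝ) ^ a.re * n.factorial) := by
  have hT : ∃ l, Tendsto (fun n => (Complex.GammaSeq a n)⁻¹) atTop (𝓝 l) := by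
    by_cases h : ∀ m : ℕ, a ≠ -m
    · exact ⟨_, (Complex.GammaSeq_tendsto_Gamma a).inv₀ (Complex.Gamma_ne_zero h)⟩
    · push Not at h
      obtain ⟨m, hm⟩ := h
      refine ⟨0, tendsto_const_nhds.congr' ?_⟩
      filter_upwards [eventually_ge_atTop m] with n hn
      have : ∏ j ∈ Finset.range (n+1), (a + (j:ℂ)) = 0 := by
        apply Finset.prod_eq_zero (i := m) (by simp; omega)
        rw [hm]; ring
      simp [Complex.GammaSeq, this]
  obtain ⟨l, hl⟩ := hT
  obtain ⟨C, hC⟩ := hl.norm.bddAbove_range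
  refine ⟨max C 0, le_max_right _ _, fun n hn => ?_⟩
  have h1 : ‖(Complex.GammaSeq a n)⁻¹‖ ≤ C := hC ⟨n, rfl⟩
  have hn0 : (0:ℝ) < n := by exact_mod_cast hn
  have h2 : poch a (n+1) = (Complex.GammaSeq a n)⁻¹ * ((n:ℂ)^a * n.factorial) := by
    have h3 : (n.factorial : ℂ) ≠ 0 := by exact_mod_cast n.factorial_ne_zero
    have h4 : (n : ℂ)^a ≠ 0 := by
      rw [Complex.cpow_ne_zero_iff]; left; exact_mod_cast hn0.ne'
    rw [Complex.GammaSeq, ← poch, inv_div]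
    field_simp
  rw [h2, norm_mul, norm_mul, Complex.norm_natCast_cpow_of_pos (by omega), Complex.norm_natCast]
  gcongr
  exact h1.trans (le_max_left _ _)

lemma poch_lower {c : ℂ} (hc : 0 < c.re) : ∃ C : ℝ, 0 ≤ C ∧ ∀ n : ℕ, 1 ≤ n →
    (n:ℝ) ^ c.re * n.factorial ≤ C * ‖poch c (n+1)‖ := by
  obtain ⟨C, hC⟩ := (Complex.GammaSeq_tendsto_Gamma c).norm.bddAbove_range
  refine ⟨max C 0, le_max_right _ _, fun n hn => ?_⟩
  have h1 : ‖(Complex.GammaSeq c n)‖ ≤ C := hC ⟨n, rfl⟩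
  have h2 : ((n:ℂ)^c * n.factorial) = (Complex.GammaSeq c n) * poch c (n+1) := by
    rw [Complex.GammaSeq, ← poch, div_mul_cancel₀ _ (poch_ne_zero hc _)]
  have h3 := congrArg norm h2
  rw [norm_mul, norm_mul, Complex.norm_natCast_cpow_of_pos (by omega), Complex.norm_natCast] at h3
  rw [h3]
  gcongr
  exact h1.trans (le_max_left _ _)

lemma hyp_bound (a b : ℂ) {c : ℂ} (hc : 0 < c.re) : ∃ C : ℝ, ∀ n : ℕ, 1 ≤ n →
    ((n:ℝ) + 1) * ‖hyp a b c (n+1)‖ ≤ C * (n:ℝ) ^ (-(c - a - b).re) := by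
  obtain ⟨A, hA0, hA⟩ := poch_upper a
  obtain ⟨B, hB0, hB⟩ := poch_upper b
  obtain ⟨D, hD0, hD⟩ := poch_lower hc
  refine ⟨A * B * D, fun n hn => ?_⟩
  have hn0 : (0:ℝ) < n := by exact_mod_cast hn
  have hf : (0:ℝ) < n.factorial := by exact_mod_cast n.factorial_pos
  have hp : 0 < ‖poch c (n+1)‖ := norm_pos_iff.2 (poch_ne_zero hc _)
  have e1 : ((n:ℝ) + 1) * ‖hyp a b c (n+1)‖ =
      ‖poch a (n+1)‖ * ‖poch b (n+1)‖ / (‖poch c (n+1)‖ * n.factorial) := by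
    rw [hyp, norm_div, norm_mul, norm_mul, Complex.norm_natCast, Nat.factorial_succ]
    push_cast
    field_simp
  have e2 : (n:ℝ) ^ (-(c - a - b).re) = (n:ℝ)^a.re * (n:ℝ)^b.re / (n:ℝ)^c.re := by
    rw [← Real.rpow_add hn0, ← Real.rpow_sub hn0]
    congr 1; simp; ring
  rw [e1, e2, div_le_iff₀ (by positivity)]
  have hcp : 0 < (n:ℝ)^c.re := Real.rpow_pos_of_pos hn0 _
  have h3 : ‖poch a (n+1)‖ * ‖poch b (n+1)‖ ≤
      (A * ((n:ℝ) ^ a.re * n.factorial)) * (B * ((n:ℝ) ^ b.re * n.factorial)) :=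
    mul_le_mul (hA n hn) (hB n hn) (norm_nonneg _) (by positivity)
  refine h3.trans ?_
  have h4 := hD n hn
  calc _ = A * B * ((n:ℝ)^a.re * (n:ℝ)^b.re / (n:ℝ)^c.re) * n.factorial * ((n:ℝ)^c.re * n.factorial) := by
        field_simp
    _ ≤ A * B * ((n:ℝ)^a.re * (n:ℝ)^b.re / (n:ℝ)^c.re) * n.factorial * (D * ‖poch c (n+1)‖) := by
        gcongr
    _ = _ := by ring

lemma hyp_summable (a b : ℂ) {c : ℂ} (hc : 0 < c.re) (h : 0 < (c - a - b).re) :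
    Summable (fun n => ‖hyp a b c n‖) := by
  obtain ⟨C, hC⟩ := hyp_bound a b hc
  rw [← summable_nat_add_iff 2]
  have hs : Summable (fun n : ℕ => C * ((n:ℝ)^(-(c - a - b).re - 1))) :=
    (Real.summable_nat_rpow.2 (by linarith)).mul_left C
  rw [← summable_nat_add_iff 1] at hs
  refine Summable.of_nonneg_of_le (fun n => norm_nonneg _) (fun n => ?_) hs
  have h1 := hC (n+1) (by omega)
  have hp : (0:ℝ) < ((n+1 : ℕ):ℝ) := by positivity
  rw [Real.rpow_sub hp, Real.rpow_one, mul_div_assoc', le_div_iff₀ hp]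
  refine le_trans ?_ h1
  rw [mul_comm]
  gcongr
  linarith

lemma hyp_tendsto (a b : ℂ) {c : ℂ} (hc : 0 < c.re) (h : 0 < (c - a - b).re) :
    Tendsto (fun n : ℕ => (n:ℂ) * hyp a b c n) atTop (𝓝 0) := by
  obtain ⟨C, hC⟩ := hyp_bound a b hc
  rw [← tendsto_add_atTop_iff_nat 1]
  have hs : Tendsto (fun n : ℕ => C * ((n:ℝ)^(-(c - a - b).re))) atTop (𝓝 0) := by
    simpa using ((tendsto_rpow_neg_atTop h).comp tendsto_natCast_atTop_atTop).const_mul C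
  refine squeeze_zero_norm' ?_ hs
  filter_upwards [eventually_ge_atTop 1] with n hn
  have := hC n hn
  rw [norm_mul, Complex.norm_natCast]
  push_cast
  exact this

/-- value at one -/
def hypS (a b c : ℂ) : ℂ := ∑' n, hyp a b c n

lemma hyp_c_succ (a b : ℂ) {c : ℂ} (hc : 0 < c.re) (n : ℕ) :
    (c + n) * hyp a b (c + 1) n = c * hyp a b c n := by
  have h : ∀ n : ℕ, c * poch (c+1) n = poch c n * (c + n) := by
    intro n
    induction n with
    | zero => simp [poch_zero]
    | succ k ih =>
      rw [poch_succ, poch_succ c k, ← mul_assoc, ih]; push_cast; ring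
  have h1 := poch_ne_zero hc n
  have h2 : poch (c+1) n ≠ 0 := poch_ne_zero (by simp; linarith) n
  have h3 : (n.factorial : ℂ) ≠ 0 := by exact_mod_cast n.factorial_ne_zero
  simp only [hyp]
  field_simp
  linear_combination -(poch a n * poch b n) * h n

lemma hypS_rec (a b : ℂ) {c : ℂ} (hc : 0 < c.re) (h : 0 < (c - a - b).re) :
    c * (c - a - b) * hypS a b c = (c - a) * (c - b) * hypS a b (c + 1) := by
  have hc1 : 0 < (c+1).re := by simp; linarith
  have s1 := (hyp_summable a b hc h).of_norm.hasSum
  have s2 := (hyp_summable a b hc1 (by simp at h ⊢; linarith)).of_norm.hasSum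
  have s3 := (s1.mul_left (c * (c - a - b))).sub (s2.mul_left ((c - a) * (c - b)))
  have h1 := s3.tendsto_sum_nat
  have h2 : ∀ N : ℕ, ∑ n ∈ Finset.range N, (c * (c - a - b) * hyp a b c n -
      (c - a) * (c - b) * hyp a b (c+1) n) = -c * (N * hyp a b c N) := by
    intro N
    induction N with
    | zero => simp
    | succ k ih =>
      rw [Finset.sum_range_succ, ih]
      have e1 := hyp_succ a b hc k
      have e2 := hyp_c_succ a b hc k
      have e3 := add_nat_ne_zero hc k
      apply mul_left_cancel₀ e3
      push_cast
      linear_combination c * e1 - (c-a)*(c-b) * e2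
  simp_rw [h2] at h1
  have h3 := tendsto_nhds_unique h1 ((hyp_tendsto a b hc h).const_mul (-c))
  simp only [hypS]
  linear_combination h3

lemma hypS_iter (a b : ℂ) {c : ℂ} (hc : 0 < c.re) (h : 0 < (c - a - b).re) (m : ℕ) :
    poch c m * poch (c - a - b) m * hypS a b c =
      poch (c - a) m * poch (c - b) m * hypS a b (c + m) := by
  induction m with
  | zero => simp [poch_zero]
  | succ k ih =>
    have hk : (0:ℝ) ≤ k := by positivity
    have := hypS_rec a b (c := c + k) (by simp; linarith) (by simp at h ⊢; linarith)
    simp only [poch_succ]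
    push_cast
    rw [← add_assoc]
    linear_combination (c + k) * (c-a-b+k) * ih + poch (c - a) k * poch (c - b) k * this

lemma hypS_tendsto (a b : ℂ) {c : ℝ} (hc : 0 < c) (h : 0 < ((c:ℂ) - a - b).re) :
    Tendsto (fun m : ℕ => hypS a b (c + m)) atTop (𝓝 1) := by
  have hc' : 0 < (c:ℂ).re := by simpa
  have e : (1:ℂ) = ∑' n : ℕ, if n = 0 then (1:ℂ) else 0 := by simp
  rw [e]
  unfold hypS
  have key : ∀ m n : ℕ, ‖hyp a b (c + (m:ℂ)) n‖ ≤ ‖hyp a b c n‖ := by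
    intro m n
    induction m with
    | zero => simp
    | succ k ih =>
      refine le_trans ?_ ih
      have hk : (0:ℝ) ≤ k := by positivity
      have hcc : 0 < ((c:ℂ) + k).re := by simp; linarith
      have e1 := congrArg norm (hyp_c_succ a b hcc n)
      rw [norm_mul, norm_mul] at e1
      have n1 : ‖(c:ℂ) + k + n‖ = c + k + n := by
        have : (c:ℂ) + k + n = ((c + k + n : ℝ) : ℂ) := by push_cast; ring
        rw [this, Complex.norm_real, Real.norm_of_nonneg (by positivity)]
      have n2 : ‖(c:ℂ) + k‖ = c + k := by
        have : (c:ℂ) + k = ((c + k : ℝ) : ℂ) := by push_cast; ring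
        rw [this, Complex.norm_real, Real.norm_of_nonneg (by positivity)]
      rw [n1, n2] at e1
      have hp : 0 < c + k := by positivity
      push_cast
      rw [← add_assoc]
      have : (c + k) * ‖hyp a b (c + k + 1) n‖ ≤ (c + k) * ‖hyp a b (c + k) n‖ := by
        rw [← e1]
        refine mul_le_mul_of_nonneg_right ?_ (norm_nonneg _)
        have : (0:ℝ) ≤ n := by positivity
        linarith
      exact le_of_mul_le_mul_left this hp
  refine tendsto_tsum_of_dominated_convergence (hyp_summable a b hc' h) ?_ (Eventually.of_forall key)
  intro n
  rcases n with _ | n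
  · simp [hyp_zero]
  · simp only [Nat.succ_ne_zero, if_false]
    have hb : ∀ m : ℕ, 1 ≤ m → ‖hyp a b (c + (m:ℂ)) (n+1)‖ ≤ ‖(a+n) * (b+n)‖ * ‖hyp a b c n‖ * (m:ℝ)⁻¹ := by
      intro m hm
      have hm0 : (0:ℝ) < m := by exact_mod_cast hm
      have hcc : 0 < ((c:ℂ) + m).re := by simp; linarith
      have e1 := congrArg norm (hyp_succ a b hcc n)
      rw [norm_mul, norm_mul (((a:ℂ) + n) * _)] at e1
      have n1 : ‖((n:ℂ) + 1) * ((c:ℂ) + m + n)‖ = (n+1) * (c + m + n) := by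
        have : ((n:ℂ) + 1) * ((c:ℂ) + m + n) = (((n+1) * (c + m + n) : ℝ) : ℂ) := by push_cast; ring
        rw [this, Complex.norm_real, Real.norm_of_nonneg (by positivity)]
      rw [n1] at e1
      rw [← div_eq_mul_inv, le_div_iff₀ hm0, mul_comm]
      calc (m:ℝ) * ‖hyp a b (c + (m:ℂ)) (n+1)‖ ≤ (n+1) * (c+m+n) * ‖hyp a b (c + (m:ℂ)) (n+1)‖ := by
            gcongr
            have : (0:ℝ) ≤ n := by positivity
            nlinarith
        _ = _ := e1
        _ ≤ _ := by
            gcongr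
            exact key m n
    have ht : Tendsto (fun m : ℕ => ‖(a+n) * (b+n)‖ * ‖hyp a b c n‖ * (m:ℝ)⁻¹) atTop (𝓝 0) := by
      simpa using (tendsto_inv_atTop_zero.comp tendsto_natCast_atTop_atTop).const_mul (‖(a+n) * (b+n)‖ * ‖hyp a b c n‖)
    refine squeeze_zero_norm' ?_ ht
    filter_upwards [eventually_ge_atTop 1] with m hm using hb m hm

lemma gauss_sum (a b : ℂ) {c : ℝ} (hc : 0 < c) (h : 0 < ((c:ℂ) - a - b).re)
    (ha : 0 < ((c:ℂ) - a).re) (hb : 0 < ((c:ℂ) - b).re) :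
    hypS a b c = Complex.Gamma c * Complex.Gamma (c - a - b) /
      (Complex.Gamma (c - a) * Complex.Gamma (c - b)) := by
  have hc' : 0 < (c:ℂ).re := by simpa
  have T1 := (((Complex.GammaSeq_tendsto_Gamma c).mul
    (Complex.GammaSeq_tendsto_Gamma (c - a - b))).div
    ((Complex.GammaSeq_tendsto_Gamma (c - a)).mul (Complex.GammaSeq_tendsto_Gamma (c - b)))
    (mul_ne_zero (Complex.Gamma_ne_zero_of_re_pos ha) (Complex.Gamma_ne_zero_of_re_pos hb))).mul
    ((tendsto_add_atTop_iff_nat 1).2 (hypS_tendsto a b hc h))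
  rw [mul_one] at T1
  refine tendsto_nhds_unique (tendsto_const_nhds.congr' ?_) T1
  filter_upwards [eventually_ge_atTop 1] with m hm
  have hm0 : (m:ℂ) ≠ 0 := by exact_mod_cast (by omega : m ≠ 0)
  have e := hypS_iter a b hc' h (m+1)
  have h1 := poch_ne_zero hc' (m+1)
  have h2 := poch_ne_zero h (m+1)
  have h3 := poch_ne_zero ha (m+1)
  have h4 := poch_ne_zero hb (m+1)
  have h5 : (m.factorial : ℂ) ≠ 0 := by exact_mod_cast m.factorial_ne_zero
  have hp : ∀ z : ℂ, (m:ℂ)^z ≠ 0 := fun z => by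
    rw [Complex.cpow_ne_zero_iff]; left; exact hm0
  have e2 : (m:ℂ)^(c:ℂ) * (m:ℂ)^((c:ℂ)-a-b) = (m:ℂ)^((c:ℂ)-a) * (m:ℂ)^((c:ℂ)-b) := by
    rw [← Complex.cpow_add _ _ hm0, ← Complex.cpow_add _ _ hm0]; congr 1; ring
  have e3 : hypS a b c = poch (c - a) (m+1) * poch (c - b) (m+1) * hypS a b (c + (m+1 : ℕ)) /
      (poch c (m+1) * poch (c - a - b) (m+1)) := by
    rw [eq_div_iff (mul_ne_zero h1 h2), ← e]; ring
  simp only [Pi.div_apply, Complex.GammaSeq]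
  rw [← poch, ← poch, ← poch, ← poch]
  rw [e3]
  have := hp c
  have := hp (c-a-b)
  have := hp (c-a)
  have := hp (c-b)
  field_simp
  linear_combination (-(hypS a b (c + (m+1 : ℕ)))) * e2

/-- polynomially bounded sequence -/
def PB (u : ℕ → ℂ) : Prop := ∃ (C : ℝ) (k : ℕ), ∀ n : ℕ, ‖u n‖ ≤ C * ((n:ℝ) + 1) ^ k

/-- derivative sequence -/
def du (u : ℕ → ℂ) (n : ℕ) : ℂ := ((n:ℂ) + 1) * u (n+1)

/-- power series sum -/
def psum (u : ℕ → ℂ) (x : ℂ) : ℂ := ∑' n, u n * x ^ n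

lemma PB.du {u : ℕ → ℂ} (h : PB u) : PB (du u) := by
  obtain ⟨C, k, h⟩ := h
  have hC : 0 ≤ C := by
    have := (norm_nonneg _).trans (h 0)
    simpa using this
  refine ⟨C * 2 ^ k, k + 1, fun n => ?_⟩
  have h1 := h (n+1)
  have h0 : ‖(n:ℂ) + 1‖ = (n:ℝ) + 1 := by
    have : (n:ℂ) + 1 = ((n + 1 : ℕ) : ℂ) := by push_cast; rfl
    rw [this, Complex.norm_natCast]; push_cast; rfl
  rw [_root_.du, norm_mul, h0]
  push_cast at h1
  calc ((n:ℝ)+1) * ‖u (n+1)‖ ≤ (n+1) * (C * ((n:ℝ) + 1 + 1)^k) := by gcongr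
    _ ≤ (n+1) * (C * (2 * ((n:ℝ) + 1))^k) := by
      gcongr
      have : (0:ℝ) ≤ n := by positivity
      linarith
    _ = _ := by rw [mul_pow]; ring

lemma summable_aux (C : ℝ) (k : ℕ) {r : ℝ} (hr0 : 0 < r) (hr : r < 1) :
    Summable (fun n : ℕ => C * ((n:ℝ)+1)^k * r^n) := by
  have h := summable_pow_mul_geometric_of_norm_lt_one k (r := r) (by rwa [Real.norm_of_nonneg hr0.le])
  rw [← summable_nat_add_iff 1] at h
  refine (h.mul_left (C / r)).congr fun n => ?_
  push_cast
  rw [pow_succ]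
  field_simp

lemma PB.summable {u : ℕ → ℂ} (h : PB u) {x : ℂ} (hx : ‖x‖ < 1) :
    Summable (fun n => u n * x ^ n) := by
  obtain ⟨r, hr1, hr2⟩ := exists_between hx
  obtain ⟨C, k, h⟩ := h
  refine Summable.of_norm_bounded (summable_aux C k ((norm_nonneg _).trans_lt hr1) hr2) fun n => ?_
  rw [norm_mul, norm_pow]
  have h0 := (norm_nonneg _).trans (h n)
  exact mul_le_mul (h n) (by gcongr) (by positivity) h0

lemma PB.hasSum {u : ℕ → ℂ} (h : PB u) {x : ℂ} (hx : ‖x‖ < 1) :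
    HasSum (fun n => u n * x ^ n) (psum u x) := (h.summable hx).hasSum

lemma PB.hasDerivAt {u : ℕ → ℂ} (h : PB u) {x : ℂ} (hx : ‖x‖ < 1) :
    HasDerivAt (psum u) (psum (_root_.du u) x) x := by
  obtain ⟨r, hr1, hr2⟩ := exists_between hx
  have hr0 : 0 < r := (norm_nonneg _).trans_lt hr1
  obtain ⟨C, k, hd⟩ := h.du
  have hs : Summable (fun n : ℕ => ‖u n * n‖ * r ^ (n-1)) := by
    rw [← summable_nat_add_iff 1]
    refine Summable.of_nonneg_of_le (fun n => by positivity) (fun n => ?_) (summable_aux C k hr0 hr2)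
    have := hd n
    simp only [_root_.du] at this
    simp only [Nat.add_sub_cancel]
    gcongr
    push_cast
    rwa [mul_comm]
  have key := hasDerivAt_tsum_of_isPreconnected (𝕜 := ℂ) (F := ℂ) (t := Metric.ball (0:ℂ) r) (g := fun n z => u n * z ^ n)
    (g' := fun n z => u n * (n * z ^ (n-1))) (y := x) (y₀ := 0) hs Metric.isOpen_ball
    (convex_ball _ _).isPreconnected
    (fun n y _ => (hasDerivAt_pow n y).const_mul (u n))
    (fun n y hy => by
      rw [← mul_assoc, norm_mul, norm_pow]
      have : ‖y‖ < r := by simpa using hy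
      gcongr)
    (by simpa using hr0) (h.summable (by simp)) (by simpa using hr1)
  have e : psum (_root_.du u) x = ∑' n, u n * (n * x ^ (n-1)) := by
    have hsum : Summable (fun n : ℕ => u n * (n * x ^ (n-1))) := by
      refine Summable.of_norm_bounded hs fun n => ?_
      rw [← mul_assoc, norm_mul, norm_pow]
      gcongr
    rw [hsum.tsum_eq_zero_add]
    simp only [psum, _root_.du]
    simp
    congr 1; ext n; ring
  rw [e]
  exact key

lemma hasSum_shift {f : ℕ → ℂ} {s : ℂ} (h : HasSum (fun n => f (n+1)) s) (h0 : f 0 = 0) :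
    HasSum f s := by
  have := (hasSum_nat_add_iff (f := f) 1).1 h
  simpa [h0] using this

lemma hyp_ode_aux {u : ℕ → ℂ} (hu : PB u) {a b c : ℂ}
    (hrec : ∀ n : ℕ, ((n:ℂ) + 1) * (c + n) * u (n+1) = (a + n) * (b + n) * u n)
    {x : ℂ} (hx : ‖x‖ < 1) :
    x * (1 - x) * psum (du (du u)) x + (c - (a + b + 1) * x) * psum (du u) x
      - a * b * psum u x = 0 := by
  have s0 := hu.hasSum hx
  have s1 := hu.du.hasSum hx
  have s2 := hu.du.du.hasSum hx
  have s1x : HasSum (fun n : ℕ => n * u n * x ^ n) (x * psum (du u) x) := by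
    refine hasSum_shift ?_ (by simp)
    refine (s1.mul_left x).congr_fun ?_
    intro n; simp only [du]; push_cast; ring
  have s2x : HasSum (fun n : ℕ => n * ((n:ℂ)+1) * u (n+1) * x ^ n) (x * psum (du (du u)) x) := by
    refine hasSum_shift ?_ (by simp)
    refine (s2.mul_left x).congr_fun ?_
    intro n; simp only [du]; push_cast; ring
  have s2xx : HasSum (fun n : ℕ => n * ((n:ℂ)-1) * u n * x ^ n) (x * (x * psum (du (du u)) x)) := by
    refine hasSum_shift ?_ (by simp)
    refine (s2x.mul_left x).congr_fun ?_
    intro n; push_cast; ring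
  have := ((((s2x.sub s2xx).add (s1.mul_left c)).sub (s1x.mul_left (a+b+1))).sub (s0.mul_left (a*b)))
  have h0 : HasSum (fun _ : ℕ => (0:ℂ)) (x * psum (du (du u)) x - x * (x * psum (du (du u)) x) + c * psum (du u) x
      - (a+b+1) * (x * psum (du u) x) - a * b * psum u x) := by
    refine this.congr_fun ?_
    intro n
    simp only [du]
    linear_combination (-x^n) * hrec n
  have h1 := h0.unique hasSum_zero
  linear_combination h1

lemma tanh_deriv (t : ℝ) : HasDerivAt (fun t : ℝ => ((Real.tanh t : ℝ) : ℂ)) (1 - ((Real.tanh t : ℝ):ℂ)^2) t := by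
  have h : HasDerivAt Real.tanh (1 - Real.tanh t ^2) t := by
    have h1 := (Real.hasDerivAt_sinh t).div (Real.hasDerivAt_cosh t) (Real.cosh_pos t).ne'
    have e : Real.tanh = Real.sinh / Real.cosh := by
      ext y; simp [Real.tanh_eq_sinh_div_cosh]
    rw [e]
    refine HasDerivAt.congr_deriv h1 ?_
    have := (Real.cosh_pos t).ne'
    simp
    field_simp
  have := h.ofReal_comp
  refine HasDerivAt.congr_deriv this ?_
  push_cast; ring

lemma coshpow_deriv (s : ℂ) (t : ℝ) :
    HasDerivAt (fun t : ℝ => Complex.exp (s * (Real.log (Real.cosh t) : ℝ)))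
      (s * ((Real.tanh t : ℝ):ℂ) * Complex.exp (s * (Real.log (Real.cosh t) : ℝ))) t := by
  have h1 := ((Real.hasDerivAt_cosh t).log (Real.cosh_pos t).ne').ofReal_comp
  have h2 := (h1.const_mul s).cexp
  refine HasDerivAt.congr_deriv h2 ?_
  rw [Real.tanh_eq_sinh_div_cosh]
  push_cast; ring

section
variable (u : ℕ → ℂ) (s : ℂ)

/-- candidate solution -/
def q0 (t : ℝ) : ℂ := Complex.exp (s * (Real.log (Real.cosh t) : ℝ)) *
  psum u (((Real.tanh t : ℝ):ℂ)^2)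

/-- its derivative -/
def q1 (t : ℝ) : ℂ := Complex.exp (s * (Real.log (Real.cosh t) : ℝ)) *
  (s * ((Real.tanh t : ℝ):ℂ) * psum u (((Real.tanh t : ℝ):ℂ)^2) +
   2 * ((Real.tanh t : ℝ):ℂ) * (1 - ((Real.tanh t : ℝ):ℂ)^2) * psum (du u) (((Real.tanh t : ℝ):ℂ)^2))

/-- its second derivative -/
def q2 (t : ℝ) : ℂ :=
  let T : ℂ := ((Real.tanh t : ℝ):ℂ)
  Complex.exp (s * (Real.log (Real.cosh t) : ℝ)) *
  (s * T * (s * T * psum u (T^2) + 2 * T * (1 - T^2) * psum (du u) (T^2))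
    + s * (1 - T^2) * psum u (T^2) + s * T * (2 * T * (1 - T^2)) * psum (du u) (T^2)
    + 2 * (1 - 3 * T^2) * (1 - T^2) * psum (du u) (T^2)
    + 4 * T^2 * (1 - T^2)^2 * psum (du (du u)) (T^2))
end

lemma norm_T (t : ℝ) : ‖((Real.tanh t : ℝ):ℂ)^2‖ < 1 := by
  rw [norm_pow, Complex.norm_real, Real.norm_eq_abs, sq_abs]
  exact Real.tanh_sq_lt_one t

lemma psumT_deriv {u : ℕ → ℂ} (hu : PB u) (t : ℝ) :
    HasDerivAt (fun t : ℝ => psum u (((Real.tanh t : ℝ):ℂ)^2))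
      (psum (du u) (((Real.tanh t : ℝ):ℂ)^2) * (2 * ((Real.tanh t : ℝ):ℂ) * (1 - ((Real.tanh t : ℝ):ℂ)^2))) t := by
  have h1 := (tanh_deriv t).pow 2
  have h2 := (hu.hasDerivAt (norm_T t)).comp t h1
  refine HasDerivAt.congr_deriv h2 ?_
  simp

lemma q0_deriv {u : ℕ → ℂ} (hu : PB u) (s : ℂ) (t : ℝ) : HasDerivAt (q0 u s) (q1 u s t) t := by
  have := (coshpow_deriv s t).mul (psumT_deriv hu t)
  refine HasDerivAt.congr_deriv this ?_
  simp only [q1]; ring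

lemma q1_deriv {u : ℕ → ℂ} (hu : PB u) (s : ℂ) (t : ℝ) : HasDerivAt (q1 u s) (q2 u s t) t := by
  have hT := tanh_deriv t
  have := (coshpow_deriv s t).mul ((((hT.const_mul s).mul (psumT_deriv hu t))).add
    (((hT.const_mul 2).mul ((hT.pow 2).const_sub 1)).mul (psumT_deriv hu.du t)))
  refine HasDerivAt.congr_deriv this ?_
  simp only [q2, Pi.mul_apply, Pi.add_apply, Pi.pow_apply]; push_cast; ring

/-- Uniqueness. -/
lemma zero_of_data {p : ℝ → ℝ} {κ : ℂ} {t0 t1 : ℝ} (ht : t0 ≤ t1) {f f1 : ℝ → ℂ}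
    (hp : ContinuousOn p (Icc t0 t1))
    (h0 : ∀ t ∈ Icc t0 t1, HasDerivAt f (f1 t) t)
    (h1 : ∀ t ∈ Icc t0 t1, HasDerivAt f1 (-(p t : ℂ) * f1 t - κ * f t) t)
    (hf : f t0 = 0) (hf1 : f1 t0 = 0) : f t1 = 0 := by
  obtain ⟨M, hM⟩ := isCompact_Icc.exists_bound_of_continuousOn hp
  have hM0 : 0 ≤ M := (norm_nonneg _).trans (hM t0 ⟨le_rfl, ht⟩)
  have := eq_zero_of_abs_deriv_le_mul_abs_self_of_eq_zero_right (E := ℂ × ℂ)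
    (f := fun t => (f t, f1 t)) (f' := fun t => (f1 t, -(p t : ℂ) * f1 t - κ * f t))
    (K := 1 + M + ‖κ‖) (a := t0) (b := t1)
    (fun t ht => ((h0 t ht).prodMk (h1 t ht)).continuousAt.continuousWithinAt)
    (fun t ht => ((h0 t ⟨ht.1, ht.2.le⟩).prodMk (h1 t ⟨ht.1, ht.2.le⟩)).hasDerivWithinAt)
    (by simp [hf, hf1]) (fun t ht => ?_) t1 ⟨ht, le_rfl⟩
  · exact congrArg Prod.fst this
  · have hp1 := hM t ⟨ht.1, ht.2.le⟩
    set N := ‖(f t, f1 t)‖ with hN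
    have n1 : ‖f t‖ ≤ N := norm_fst_le (f t, f1 t)
    have n2 : ‖f1 t‖ ≤ N := norm_snd_le (f t, f1 t)
    have hN0 : 0 ≤ N := norm_nonneg _
    have hk := norm_nonneg κ
    rw [Prod.norm_def]
    refine max_le ?_ ?_
    · refine n2.trans ?_
      nlinarith [mul_nonneg hM0 hN0, mul_nonneg hk hN0]
    · have e1 : ‖-(p t : ℂ) * f1 t‖ ≤ M * N := by
        rw [norm_mul, norm_neg, Complex.norm_real]
        exact mul_le_mul hp1 n2 (norm_nonneg _) hM0
      have e2 : ‖κ * f t‖ ≤ ‖κ‖ * N := by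
        rw [norm_mul]; gcongr
      refine (norm_sub_le _ _).trans ?_
      nlinarith

lemma ode_unique {A p : ℝ → ℝ} {κ : ℂ} {φ φ1 q q1 : ℝ → ℂ}
    (hA0 : ∀ t > 0, 0 < A t) (hA : ∀ t > 0, HasDerivAt A (p t * A t) t)
    (hAO : A =O[𝓝[>] 0] (fun t => t)) (hp : ContinuousOn p (Ioi 0))
    (hφ : ∀ t > 0, HasDerivAt φ (φ1 t) t)
    (hφ1 : ∀ t > 0, HasDerivAt φ1 (-(p t : ℂ) * φ1 t - κ * φ t) t)
    (hq : ∀ t > 0, HasDerivAt q (q1 t) t)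
    (hq1 : ∀ t > 0, HasDerivAt q1 (-(p t : ℂ) * q1 t - κ * q t) t)
    (lφ : Tendsto φ (𝓝[>] 0) (𝓝 1)) (lq : Tendsto q (𝓝[>] 0) (𝓝 1)) :
    ∀ t > 0, φ t = q t := by
  obtain ⟨K, hK⟩ : ∃ K : ℂ, ∀ t > 0, (A t : ℂ) * (φ t * q1 t - φ1 t * q t) = K := by
    refine ⟨_, fun t ht => (convex_Ioi (0:ℝ)).is_const_of_fderivWithin_eq_zero (𝕜 := ℝ)
      (f := fun t => (A t : ℂ) * (φ t * q1 t - φ1 t * q t)) (y := 1) ?_ ?_ ht (by simp)⟩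
    all_goals
      have key : ∀ t > 0, HasDerivAt (fun t => (A t : ℂ) * (φ t * q1 t - φ1 t * q t)) 0 t := by
        intro t ht
        have := (hA t ht).ofReal_comp.mul (((hφ t ht).mul (hq1 t ht)).sub ((hφ1 t ht).mul (hq t ht)))
        refine HasDerivAt.congr_deriv this ?_
        simp only [Pi.mul_apply, Pi.sub_apply]
        push_cast; ring
    · exact fun t ht => (key t ht).differentiableAt.differentiableWithinAt
    · intro t ht
      have h := (key t ht).hasDerivWithinAt (s := Ioi 0)
      have h2 := h.hasFDerivWithinAt.fderivWithin (isOpen_Ioi.uniqueDiffWithinAt ht)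
      rw [h2]; ext; simp
  have hre : ∀ᶠ t in 𝓝[>] (0:ℝ), (1:ℝ)/2 < ((q t ^ 2)⁻¹).re ∧ q t ≠ 0 := by
    have l2 : Tendsto (fun t => ((q t ^ 2)⁻¹).re) (𝓝[>] 0) (𝓝 1) := by
      have h1 := ((lq.pow 2).inv₀ (by simp))
      have h2 := (Complex.continuous_re.tendsto _).comp h1
      rw [show ((1:ℂ)^2)⁻¹.re = 1 by simp] at h2
      exact h2
    exact (l2.eventually (lt_mem_nhds (by norm_num))).and (lq.eventually_ne one_ne_zero)
  obtain ⟨C, hC0, hC⟩ := hAO.exists_pos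
  rw [Asymptotics.isBigOWith_iff] at hC
  obtain ⟨ε, hε, hall⟩ := mem_nhdsGT_iff_exists_Ioo_subset.1 (hre.and hC)
  have hε : 0 < ε := hε
  have hder : ∀ t ∈ Ioo 0 ε, HasDerivAt (fun t => φ t / q t) (-K * ((A t : ℂ) * q t ^ 2)⁻¹) t := by
    intro t ht
    have hq0 := (hall ht).1.2
    have := (hφ t ht.1).div (hq t ht.1) hq0
    refine HasDerivAt.congr_deriv this ?_
    rw [← hK t ht.1]
    have : (A t : ℂ) ≠ 0 := by exact_mod_cast (hA0 t ht.1).ne'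
    field_simp
    ring
  have lh : Tendsto (fun t => φ t / q t) (𝓝[>] 0) (𝓝 1) := by
    have h1 := lφ.div lq one_ne_zero
    rw [div_one] at h1
    exact h1
  have hK0 : K = 0 := by
    by_contra hne
    set R : ℝ → ℝ := fun t => (-(φ t / q t) / K).re with hR
    have hRd : ∀ t ∈ Ioo 0 ε, HasDerivAt (fun t => R t - 1/(2*C) * Real.log t)
        (((A t : ℂ) * q t ^ 2)⁻¹.re - 1/(2*C) * t⁻¹) t := by
      intro t ht
      have h1 := ((hder t ht).neg.div_const K)
      have h2 := (Complex.reCLM.hasFDerivAt.comp_hasDerivAt t h1)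
      have h3 := h2.sub ((Real.hasDerivAt_log ht.1.ne').const_mul (1/(2*C)))
      refine HasDerivAt.congr_deriv h3 ?_
      congr 1
      rw [Complex.reCLM_apply]
      congr 1
      field_simp
    have hmono : MonotoneOn (fun t => R t - 1/(2*C) * Real.log t) (Ioo 0 ε) := by
      refine monotoneOn_of_deriv_nonneg (convex_Ioo _ _)
        (fun t ht => (hRd t ht).continuousAt.continuousWithinAt) ?_ ?_
      · rw [interior_Ioo]
        exact fun t ht => (hRd t ht).differentiableAt.differentiableWithinAt
      · rw [interior_Ioo]
        intro t ht
        rw [(hRd t ht).deriv]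
        have ht0 : 0 < t := ht.1
        have hAt := hA0 t ht0
        have b1 := (hall ht).1.1
        have b2 : A t ≤ C * t := by
          have := (hall ht).2
          simpa [abs_of_pos hAt, abs_of_pos ht0] using this
        have e : (((A t : ℂ) * q t ^ 2)⁻¹).re = (A t)⁻¹ * ((q t ^ 2)⁻¹).re := by
          rw [mul_inv, ← Complex.ofReal_inv, Complex.re_ofReal_mul]
        rw [e]
        have b3 : (C * t)⁻¹ ≤ (A t)⁻¹ := inv_anti₀ hAt b2
        have b4 : (C * t)⁻¹ * (1/2) ≤ (A t)⁻¹ * ((q t ^ 2)⁻¹).re :=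
          mul_le_mul b3 b1.le (by norm_num) (by positivity)
        have : (C * t)⁻¹ * (1/2) = 1/(2*C) * t⁻¹ := by field_simp
        linarith
    have hm : ε/2 ∈ Ioo 0 ε := ⟨by linarith, by linarith⟩
    have hlim : Tendsto R (𝓝[>] 0) atBot := by
      have hl : Tendsto (fun t => 1/(2*C) * Real.log t + (R (ε/2) - 1/(2*C) * Real.log (ε/2)))
          (𝓝[>] 0) atBot :=
        tendsto_atBot_add_const_right _ _
          (Real.tendsto_log_nhdsGT_zero.const_mul_atBot (by positivity))
      refine tendsto_atBot_mono' _ ?_ hl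
      filter_upwards [Ioo_mem_nhdsGT hm.1] with t ht
      have := hmono ⟨ht.1, ht.2.trans hm.2⟩ hm ht.2.le
      simp only at this
      linarith
    have hlim2 : Tendsto R (𝓝[>] 0) (𝓝 ((-1 / K).re)) :=
      (Complex.continuous_re.tendsto _).comp (lh.neg.div_const K)
    exact not_tendsto_nhds_of_tendsto_atBot hlim _ hlim2
  have heq : ∀ t ∈ Ioo 0 ε, φ t = q t := by
    intro t ht
    have hc : ∀ y ∈ Ioo 0 ε, φ y / q y = φ t / q t := by
      intro y hy
      refine (convex_Ioo (0:ℝ) ε).is_const_of_fderivWithin_eq_zero (𝕜 := ℝ)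
        (f := fun t => φ t / q t) ?_ ?_ hy ht
      · exact fun t ht => (hder t ht).differentiableAt.differentiableWithinAt
      · intro t ht
        have h := (hder t ht).hasDerivWithinAt (s := Ioo 0 ε)
        have h2 := h.hasFDerivWithinAt.fderivWithin (isOpen_Ioo.uniqueDiffWithinAt ht)
        rw [h2, hK0]; ext; simp
    have l3 : Tendsto (fun t => φ t / q t) (𝓝[>] 0) (𝓝 (φ t / q t)) := by
      refine tendsto_const_nhds.congr' ?_
      filter_upwards [Ioo_mem_nhdsGT hε] with y hy using (hc y hy).symm
    have := tendsto_nhds_unique l3 lh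
    rwa [div_eq_one_iff_eq (hall ht).1.2] at this
  intro t ht
  by_cases h : t < ε
  · exact heq t ⟨ht, h⟩
  · have hm : ε/2 ∈ Ioo 0 ε := ⟨by linarith, by linarith⟩
    have e0 := heq _ hm
    have e1 : φ1 (ε/2) = q1 (ε/2) := by
      have h1 := hK _ hm.1
      rw [hK0, e0] at h1
      have hA1 : (A (ε/2) : ℂ) ≠ 0 := by exact_mod_cast (hA0 _ hm.1).ne'
      have hq0 := (hall hm).1.2
      have h2 := (mul_eq_zero.1 h1).resolve_left hA1
      have h3 : q (ε/2) * (q1 (ε/2) - φ1 (ε/2)) = 0 := by linear_combination h2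
      exact (sub_eq_zero.1 ((mul_eq_zero.1 h3).resolve_left hq0)).symm
    have hpos : ∀ y ∈ Icc (ε/2) t, 0 < y := fun y hy => hm.1.trans_le hy.1
    have := zero_of_data (p := p) (κ := κ) (t0 := ε/2) (t1 := t) (f := fun t => φ t - q t)
      (f1 := fun t => φ1 t - q1 t) (by linarith) (hp.mono fun y hy => hpos y hy)
      (fun y hy => (hφ y (hpos y hy)).sub (hq y (hpos y hy)))
      (fun y hy => by
        refine HasDerivAt.congr_deriv ((hφ1 y (hpos y hy)).sub (hq1 y (hpos y hy))) ?_
        ring)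
      (by simp [e0]) (by simp [e1])
    exact sub_eq_zero.1 this

lemma radial_q_ode {m₁ m₂ : ℕ} {lam a b c s : ℂ} {u : ℕ → ℂ} (hu : PB u)
    (ha : a = (m₁/2 + m₂ - lam)/2) (hc : c = (m₁ + m₂ + 1)/2) (hb : b = c - (m₁/2 + m₂ + lam)/2)
    (hs : s = lam - (m₁/2 + m₂))
    (hrec : ∀ n : ℕ, ((n:ℂ) + 1) * (c + n) * u (n+1) = (a + n) * (b + n) * u n)
    {t : ℝ} (ht : 0 < t) :
    q2 u s t = -((m₁ * cothR t + 2 * m₂ * cothR (2 * t) : ℝ) : ℂ) * q1 u s t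
      - ((rho m₁ m₂ : ℂ) ^ 2 - lam ^ 2) * q0 u s t := by
  have hode := hyp_ode_aux hu hrec (norm_T t)
  have hsh : 0 < Real.sinh t := Real.sinh_pos_iff.2 ht
  have hch := Real.cosh_pos t
  have hTpos : 0 < Real.tanh t := by
    rw [Real.tanh_eq_sinh_div_cosh]; positivity
  have hp : (m₁ * cothR t + 2 * m₂ * cothR (2 * t) : ℝ) =
      (m₁ + m₂ * (1 + Real.tanh t ^ 2)) / Real.tanh t := by
    rw [cothR, cothR, Real.sinh_two_mul, Real.cosh_two_mul, Real.tanh_eq_sinh_div_cosh]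
    field_simp
  rw [hp]
  have hT0 : ((Real.tanh t : ℝ):ℂ) ≠ 0 := by exact_mod_cast hTpos.ne'
  simp only [q0, q1, q2, rho]
  push_cast [-Complex.ofReal_tanh]
  generalize ((Real.tanh t : ℝ):ℂ) = T at *
  generalize Complex.exp (s * (Real.log (Real.cosh t) : ℝ)) = E
  generalize psum (du (du u)) (T^2) = F2 at *
  generalize psum (du u) (T^2) = F1 at *
  generalize psum u (T^2) = F0 at *
  subst hs hb ha hc
  field_simp
  linear_combination (E * 4 * (1 - T^2) * 4) * hode

lemma A_props (m₁ m₂ : ℕ) {t : ℝ} (ht : 0 < t) :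
    0 < Real.sinh t ^ m₁ * Real.sinh (2*t) ^ m₂ ∧
    HasDerivAt (fun t => Real.sinh t ^ m₁ * Real.sinh (2*t) ^ m₂)
      ((m₁ * cothR t + 2 * m₂ * cothR (2 * t)) * (Real.sinh t ^ m₁ * Real.sinh (2*t) ^ m₂)) t := by
  have h1 : 0 < Real.sinh t := Real.sinh_pos_iff.2 ht
  have h2 : 0 < Real.sinh (2*t) := Real.sinh_pos_iff.2 (by linarith)
  refine ⟨by positivity, ?_⟩
  have pw : ∀ (n : ℕ) (x : ℝ), x ≠ 0 → (n:ℝ) * x^(n-1) = n * x^n / x := by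
    intro n x hx
    rcases n with _ | n
    · simp
    · simp [pow_succ]; field_simp
  have d2 : HasDerivAt (fun t => Real.sinh (2*t)) (Real.cosh (2*t) * 2) t := by
    have h0 : HasDerivAt (fun t : ℝ => 2*t) 2 t := by simpa using (hasDerivAt_id t).const_mul 2
    exact h0.sinh
  have := ((Real.hasDerivAt_sinh t).pow m₁).mul (d2.pow m₂)
  refine HasDerivAt.congr_deriv this ?_
  simp only [Pi.pow_apply]
  rw [pw _ _ h1.ne', pw _ _ h2.ne', cothR, cothR]
  field_simp

lemma A_bigO {m₁ m₂ : ℕ} (hm₁ : 1 ≤ m₁) :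
    (fun t => Real.sinh t ^ m₁ * Real.sinh (2*t) ^ m₂) =O[𝓝[>] 0] (fun t : ℝ => t) := by
  have hd : DifferentiableAt ℝ (fun t => Real.sinh t ^ m₁ * Real.sinh (2*t) ^ m₂) 0 := by
    fun_prop
  have h := hd.hasDerivAt.isBigO_sub
  have e : Real.sinh 0 ^ m₁ * Real.sinh (2*0) ^ m₂ = 0 := by
    rw [Real.sinh_zero, zero_pow (by omega), zero_mul]
  simp only [e, sub_zero] at h
  exact h.mono nhdsWithin_le_nhds

lemma exp_neg_lim : Tendsto (fun t : ℝ => Real.exp (-(2*t))) atTop (𝓝 0) :=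
  Real.tendsto_exp_neg_atTop_nhds_zero.comp (tendsto_id.const_mul_atTop two_pos)

lemma cosh_lim : Tendsto (fun t : ℝ => t - Real.log (Real.cosh t)) atTop (𝓝 (Real.log 2)) := by
  have h1 : Tendsto (fun t : ℝ => Real.log 2 - Real.log (1 + Real.exp (-(2*t)))) atTop
      (𝓝 (Real.log 2 - Real.log (1 + 0))) :=
    tendsto_const_nhds.sub ((tendsto_const_nhds.add exp_neg_lim).log (by norm_num))
  simp only [add_zero, Real.log_one, sub_zero] at h1
  refine h1.congr fun t => ?_
  have e : Real.cosh t = Real.exp t * (1 + Real.exp (-(2*t))) / 2 := by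
    rw [Real.cosh_eq, mul_add, ← Real.exp_add]; ring_nf
  rw [e, Real.log_div (by positivity) (by norm_num), Real.log_mul (by positivity) (by positivity),
    Real.log_exp]
  ring

lemma tanh_lim : Tendsto Real.tanh atTop (𝓝 1) := by
  have h1 : Tendsto (fun t : ℝ => (1 - Real.exp (-(2*t))) / (1 + Real.exp (-(2*t)))) atTop
      (𝓝 ((1 - 0)/(1 + 0))) :=
    (tendsto_const_nhds.sub exp_neg_lim).div (tendsto_const_nhds.add exp_neg_lim) (by norm_num)
  norm_num at h1
  refine h1.congr fun t => ?_
  have e : Real.exp (-(2*t)) = Real.exp (-t) / Real.exp t := by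
    rw [← Real.exp_sub]; ring_nf
  rw [Real.tanh_eq, e]
  field_simp

lemma psum_lim {u : ℕ → ℂ} (hu : Summable (fun n => ‖u n‖)) :
    Tendsto (fun t : ℝ => psum u (((Real.tanh t : ℝ):ℂ)^2)) atTop (𝓝 (∑' n, u n)) := by
  unfold psum
  refine tendsto_tsum_of_dominated_convergence hu ?_ (Eventually.of_forall ?_)
  · intro n
    have h1 : Tendsto (fun t : ℝ => ((Real.tanh t : ℝ):ℂ)) atTop (𝓝 ((1:ℝ):ℂ)) :=
      (Complex.continuous_ofReal.tendsto _).comp tanh_lim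
    have h2 := ((h1.pow 2).pow n).const_mul (u n)
    simpa using h2
  · intro t n
    rw [norm_mul, norm_pow]
    exact mul_le_of_le_one_right (norm_nonneg _) (pow_le_one₀ (norm_nonneg _) (norm_T t).le)

lemma cfun_eq {m₁ m₂ : ℕ} (hm₁ : 1 ≤ m₁) (lam : ℂ) :
    cfun m₁ m₂ lam = Complex.exp ((rho m₁ m₂ - lam) * (Real.log 2 : ℝ)) *
      (Complex.Gamma (((m₁ + m₂ + 1)/2 : ℝ) : ℂ) * Complex.Gamma lam /
      (Complex.Gamma (((m₁ : ℂ) / 2 + 1 + lam) / 2) *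
      Complex.Gamma (((m₁ : ℂ) / 2 + (m₂ : ℂ) + lam) / 2))) := by
  have hm : (1:ℝ) ≤ m₁ := by exact_mod_cast hm₁
  have hm2 : (0:ℝ) ≤ m₂ := by positivity
  have hrho : 0 < rho m₁ m₂ := by unfold rho; positivity
  have g1 : Complex.Gamma (rho m₁ m₂ : ℂ) ≠ 0 := Complex.Gamma_ne_zero_of_re_pos (by simpa using hrho)
  have g2 : Complex.Gamma (((m₁ + m₂ + 1)/2 : ℝ) : ℂ) ≠ 0 :=
    Complex.Gamma_ne_zero_of_re_pos (by rw [Complex.ofReal_re]; positivity)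
  have e1 : ((m₁ : ℂ) / 2 + 1 + (rho m₁ m₂ : ℂ)) / 2 = (((m₁ + m₂ + 1)/2 : ℝ) : ℂ) := by
    simp only [rho]; push_cast; ring
  have e2 : ((m₁ : ℂ) / 2 + (m₂ : ℂ) + (rho m₁ m₂ : ℂ)) / 2 = (rho m₁ m₂ : ℂ) := by
    simp only [rho]; push_cast; ring
  have p : ∀ z : ℂ, (2:ℂ)^z = Complex.exp (z * (Real.log 2 : ℝ)) := by
    intro z
    rw [Complex.cpow_def_of_ne_zero (by norm_num), mul_comm, Complex.ofReal_log (by norm_num)]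
    norm_num
  rw [cfun, gfun, gfun, e1, e2, p, p]
  have hE : Complex.exp ((rho m₁ m₂ - lam) * (Real.log 2 : ℝ)) =
      Complex.exp (-lam * (Real.log 2 : ℝ)) / Complex.exp (-(rho m₁ m₂ : ℂ) * (Real.log 2 : ℝ)) := by
    rw [← Complex.exp_sub]; congr 1; ring
  rw [hE]
  have := Complex.exp_ne_zero (-(rho m₁ m₂ : ℂ) * (Real.log 2 : ℝ))
  field_simp

theorem spherical_function_fatou_limit (m₁ m₂ : ℕ) (hm₁ : 1 ≤ m₁) (lam : ℂ)
    (hre : 0 < lam.re) (hlam : ∀ n : ℤ, 2 * lam ≠ (n : ℂ))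
    (φ : ℝ → ℂ) (hφc : ContinuousOn φ (Set.Ici 0)) (hφ0 : φ 0 = 1)
    (hφd : ∀ t ∈ Set.Ioi (0 : ℝ), DifferentiableAt ℝ φ t ∧ DifferentiableAt ℝ (deriv φ) t)
    (hφODE : ∀ t ∈ Set.Ioi (0 : ℝ), RadialODEt m₁ m₂ lam φ t) :
    Filter.Tendsto (fun t : ℝ => Complex.exp (((rho m₁ m₂ : ℂ) - lam) * t) * φ t)
      Filter.atTop (nhds (cfun m₁ m₂ lam)) := by
  have hm : (1:ℝ) ≤ m₁ := by exact_mod_cast hm₁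
  have hm2 : (0:ℝ) ≤ m₂ := by positivity
  set c : ℝ := (m₁ + m₂ + 1)/2 with hc
  have hc0 : 0 < c := by positivity
  have hcc : (c:ℂ) = (m₁ + m₂ + 1)/2 := by rw [hc]; push_cast; ring
  set a : ℂ := (m₁/2 + m₂ - lam)/2 with ha
  set b : ℂ := c - (m₁/2 + m₂ + lam)/2 with hb
  set s : ℂ := lam - (m₁/2 + m₂) with hs
  have e1 : (c:ℂ) - a - b = lam := by rw [hb, ha]; ring
  have e2 : (c:ℂ) - a = ((m₁ : ℂ) / 2 + 1 + lam) / 2 := by rw [hcc, ha]; ring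
  have e3 : (c:ℂ) - b = ((m₁ : ℂ) / 2 + (m₂ : ℂ) + lam) / 2 := by rw [hb]; ring
  have hcre : 0 < (c:ℂ).re := by simpa using hc0
  have r1 : 0 < ((c:ℂ) - a - b).re := by rw [e1]; exact hre
  have r2 : 0 < ((c:ℂ) - a).re := by
    have : (c:ℂ) - a = (((m₁ / 2 + 1)/2 : ℝ) : ℂ) + ((1/2 : ℝ) : ℂ) * lam := by
      rw [e2]; push_cast; ring
    rw [this, Complex.add_re, Complex.re_ofReal_mul, Complex.ofReal_re]; positivity
  have r3 : 0 < ((c:ℂ) - b).re := by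
    have : (c:ℂ) - b = (((m₁ / 2 + m₂)/2 : ℝ) : ℂ) + ((1/2 : ℝ) : ℂ) * lam := by
      rw [e3]; push_cast; ring
    rw [this, Complex.add_re, Complex.re_ofReal_mul, Complex.ofReal_re]; positivity
  have hsum := hyp_summable a b hcre r1
  have hPB : PB (hyp a b c) := by
    refine ⟨∑' n, ‖hyp a b c n‖, 0, fun n => ?_⟩
    rw [pow_zero, mul_one]
    exact hsum.le_tsum n (fun _ _ => norm_nonneg _)
  have hgauss := gauss_sum a b hc0 r1 r2 r3
  rw [e1, e2, e3] at hgauss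
  have heq : ∀ t > 0, φ t = q0 (hyp a b c) s t := by
    refine ode_unique (A := fun t => Real.sinh t ^ m₁ * Real.sinh (2*t) ^ m₂)
      (p := fun t => m₁ * cothR t + 2 * m₂ * cothR (2 * t))
      (κ := (rho m₁ m₂ : ℂ) ^ 2 - lam ^ 2) (φ1 := deriv φ) (q1 := q1 (hyp a b c) s)
      (fun t ht => (A_props m₁ m₂ ht).1) (fun t ht => (A_props m₁ m₂ ht).2) (A_bigO hm₁) ?_
      (fun t ht => (hφd t ht).1.hasDerivAt) ?_ (fun t ht => q0_deriv hPB s t) ?_ ?_ ?_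
    · unfold cothR
      refine ContinuousOn.add (continuousOn_const.mul ?_) (continuousOn_const.mul ?_)
      · exact Real.continuous_cosh.continuousOn.div Real.continuous_sinh.continuousOn
          (fun t ht => (Real.sinh_pos_iff.2 ht).ne')
      · refine ContinuousOn.div (by fun_prop) (by fun_prop) (fun t ht => ?_)
        have ht : 0 < t := ht
        exact (Real.sinh_pos_iff.2 (by linarith)).ne'
    · intro t ht
      refine (hφd t ht).2.hasDerivAt.congr_deriv ?_
      have := hφODE t ht
      unfold RadialODEt at this
      linear_combination this
    · intro t ht
      refine (q1_deriv hPB s t).congr_deriv ?_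
      exact radial_q_ode hPB ha hcc hb hs (hyp_succ a b hcre) ht
    · have := (hφc 0 (by simp)).tendsto
      rw [hφ0] at this
      exact this.mono_left (nhdsWithin_mono _ Ioi_subset_Ici_self)
    · have h1 := (q0_deriv hPB s 0).continuousAt.tendsto
      have h0 : q0 (hyp a b c) s 0 = 1 := by
        simp only [q0, psum]
        rw [tsum_eq_single 0 (fun n hn => by simp [hn])]
        simp [hyp_zero]
      rw [h0] at h1
      exact h1.mono_left nhdsWithin_le_nhds
  rw [cfun_eq hm₁, ← hgauss]
  have l1 : Tendsto (fun t : ℝ => Complex.exp ((rho m₁ m₂ - lam) * ((t - Real.log (Real.cosh t) : ℝ) : ℂ)))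
      atTop (𝓝 (Complex.exp ((rho m₁ m₂ - lam) * (Real.log 2 : ℝ)))) :=
    (Complex.continuous_exp.tendsto _).comp
      (((Complex.continuous_ofReal.tendsto _).comp cosh_lim).const_mul _)
  refine (l1.mul (psum_lim hsum)).congr' ?_
  filter_upwards [eventually_gt_atTop 0] with t ht
  rw [heq t ht, q0, ← mul_assoc, ← Complex.exp_add]
  congr 2
  rw [hs, rho]
  push_cast
  ring

end
end

section
/- Let m₁ ≥ 1 and m₂ ≥ 0 be integers, ρ = m₁/2 + m₂, r(y) = 2m₁·y²/(1−y²) + 4m₂·y⁴/(1−y⁴) and s(y) = 2m₁·y/(1−y²) + 4m₂·y³/(1−y⁴) (so s(y) = r(y)/y for y ≠ 0). Let λ ∈ ℂ with 2λ ∉ {0,−1,−2,…}, let ε ∈ (0,1), and let v : [0,ε) → ℂ be continuous on [0,ε) and twice continuously differentiable on (0,ε), such that u(y) = y^{ρ−λ}·v(y) satisfies y²·u''(y) + (1 − 2ρ − r(y))·y·u'(y) + (ρ² − λ²)·u(y) = 0 for all y ∈ (0,ε). Then for every smooth compactly supported f : ℝ → ℂ with support contained in (−ε,ε): ∫₀^ε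 v(y)·[ −(2λ+1)·f'(y) − y·f''(y) − (d/dy)(r(y)·f(y)) + (ρ−λ)·s(y)·f(y) ] dy = 2λ·v(0)·f(0). (Equivalently: the extension of v by zero to (−ε,ε) satisfies, in the sense of distributions, ((2λ−θ−1)∂_y + s(y)(θ+ρ−λ)) ṽ = 2λ·v(0)·δ₀, where θ = y∂_y.) -/
open Set Filter Topology MeasureTheory

noncomputable section

/-- `s(y) = 2m₁y/(1−y²) + 4m₂y³/(1−y⁴)`, so `s(y) = r(y)/y` for `y ≠ 0`. -/
def sFun (m₁ m₂ : ℕ) (y : ℝ) : ℝ :=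
  2 * m₁ * y / (1 - y ^ 2) + 4 * m₂ * y ^ 3 / (1 - y ^ 4)

/-- Rewriting the radial equation for `y^A v` as an equation for `v`. -/
lemma ode_conj (A lam ρ R : ℂ) (hA : A = ρ - lam) (ε : ℝ) (v : ℝ → ℂ)
    (h1 : ∀ y ∈ Ioo (0 : ℝ) ε, HasDerivAt v (deriv v y) y)
    (h2 : ∀ y ∈ Ioo (0 : ℝ) ε, HasDerivAt (deriv v) (deriv (deriv v) y) y)
    (y : ℝ) (hy : y ∈ Ioo (0 : ℝ) ε)
    (h : (y : ℂ) ^ 2 * deriv (deriv (fun z : ℝ => (z : ℂ) ^ A * v z)) y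
      + (1 - 2 * ρ - R) * (y : ℂ) * deriv (fun z : ℝ => (z : ℂ) ^ A * v z) y
      + (ρ ^ 2 - lam ^ 2) * ((y : ℂ) ^ A * v y) = 0) :
    (y : ℂ) ^ 2 * deriv (deriv v) y + (1 - 2 * lam) * y * deriv v y
      = R * (y * deriv v y + A * v y) := by
  have hp : ∀ (c : ℂ) (z : ℝ), z ∈ Ioo (0 : ℝ) ε →
      HasDerivAt (fun z : ℝ => (z : ℂ) ^ c) (c * (z : ℂ) ^ (c - 1)) z := by
    intro c z hz
    exact (Complex.hasStrictDerivAt_cpow_const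
      (Complex.ofReal_mem_slitPlane.2 hz.1)).hasDerivAt.comp_ofReal
  have d1 : ∀ z ∈ Ioo (0 : ℝ) ε, HasDerivAt (fun z : ℝ => (z : ℂ) ^ A * v z)
      (A * (z : ℂ) ^ (A - 1) * v z + (z : ℂ) ^ A * deriv v z) z :=
    fun z hz => (hp A z hz).mul (h1 z hz)
  have e1 : deriv (fun z : ℝ => (z : ℂ) ^ A * v z) =ᶠ[𝓝 y]
      fun z => A * (z : ℂ) ^ (A - 1) * v z + (z : ℂ) ^ A * deriv v z := by
    filter_upwards [Ioo_mem_nhds hy.1 hy.2] with z hz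
    exact (d1 z hz).deriv
  have d2 := ((((hp (A - 1) y hy).const_mul A).mul (h1 y hy)).add
    ((hp A y hy).mul (h2 y hy)))
  have e2 := (d2.congr_of_eventuallyEq e1).deriv
  rw [e2, e1.self_of_nhds] at h
  have hy0 : (y : ℂ) ≠ 0 := Complex.ofReal_ne_zero.2 hy.1.ne'
  have hpow : (y : ℂ) ^ A ≠ 0 := by simp [Complex.cpow_eq_zero_iff, hy0]
  have p1 : (y : ℂ) ^ (A - 1) = (y : ℂ) ^ A / y := by
    rw [Complex.cpow_sub _ _ hy0, Complex.cpow_one]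
  have p2 : (y : ℂ) ^ (A - 1 - 1) = (y : ℂ) ^ A / y / y := by
    rw [Complex.cpow_sub _ _ hy0, Complex.cpow_one, p1]
  simp only [p2, p1] at h
  apply mul_left_cancel₀ hpow
  field_simp at h
  have h' := h
  subst hA
  linear_combination h'

lemma bdd_near_right (A lam : ℂ) (R S : ℝ → ℂ) (ε : ℝ) (hε : ε ∈ Ioo (0 : ℝ) 1) (v : ℝ → ℂ)
    (hR : ContDiffOn ℝ 1 R (Ioo (-1) 1)) (hS : ContinuousOn S (Ioo (-1) 1))
    (h1 : ∀ y ∈ Ioo (0 : ℝ) ε, HasDerivAt v (deriv v y) y)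
    (h2 : ∀ y ∈ Ioo (0 : ℝ) ε, HasDerivAt (deriv v) (deriv (deriv v) y) y)
    (ho : ∀ y ∈ Ioo (0 : ℝ) ε, (y : ℂ) * deriv (deriv v) y + (1 - 2 * lam) * deriv v y
      = R y * deriv v y + A * S y * v y) :
    ∃ C, ∀ y ∈ Ico (ε / 2) ε, ‖v y‖ ≤ C ∧ ‖deriv v y‖ ≤ C := by
  obtain ⟨h0, hlt⟩ := hε
  have hsub : Icc (ε / 2) ε ⊆ Ioo (-1 : ℝ) 1 := fun x hx => ⟨by linarith [hx.1], by linarith [hx.2]⟩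
  have hc1 : ContinuousOn (fun y : ℝ => (2 * lam - 1 + R y) / (y : ℂ)) (Icc (ε / 2) ε) := by
    refine ContinuousOn.div (continuousOn_const.add (hR.continuousOn.mono hsub))
      Complex.continuous_ofReal.continuousOn ?_
    intro x hx
    exact Complex.ofReal_ne_zero.2 (by linarith [hx.1])
  have hc2 : ContinuousOn (fun y : ℝ => A * S y / (y : ℂ)) (Icc (ε / 2) ε) := by
    refine ContinuousOn.div (continuousOn_const.mul (hS.mono hsub))
      Complex.continuous_ofReal.continuousOn ?_
    intro x hx
    exact Complex.ofReal_ne_zero.2 (by linarith [hx.1])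
  obtain ⟨B1, hB1⟩ := isCompact_Icc.exists_bound_of_continuousOn hc1
  obtain ⟨B2, hB2⟩ := isCompact_Icc.exists_bound_of_continuousOn hc2
  have hmid : ε / 2 ∈ Icc (ε / 2) ε := ⟨le_rfl, by linarith⟩
  have hB1n : 0 ≤ B1 := (norm_nonneg _).trans (hB1 _ hmid)
  have hB2n : 0 ≤ B2 := (norm_nonneg _).trans (hB2 _ hmid)
  set K := 1 + B1 + B2 with hK
  set g : ℝ → ℂ × ℂ := fun y => (v y, deriv v y) with hg
  have hgd : ∀ y ∈ Ioo (0 : ℝ) ε, HasDerivAt g (deriv v y, deriv (deriv v) y) y :=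
    fun y hy => (h1 y hy).prodMk (h2 y hy)
  refine ⟨‖g (ε / 2)‖ * Real.exp (K * ε), fun y hy => ?_⟩
  have hin : ∀ x ∈ Icc (ε / 2) y, x ∈ Ioo (0 : ℝ) ε :=
    fun x hx => ⟨by linarith [hx.1], by linarith [hx.2, hy.2]⟩
  have key := norm_le_gronwallBound_of_norm_deriv_right_le (f := g)
    (f' := fun y => (deriv v y, deriv (deriv v) y)) (δ := ‖g (ε / 2)‖) (K := K) (ε := 0)
    (a := ε / 2) (b := y)
    (fun x hx => (hgd x (hin x hx)).continuousAt.continuousWithinAt)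
    (fun x hx => (hgd x (hin x ⟨hx.1, hx.2.le⟩)).hasDerivWithinAt) le_rfl
    (by
      intro x hx
      have hx' := hin x ⟨hx.1, hx.2.le⟩
      have hxI : x ∈ Icc (ε / 2) ε := ⟨hx.1, hx'.2.le⟩
      have hx0 : (x : ℂ) ≠ 0 := Complex.ofReal_ne_zero.2 hx'.1.ne'
      have e : deriv (deriv v) x = (2 * lam - 1 + R x) / (x : ℂ) * deriv v x
          + A * S x / (x : ℂ) * v x := by
        field_simp
        linear_combination ho x hx'
      have n1 : ‖v x‖ ≤ ‖g x‖ := norm_fst_le (g x)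
      have n2 : ‖deriv v x‖ ≤ ‖g x‖ := norm_snd_le (g x)
      have hgn := norm_nonneg (g x)
      rw [add_zero]
      refine max_le ?_ ?_
      · change ‖deriv v x‖ ≤ _
        rw [hK]
        nlinarith [mul_nonneg hB1n hgn, mul_nonneg hB2n hgn]
      · change ‖deriv (deriv v) x‖ ≤ _
        rw [e]
        calc _ ≤ ‖(2 * lam - 1 + R x) / (x : ℂ)‖ * ‖deriv v x‖ + ‖A * S x / (x : ℂ)‖ * ‖v x‖ := by
              rw [← norm_mul, ← norm_mul]; exact norm_add_le _ _
          _ ≤ B1 * ‖g x‖ + B2 * ‖g x‖ :=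
              add_le_add (mul_le_mul (hB1 x hxI) n2 (norm_nonneg _) hB1n)
                (mul_le_mul (hB2 x hxI) n1 (norm_nonneg _) hB2n)
          _ ≤ K * ‖g x‖ := by rw [hK]; nlinarith)
    y ⟨hy.1, le_rfl⟩
  rw [gronwallBound_ε0] at key
  have hle : ‖g y‖ ≤ ‖g (ε / 2)‖ * Real.exp (K * ε) := by
    refine key.trans (mul_le_mul_of_nonneg_left (Real.exp_le_exp.2 ?_) (norm_nonneg _))
    apply mul_le_mul_of_nonneg_left _ (by positivity)
    linarith [hy.2]
  exact ⟨(norm_fst_le (g y)).trans hle, (norm_snd_le (g y)).trans hle⟩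

lemma lim_theta_zero (A lam : ℂ) (R S : ℝ → ℂ) (ε : ℝ) (hε : ε ∈ Ioo (0 : ℝ) 1) (v : ℝ → ℂ)
    (hR : ContDiffOn ℝ 1 R (Ioo (-1) 1)) (hS : ContinuousOn S (Ioo (-1) 1))
    (hvc : ContinuousOn v (Ico 0 ε))
    (h1 : ∀ y ∈ Ioo (0 : ℝ) ε, HasDerivAt v (deriv v y) y)
    (h2 : ∀ y ∈ Ioo (0 : ℝ) ε, HasDerivAt (deriv v) (deriv (deriv v) y) y)
    (ho : ∀ y ∈ Ioo (0 : ℝ) ε, (y : ℂ) * deriv (deriv v) y + (1 - 2 * lam) * deriv v y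
      = R y * deriv v y + A * S y * v y) :
    Tendsto (fun y : ℝ => (y : ℂ) * deriv v y) (𝓝[>] 0) (𝓝 0) := by
  obtain ⟨h0, hlt⟩ := hε
  have hsub : Icc 0 (ε / 2) ⊆ Ioo (-1 : ℝ) 1 := fun x hx => ⟨by linarith [hx.1], by linarith [hx.2]⟩
  have hR1 : ∀ y ∈ Ioo (-1 : ℝ) 1, HasDerivAt R (deriv R y) y := fun y hy =>
    ((hR.differentiableOn one_ne_zero).differentiableAt (Ioo_mem_nhds hy.1 hy.2)).hasDerivAt
  have hR' : ContinuousOn (deriv R) (Ioo (-1) 1) := hR.continuousOn_deriv_of_isOpen isOpen_Ioo le_rfl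
  have hid : ∀ y : ℝ, HasDerivAt (fun y : ℝ => (y : ℂ)) 1 y := fun y => Complex.ofRealCLM.hasDerivAt
  have hv0 : Tendsto v (𝓝[>] 0) (𝓝 (v 0)) :=
    (hvc 0 ⟨le_rfl, h0⟩).mono_left (by
      rw [nhdsWithin_Ico_eq_nhdsGE h0]; exact nhdsWithin_mono _ Ioi_subset_Ici_self)
  set k : ℝ → ℂ := fun y => (A * S y - deriv R y) * v y with hk
  have hkc : ContinuousOn k (Icc 0 (ε / 2)) :=
    ((continuousOn_const.mul (hS.mono hsub)).sub (hR'.mono hsub)).mul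
      (hvc.mono fun x hx => ⟨hx.1, by linarith [hx.2]⟩)
  set h : ℝ → ℂ := fun y => (y : ℂ) * deriv v y - (2 * lam + R y) * v y with hh
  have hd : ∀ y ∈ Ioo (0 : ℝ) ε, HasDerivAt h (k y) y := by
    intro y hy
    have hyR : y ∈ Ioo (-1 : ℝ) 1 := ⟨by linarith [hy.1], by linarith [hy.2]⟩
    have := ((hid y).mul (h2 y hy)).sub (((hR1 y hyR).const_add (2 * lam)).mul (h1 y hy))
    refine this.congr_deriv ?_
    simp only [hk]
    linear_combination ho y hy
  have hint : ∀ y ∈ Ioc (0 : ℝ) (ε / 2), h y = h (ε / 2) - ∫ t in y..(ε / 2), k t := by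
    intro y hy
    rw [intervalIntegral.integral_eq_sub_of_hasDerivAt (f := h)]
    · ring
    · intro x hx
      rw [uIcc_of_le hy.2] at hx
      exact hd x ⟨by linarith [hx.1, hy.1], by linarith [hx.2]⟩
    · apply ContinuousOn.intervalIntegrable
      rw [uIcc_of_le hy.2]
      exact hkc.mono (Icc_subset_Icc hy.1.le le_rfl)
  have hpr : ContinuousOn (fun x => ∫ t in x..(ε / 2), k t) (Icc 0 (ε / 2)) := by
    have := intervalIntegral.continuousOn_primitive_interval_left (f := k) (μ := volume)
      (a := 0) (b := ε / 2) (by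
        rw [uIcc_of_le (by linarith)]; exact hkc.integrableOn_Icc)
    rwa [uIcc_of_le (by linarith)] at this
  have hmem : Ioc (0 : ℝ) (ε / 2) ∈ 𝓝[>] (0 : ℝ) := Ioc_mem_nhdsGT (by linarith)
  have hpr0 := (hpr 0 ⟨le_rfl, by linarith⟩).mono_left
    (nhdsWithin_le_of_mem (mem_of_superset hmem Ioc_subset_Icc_self) :
      𝓝[>] (0 : ℝ) ≤ 𝓝[Icc 0 (ε / 2)] 0)
  have hhl : ∃ l, Tendsto h (𝓝[>] 0) (𝓝 l) := by
    refine ⟨_, ((tendsto_const_nhds (x := h (ε / 2))).sub hpr0).congr' ?_⟩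
    filter_upwards [hmem] with y hy
    exact (hint y hy).symm
  obtain ⟨l, hl⟩ := hhl
  have hR0 : Tendsto R (𝓝[>] 0) (𝓝 (R 0)) :=
    (hR1 0 ⟨by norm_num, by norm_num⟩).continuousAt.tendsto.mono_left nhdsWithin_le_nhds
  obtain ⟨m, hm⟩ : ∃ m, Tendsto (fun y : ℝ => (y : ℂ) * deriv v y) (𝓝[>] 0) (𝓝 m) := by
    refine ⟨l + (2 * lam + R 0) * v 0,
      (hl.add ((tendsto_const_nhds.add hR0).mul hv0)).congr fun y => ?_⟩
    simp [hh]
  -- identify the limit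
  have gd : ∀ y ∈ Ioo (0 : ℝ) ε, HasDerivAt (fun y : ℝ => (y : ℂ) * (v y - v 0))
      (1 * (v y - v 0) + (y : ℂ) * deriv v y) y := fun y hy =>
    (hid y).mul ((h1 y hy).sub_const _)
  have hmem' : Ioo (0 : ℝ) ε ∈ 𝓝[>] (0 : ℝ) := Ioo_mem_nhdsGT h0
  have hid0 : Tendsto (fun y : ℝ => (y : ℂ)) (𝓝[>] 0) (𝓝 0) := by
    have := (hid 0).continuousAt.tendsto.mono_left (nhdsWithin_le_nhds (s := Ioi 0))
    simpa using this
  have hvs : Tendsto (fun y => v y - v 0) (𝓝[>] 0) (𝓝 0) := by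
    simpa using hv0.sub_const (v 0)
  have D1 : HasDerivWithinAt (fun y : ℝ => (y : ℂ) * (v y - v 0)) m (Ici 0) 0 := by
    apply hasDerivWithinAt_Ici_of_tendsto_deriv (s := Ioo 0 ε)
    · exact fun y hy => (gd y hy).differentiableAt.differentiableWithinAt
    · have : Tendsto (fun y : ℝ => (y : ℂ) * (v y - v 0)) (𝓝[>] 0) (𝓝 0) := by
        simpa using hid0.mul hvs
      change Tendsto _ _ _
      simpa using this.mono_left (nhdsWithin_mono _ Ioo_subset_Ioi_self)
    · exact hmem'
    · have := hvs.add hm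
      rw [zero_add] at this
      refine this.congr' ?_
      filter_upwards [hmem'] with y hy
      rw [(gd y hy).deriv, one_mul]
  have D2 : HasDerivWithinAt (fun y : ℝ => (y : ℂ) * (v y - v 0)) 0 (Ici 0) 0 := by
    rw [hasDerivWithinAt_iff_tendsto_slope]
    have : Ici (0 : ℝ) \ {0} = Ioi 0 := by simp
    rw [this]
    refine hvs.congr' ?_
    filter_upwards [self_mem_nhdsWithin] with y hy
    have hy0 : (y : ℂ) ≠ 0 := Complex.ofReal_ne_zero.2 (ne_of_gt hy)
    simp [slope, hy0]
  have : m = 0 := (uniqueDiffOn_Ici (0 : ℝ) 0 (by simp)).eq_deriv _ D1 D2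
  rwa [this] at hm

lemma smooth_rFun (m₁ m₂ : ℕ) : ContDiffOn ℝ 1 (fun y => (rFun m₁ m₂ y : ℂ)) (Ioo (-1) 1) := by
  suffices h : ContDiffOn ℝ 1 (rFun m₁ m₂) (Ioo (-1) 1) from
    Complex.ofRealCLM.contDiff.comp_contDiffOn h
  unfold rFun
  refine ContDiffOn.add (ContDiffOn.div (by fun_prop) (by fun_prop) ?_)
    (ContDiffOn.div (by fun_prop) (by fun_prop) ?_)
  · intro x hx
    nlinarith [hx.1, hx.2]
  · intro x hx
    have : x ^ 2 < 1 := by nlinarith [hx.1, hx.2]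
    nlinarith [sq_nonneg x]

lemma cont_sFun (m₁ m₂ : ℕ) : ContinuousOn (fun y => (sFun m₁ m₂ y : ℂ)) (Ioo (-1) 1) := by
  apply Complex.continuous_ofReal.comp_continuousOn
  unfold sFun
  refine ContinuousOn.add (ContinuousOn.div (by fun_prop) (by fun_prop) ?_)
    (ContinuousOn.div (by fun_prop) (by fun_prop) ?_)
  · intro x hx
    nlinarith [hx.1, hx.2]
  · intro x hx
    have : x ^ 2 < 1 := by nlinarith [hx.1, hx.2]
    nlinarith [sq_nonneg x]

lemma main_abs (A lam : ℂ) (R S : ℝ → ℂ) (ε : ℝ) (hε : ε ∈ Ioo (0 : ℝ) 1) (v : ℝ → ℂ)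
    (hR : ContDiffOn ℝ 1 R (Ioo (-1) 1)) (hS : ContinuousOn S (Ioo (-1) 1)) (hR00 : R 0 = 0)
    (hvc : ContinuousOn v (Ico 0 ε))
    (h1 : ∀ y ∈ Ioo (0 : ℝ) ε, HasDerivAt v (deriv v y) y)
    (h2 : ∀ y ∈ Ioo (0 : ℝ) ε, HasDerivAt (deriv v) (deriv (deriv v) y) y)
    (ho : ∀ y ∈ Ioo (0 : ℝ) ε, (y : ℂ) * deriv (deriv v) y + (1 - 2 * lam) * deriv v y
      = R y * deriv v y + A * S y * v y)
    (f : ℝ → ℂ) (hf : ContDiff ℝ (⊤ : ℕ∞) f) (hfs : Function.support f ⊆ Ioo (-ε) ε) :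
    ∫ y in Ioo (0 : ℝ) ε, v y * (-(2 * lam + 1) * deriv f y - (y : ℂ) * deriv (deriv f) y
            - deriv (fun z : ℝ => R z * f z) y + A * S y * f y)
        = 2 * lam * v 0 * f 0 := by
  have hw := lim_theta_zero A lam R S ε hε v hR hS hvc h1 h2 ho
  obtain ⟨C, hC⟩ := bdd_near_right A lam R S ε hε v hR hS h1 h2 ho
  obtain ⟨h0, hlt⟩ := hε
  have hsub : Icc 0 ε ⊆ Ioo (-1 : ℝ) 1 := fun x hx => ⟨by linarith [hx.1], by linarith [hx.2]⟩
  have hR1 : ∀ y ∈ Ioo (-1 : ℝ) 1, HasDerivAt R (deriv R y) y := fun y hy =>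
    ((hR.differentiableOn one_ne_zero).differentiableAt (Ioo_mem_nhds hy.1 hy.2)).hasDerivAt
  have hid : ∀ y : ℝ, HasDerivAt (fun y : ℝ => (y : ℂ)) 1 y := fun y => Complex.ofRealCLM.hasDerivAt
  have hidc : Continuous (fun y : ℝ => (y : ℂ)) := Complex.continuous_ofReal
  have hv0 : Tendsto v (𝓝[>] 0) (𝓝 (v 0)) :=
    (hvc 0 ⟨le_rfl, h0⟩).mono_left (by
      rw [nhdsWithin_Ico_eq_nhdsGE h0]; exact nhdsWithin_mono _ Ioi_subset_Ici_self)
  have hf' : ContDiff ℝ (⊤ : ℕ∞) (deriv f) := (contDiff_infty_iff_deriv.1 hf).2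
  have hf'' : ContDiff ℝ (⊤ : ℕ∞) (deriv (deriv f)) := (contDiff_infty_iff_deriv.1 hf').2
  have hfd : ∀ y, HasDerivAt f (deriv f y) y := fun y =>
    ((contDiff_infty_iff_deriv.1 hf).1 y).hasDerivAt
  have hfd' : ∀ y, HasDerivAt (deriv f) (deriv (deriv f) y) y := fun y =>
    ((contDiff_infty_iff_deriv.1 hf').1 y).hasDerivAt
  have hRf : ContDiffOn ℝ 1 (fun z => R z * f z) (Ioo (-1) 1) :=
    hR.mul ((hf.of_le (by exact_mod_cast le_top)).contDiffOn)
  have hRf' := hRf.continuousOn_deriv_of_isOpen isOpen_Ioo le_rfl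
  have hRfd : ∀ y ∈ Ioo (-1 : ℝ) 1, HasDerivAt (fun z => R z * f z)
      (deriv (fun z => R z * f z) y) y := fun y hy =>
    ((hRf.differentiableOn one_ne_zero).differentiableAt (Ioo_mem_nhds hy.1 hy.2)).hasDerivAt
  -- vanishing at `ε`
  have hz : ∀ y, ε ≤ y → f y = 0 := by
    intro y hy
    by_contra hne
    exact absurd (hfs hne).2 (not_lt.2 hy)
  have hfε : f ε = 0 := hz ε le_rfl
  have hfε' : deriv f ε = 0 := by
    have a1 : HasDerivWithinAt f (deriv f ε) (Ici ε) ε := (hfd ε).hasDerivWithinAt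
    have a2 : HasDerivWithinAt f 0 (Ici ε) ε :=
      (hasDerivWithinAt_const ε (Ici ε) (0 : ℂ)).congr (fun y hy => hz y hy) hfε
    exact (uniqueDiffOn_Ici ε ε (by simp)).eq_deriv _ a1 a2
  -- boundedness of `v`
  have hvb : ∃ B, ∀ y ∈ Ioo (0 : ℝ) ε, ‖v y‖ ≤ B := by
    obtain ⟨B, hB⟩ := isCompact_Icc.exists_bound_of_continuousOn
      (hvc.mono (fun x hx => ⟨hx.1, by linarith [hx.2]⟩ : Icc 0 (ε / 2) ⊆ Ico 0 ε))
    refine ⟨max B C, fun y hy => ?_⟩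
    rcases le_total y (ε / 2) with hle | hle
    · exact (hB y ⟨hy.1.le, hle⟩).trans (le_max_left _ _)
    · exact (hC y ⟨hle, hy.2⟩).1.trans (le_max_right _ _)
  obtain ⟨B, hB⟩ := hvb
  set q : ℝ → ℂ := fun y => -(2 * lam + 1) * deriv f y - (y : ℂ) * deriv (deriv f) y
            - deriv (fun z : ℝ => R z * f z) y + A * S y * f y with hq
  have hqc : ContinuousOn q (Icc 0 ε) :=
    (((continuous_const.mul hf'.continuous).sub (hidc.mul hf''.continuous)).continuousOn.sub
      (hRf'.mono hsub)).add ((continuousOn_const.mul (hS.mono hsub)).mul hf.continuous.continuousOn)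
  have hint : IntegrableOn (fun y => v y * q y) (Ioo 0 ε) := by
    have hqi : IntegrableOn q (Ioo 0 ε) := hqc.integrableOn_Icc.mono_set Ioo_subset_Icc_self
    refine Integrable.bdd_mul (c := B) hqi ?_ ?_
    · exact (hvc.mono Ioo_subset_Ico_self).aestronglyMeasurable measurableSet_Ioo
    · exact (ae_restrict_iff' measurableSet_Ioo).2 (Eventually.of_forall hB)
  set F : ℝ → ℂ := fun y => (y : ℂ) * deriv v y * f y
    - v y * (2 * lam * f y + (y : ℂ) * deriv f y + R y * f y) with hF
  have hFd : ∀ y ∈ Ioo (0 : ℝ) ε, HasDerivAt F (v y * q y) y := by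
    intro y hy
    have t := (((hid y).mul (h2 y hy)).mul (hfd y)).sub ((h1 y hy).mul
      ((((hfd y).const_mul (2 * lam)).add ((hid y).mul (hfd' y))).add
        (hRfd y (hsub ⟨hy.1.le, hy.2.le⟩))))
    refine t.congr_deriv ?_
    simp only [hq, Pi.mul_apply, Pi.add_apply]
    linear_combination (f y) * ho y hy
  have hR0 : Tendsto R (𝓝[>] 0) (𝓝 0) := by
    rw [← hR00]
    exact (hR1 0 ⟨by norm_num, by norm_num⟩).continuousAt.tendsto.mono_left nhdsWithin_le_nhds
  have lim0 : Tendsto F (𝓝[>] 0) (𝓝 (-(2 * lam * v 0 * f 0))) := by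
    have tf : Tendsto f (𝓝[>] 0) (𝓝 (f 0)) := hf.continuous.continuousAt.mono_left nhdsWithin_le_nhds
    have tf' : Tendsto (deriv f) (𝓝[>] 0) (𝓝 (deriv f 0)) :=
      hf'.continuous.continuousAt.mono_left nhdsWithin_le_nhds
    have ti : Tendsto (fun y : ℝ => (y : ℂ)) (𝓝[>] 0) (𝓝 ((0 : ℝ) : ℂ)) :=
      hidc.continuousAt.mono_left nhdsWithin_le_nhds
    have := (hw.mul tf).sub (hv0.mul (((tf.const_mul (2 * lam)).add (ti.mul tf')).add (hR0.mul tf)))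
    convert this using 2
    push_cast
    ring
  have hb : ∀ᶠ y in 𝓝[<] ε, y ∈ Ico (ε / 2) ε := Ico_mem_nhdsLT (by linarith)
  have limε : Tendsto F (𝓝[<] ε) (𝓝 0) := by
    have tv : IsBoundedUnder (· ≤ ·) (𝓝[<] ε) (norm ∘ v) :=
      isBoundedUnder_of_eventually_le (a := C) (hb.mono fun y hy => (hC y hy).1)
    have tv' : IsBoundedUnder (· ≤ ·) (𝓝[<] ε) (norm ∘ deriv v) :=
      isBoundedUnder_of_eventually_le (a := C) (hb.mono fun y hy => (hC y hy).2)
    have tf : Tendsto f (𝓝[<] ε) (𝓝 (f ε)) := hf.continuous.continuousAt.mono_left nhdsWithin_le_nhds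
    have tf' : Tendsto (deriv f) (𝓝[<] ε) (𝓝 (deriv f ε)) :=
      hf'.continuous.continuousAt.mono_left nhdsWithin_le_nhds
    have ti : Tendsto (fun y : ℝ => (y : ℂ)) (𝓝[<] ε) (𝓝 (ε : ℂ)) :=
      hidc.continuousAt.mono_left nhdsWithin_le_nhds
    have tR : Tendsto R (𝓝[<] ε) (𝓝 (R ε)) :=
      (hR1 ε (hsub ⟨h0.le, le_rfl⟩)).continuousAt.tendsto.mono_left nhdsWithin_le_nhds
    have p1 : Tendsto (fun y : ℝ => (y : ℂ) * f y) (𝓝[<] ε) (𝓝 0) := by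
      simpa [hfε] using ti.mul tf
    have p2 : Tendsto (fun y : ℝ => 2 * lam * f y + (y : ℂ) * deriv f y + R y * f y)
        (𝓝[<] ε) (𝓝 0) := by
      simpa [hfε, hfε'] using ((tf.const_mul (2 * lam)).add (ti.mul tf')).add (tR.mul tf)
    have z1 := isBoundedUnder_le_mul_tendsto_zero tv' p1
    have z2 := isBoundedUnder_le_mul_tendsto_zero tv p2
    have := z1.sub z2
    rw [sub_zero] at this
    refine this.congr fun y => ?_
    simp only [hF]
    ring
  have fin := intervalIntegral.integral_eq_sub_of_hasDerivAt_of_tendsto h0 hFd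
    ((intervalIntegrable_iff_integrableOn_Ioo_of_le h0.le).2 hint) lim0 limε
  rw [intervalIntegral.integral_of_le h0.le, integral_Ioc_eq_integral_Ioo] at fin
  rw [fin]
  ring

theorem boundary_value_distributional_identity (m₁ m₂ : ℕ) (hm₁ : 1 ≤ m₁) (lam : ℂ)
    (hlam : ∀ n : ℕ, 2 * lam ≠ -(n : ℂ))
    (ε : ℝ) (hε : ε ∈ Set.Ioo (0 : ℝ) 1) (v : ℝ → ℂ)
    (hvc : ContinuousOn v (Set.Ico 0 ε)) (hv2 : ContDiffOn ℝ 2 v (Set.Ioo 0 ε))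
    (hODE : ∀ y ∈ Set.Ioo (0 : ℝ) ε,
      RadialODE m₁ m₂ lam (fun z : ℝ => (z : ℂ) ^ ((rho m₁ m₂ : ℂ) - lam) * v z) y) :
    ∀ f : ℝ → ℂ, ContDiff ℝ (⊤ : ℕ∞) f → HasCompactSupport f →
      Function.support f ⊆ Set.Ioo (-ε) ε →
      ∫ y in Set.Ioo (0 : ℝ) ε,
          v y * (-(2 * lam + 1) * deriv f y - (y : ℂ) * deriv (deriv f) y
            - deriv (fun z : ℝ => (rFun m₁ m₂ z : ℂ) * f z) y
            + ((rho m₁ m₂ : ℂ) - lam) * (sFun m₁ m₂ y : ℂ) * f y)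
        = 2 * lam * v 0 * f 0 := by
  intro f hf _ hfs
  have hv2' : ContDiffOn ℝ (1 + 1) v (Ioo 0 ε) := by
    rw [one_add_one_eq_two]; exact hv2
  obtain ⟨hd1, -, hd2⟩ := (contDiffOn_succ_iff_deriv_of_isOpen isOpen_Ioo).1 hv2'
  have h1 : ∀ y ∈ Ioo (0 : ℝ) ε, HasDerivAt v (deriv v y) y := fun y hy =>
    (hd1.differentiableAt (Ioo_mem_nhds hy.1 hy.2)).hasDerivAt
  have h2 : ∀ y ∈ Ioo (0 : ℝ) ε, HasDerivAt (deriv v) (deriv (deriv v) y) y := fun y hy =>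
    ((hd2.differentiableOn one_ne_zero).differentiableAt (Ioo_mem_nhds hy.1 hy.2)).hasDerivAt
  refine main_abs _ lam (fun y => (rFun m₁ m₂ y : ℂ)) (fun y => (sFun m₁ m₂ y : ℂ)) ε hε v
    (smooth_rFun m₁ m₂) (cont_sFun m₁ m₂) (by simp [rFun]) hvc h1 h2 ?_ f hf hfs
  intro y hy
  have e := ode_conj _ lam _ _ rfl ε v h1 h2 y hy (hODE y hy)
  have hrs : (rFun m₁ m₂ y : ℂ) = y * (sFun m₁ m₂ y : ℂ) := by
    rw [← Complex.ofReal_mul]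
    congr 1
    unfold rFun sFun
    ring
  have hy0 : (y : ℂ) ≠ 0 := Complex.ofReal_ne_zero.2 hy.1.ne'
  apply mul_left_cancel₀ hy0
  linear_combination e + ((rho m₁ m₂ : ℂ) - lam) * v y * hrs

end
end
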